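/- Generic Solid Poincaré–Bendixson Theorem (Theorem D): Let Φ be a C^{1,α}-smooth semiflow (C¹ with locally α-Hölder derivative, α ∈ (0,1]) on X strongly focusing monotone with respect to the k-cone C with rank k = 2, satisfying the standing assumptions. Let D ⊆ X be an open bounded set such that O⁺(D) = ⋃_{x∈D} O⁺(x) is precompact. Then there exists an open dense subset D′ ⊆ D such that for every x ∈ D′, either ω(x) is a nontrivial periodic orbit, or for every z ∈ ω(x) one has ω(z) ⊆ E and α(z) ⊆ E, where α(z) is the α-limit set of z along the flow extension of Φ on ω(x). -/

import Mathlib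

open Set Metric Filter

/-- A semiflow on `X`: continuous on `[0,∞) × X`, `Φ₀ = id`, `Φ_{s+t} = Φ_s ∘ Φ_t`. -/
structure Semiflow (X : Type*) [NormedAddCommGroup X] [NormedSpace ℝ X] where
  toFun : ℝ → X → X
  cont : ContinuousOn (fun p : ℝ × X => toFun p.1 p.2) (Set.Ici (0:ℝ) ×ˢ Set.univ)
  map_zero : ∀ x, toFun 0 x = x
  map_add : ∀ s t : ℝ, 0 ≤ s → 0 ≤ t → ∀ x, toFun (s + t) x = toFun s (toFun t x)

section Defs

variable {X : Type*} [NormedAddCommGroup X] [NormedSpace ℝ X]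

/-- A cone of rank `k`: a closed set, stable under all real scalings, containing a
`k`-dimensional subspace and no subspace of higher dimension. -/
def IsKCone (C : Set X) (k : ℕ) : Prop :=
  IsClosed C ∧ (∀ (t : ℝ) (v : X), v ∈ C → t • v ∈ C) ∧
  (∃ W : Submodule ℝ X, (W : Set X) ⊆ C ∧ Module.rank ℝ W = k) ∧
  (∀ W : Submodule ℝ X, (W : Set X) ⊆ C → Module.rank ℝ W ≤ k)

/-- `C` is `k`-solid: some `k`-dimensional subspace `W` has `W \ {0} ⊆ int C`. -/
def IsKSolid (C : Set X) (k : ℕ) : Prop :=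
  ∃ W : Submodule ℝ X, Module.rank ℝ W = k ∧ ((W : Set X) \ {0}) ⊆ interior C

/-- `C` is complemented: some closed subspace of codimension `k` meets `C` only at `0`. -/
def IsComplementedCone (C : Set X) (k : ℕ) : Prop :=
  ∃ H : Submodule ℝ X, IsClosed (H : Set X) ∧ Module.rank ℝ (X ⧸ H) = k ∧
    (H : Set X) ∩ C = {0}

/-- The positive semiorbit `O⁺(x)`. -/
def posOrbit (Φ : Semiflow X) (x : X) : Set X := {y | ∃ t, 0 ≤ t ∧ y = Φ.toFun t x}

/-- The ω-limit set `ω(x) = ⋂_{s ≥ 0} cl {Φ_t(x) : t ≥ s}`. -/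
def omegaSet (Φ : Semiflow X) (x : X) : Set X :=
  ⋂ s ∈ Set.Ici (0:ℝ), closure {y | ∃ t, s ≤ t ∧ y = Φ.toFun t x}

/-- The set of equilibria of `Φ`. -/
def equilibria (Φ : Semiflow X) : Set X := {p | ∀ t, 0 ≤ t → Φ.toFun t p = p}

/-- `S` is invariant: `Φ_t(S) = S` for all `t ≥ 0`. -/
def Invariant (Φ : Semiflow X) (S : Set X) : Prop := ∀ t, 0 ≤ t → Φ.toFun t '' S = S

/-- A set is ordered w.r.t. `C` if any two of its points are ordered. -/
def OrderedSet (C S : Set X) : Prop := ∀ x ∈ S, ∀ y ∈ S, x - y ∈ C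

/-- A set is unordered w.r.t. `C` if it is not a singleton and any two distinct points are
unordered. -/
def UnorderedSet (C S : Set X) : Prop :=
  (¬ ∃ a, S = {a}) ∧ ∀ x ∈ S, ∀ y ∈ S, x ≠ y → x - y ∉ C

/-- Two sets `A ∼ B`: every point of `A` is ordered with every point of `B`. -/
def SetsOrdered (C A B : Set X) : Prop := ∀ a ∈ A, ∀ b ∈ B, a - b ∈ C

/-- `Φ` is strongly monotone with respect to the cone `C`. -/
def StronglyMonotone (Φ : Semiflow X) (C : Set X) : Prop :=
  (∀ t, 0 ≤ t → ∀ x y : X, x - y ∈ C → Φ.toFun t x - Φ.toFun t y ∈ C) ∧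
  (∀ t, 0 < t → ∀ x y : X, x - y ∈ C → x ≠ y → Φ.toFun t x - Φ.toFun t y ∈ interior C)

/-- `O⁺(x)` is pseudo-ordered. -/
def PseudoOrdered (Φ : Semiflow X) (C : Set X) (x : X) : Prop :=
  ∃ t₁ t₂ : ℝ, 0 ≤ t₁ ∧ 0 ≤ t₂ ∧ Φ.toFun t₁ x ≠ Φ.toFun t₂ x ∧
    Φ.toFun t₁ x - Φ.toFun t₂ x ∈ C

/-- A bounded operator `R` is strongly focusing w.r.t. `C` with separation index `κ`:
`0 ∉ R(C \ {0})` and every unit vector of `RC` is at distance at least `κ` from `X \ C`. -/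
def StronglyFocusing (R : X →L[ℝ] X) (C : Set X) (κ : ℝ) : Prop :=
  (∀ v ∈ C, v ≠ 0 → R v ≠ 0) ∧
  (∀ v ∈ R '' C, ‖v‖ = 1 → ∀ u ∉ C, κ ≤ ‖v - u‖)

/-- `Φ` is strongly focusing monotone with respect to `C`, with `x`-derivative `DΦ`. -/
def StronglyFocusingMonotone (Φ : Semiflow X) (DΦ : ℝ → X → X →L[ℝ] X) (C : Set X) : Prop :=
  (∀ t, 0 ≤ t → ∀ x : X, HasFDerivAt (Φ.toFun t) (DΦ t x) x) ∧
  (∀ t, 0 ≤ t → Continuous fun x : X => DΦ t x) ∧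
  StronglyMonotone Φ C ∧
  (∀ t, 0 < t → ∀ x : X, ∀ v ∈ C, v ≠ 0 → DΦ t x v ∈ interior C) ∧
  (∀ S : Set X, IsCompact S → Invariant Φ S →
    ∃ δ > (0:ℝ), ∃ T > (0:ℝ), ∃ κ > (0:ℝ), ∀ z ∈ S, ∀ x ∈ Metric.closedBall z δ,
      ∀ y ∈ Metric.closedBall z δ, ∃ R : X →L[ℝ] X,
        StronglyFocusing R C κ ∧ R (x - y) = Φ.toFun T x - Φ.toFun T y)

/-- `ψ` is a flow extension of `Φ` on the invariant set `S`. -/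
def IsFlowExtensionOn (Φ : Semiflow X) (ψ : ℝ → X → X) (S : Set X) : Prop :=
  (∀ t, 0 ≤ t → ∀ z ∈ S, ψ t z = Φ.toFun t z) ∧
  (∀ t : ℝ, ∀ z ∈ S, ψ t z ∈ S) ∧
  (∀ s t : ℝ, ∀ z ∈ S, ψ s (ψ t z) = ψ (s + t) z) ∧
  ContinuousOn (fun p : ℝ × X => ψ p.1 p.2) (Set.univ ×ˢ S)

/-- `Φ` admits a flow extension on each ω-limit set. -/
def AdmitsFlowExtensions (Φ : Semiflow X) : Prop :=
  ∀ x : X, ∃ ψ : ℝ → X → X, IsFlowExtensionOn Φ ψ (omegaSet Φ x)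

/-- The α-limit set of `z` along the (extended) flow `ψ`. -/
def alphaSet (ψ : ℝ → X → X) (z : X) : Set X :=
  ⋂ s ∈ Set.Ici (0:ℝ), closure {y | ∃ t, s ≤ t ∧ y = ψ (-t) z}

/-- Standing assumptions: `C` is a complemented `k`-solid `k`-cone, the derivative
`D_xΦ_t` is a compact operator for all `x` and `t > 0`, and `Φ` admits a flow extension on
each ω-limit set. -/
def StandingAssumptions (Φ : Semiflow X) (DΦ : ℝ → X → X →L[ℝ] X)
    (C : Set X) (k : ℕ) : Prop :=
  IsKCone C k ∧ IsKSolid C k ∧ IsComplementedCone C k ∧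
  (∀ t, 0 < t → ∀ x : X, IsCompactOperator ⇑(DΦ t x)) ∧
  AdmitsFlowExtensions Φ

end Defs

/-- `Φ` is `C^{1,α}`-smooth: `C¹` in `x` with locally `α`-Hölder derivative. -/
def COneAlpha {X : Type*} [NormedAddCommGroup X] [NormedSpace ℝ X]
    (Φ : Semiflow X) (DΦ : ℝ → X → X →L[ℝ] X) (α : ℝ) : Prop :=
  (∀ t, 0 ≤ t → ∀ x : X, HasFDerivAt (Φ.toFun t) (DΦ t x) x) ∧
  (∀ t, 0 ≤ t → ∀ x : X, ∃ U ∈ nhds x, ∃ L : ℝ, 0 ≤ L ∧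
    ∀ u ∈ U, ∀ v ∈ U, ‖DΦ t u - DΦ t v‖ ≤ L * ‖u - v‖ ^ α)

theorem exists_continuous_log {A : Type*} [TopologicalSpace A] [SimplyConnectedSpace A]
    [LocallyPathConnectedSpace A] {g : A → ℂ} (hg : Continuous g) (h0 : ∀ a, g a ≠ 0) :
    ∃ L : A → ℂ, Continuous L ∧ ∀ a, Complex.exp (L a) = g a := by
  obtain ⟨a₀⟩ := (inferInstance : Nonempty A)
  obtain ⟨F, ⟨-, hF⟩, -⟩ := Complex.isCoveringMapOn_exp.existsUnique_continuousMap_lifts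
    (⟨g, hg⟩ : C(A, ℂ)) (a₀ := a₀) (e₀ := Complex.log (g a₀)) (Complex.exp_log (h0 a₀))
    (fun a => by simpa using h0 a)
  exact ⟨F, F.continuous, fun a => congrFun hF a⟩

theorem cos_im_nonneg {z : ℂ} (h : 0 ≤ (Complex.exp z).re) : 0 ≤ Real.cos z.im := by
  rw [Complex.exp_re] at h
  exact nonneg_of_mul_nonneg_right h (Real.exp_pos _)

theorem cos_im_pos {z : ℂ} (h : 0 < (Complex.exp z).re) : 0 < Real.cos z.im := by
  rw [Complex.exp_re] at h
  exact (mul_pos_iff_of_pos_left (Real.exp_pos _)).1 h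

theorem exists_band {x : ℝ} (h : 0 ≤ Real.cos x) :
    ∃ n : ℤ, |x - 2 * Real.pi * n| ≤ Real.pi / 2 := by
  have hpi := Real.pi_pos
  refine ⟨round (x / (2 * Real.pi)), ?_⟩
  set n := round (x / (2 * Real.pi))
  have h1 : |x / (2 * Real.pi) - n| ≤ 1 / 2 := abs_sub_round _
  have h2 : |x - 2 * Real.pi * n| ≤ Real.pi := by
    have : x - 2 * Real.pi * n = (2 * Real.pi) * (x / (2 * Real.pi) - n) := by
      field_simp
    rw [this, abs_mul, abs_of_pos (by positivity)]
    nlinarith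
  by_contra hc
  push Not at hc
  have h3 : Real.cos |x - 2 * Real.pi * n| < 0 :=
    Real.cos_neg_of_pi_div_two_lt_of_lt hc (by linarith)
  rw [Real.cos_abs, show x - 2 * Real.pi * n = x - n * (2 * Real.pi) by ring,
    Real.cos_sub_int_mul_two_pi] at h3
  linarith

theorem exists_strict_band {x : ℝ} (h : 0 < Real.cos x) :
    ∃ n : ℤ, |x - 2 * Real.pi * n| < Real.pi / 2 := by
  obtain ⟨n, hn⟩ := exists_band h.le
  refine ⟨n, lt_of_le_of_ne hn fun he => ?_⟩
  have h3 : Real.cos |x - 2 * Real.pi * n| = 0 := by rw [he, Real.cos_pi_div_two]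
  rw [Real.cos_abs, show x - 2 * Real.pi * n = x - n * (2 * Real.pi) by ring,
    Real.cos_sub_int_mul_two_pi] at h3
  linarith

theorem int_eq_of_band {n m : ℤ} (h : |2 * Real.pi * n - 2 * Real.pi * m| < 2 * Real.pi) :
    n = m := by
  have hpi := Real.pi_pos
  rw [← mul_sub, abs_mul, abs_of_pos (by positivity : (0:ℝ) < 2 * Real.pi)] at h
  have h1 : |(n:ℝ) - m| < 1 := by
    by_contra hc
    push Not at hc
    nlinarith
  have h2 : |n - m| < 1 := by exact_mod_cast h1
  have := Int.abs_lt_one_iff.1 h2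
  omega

theorem band_propagate_le {S : Set ℝ} (hS : IsPreconnected S) {f : ℝ → ℝ} (hf : ContinuousOn f S)
    (hcos : ∀ x ∈ S, 0 ≤ Real.cos (f x)) {n : ℤ} {a b : ℝ} (ha : a ∈ S) (hb : b ∈ S)
    (hn : |f a - 2 * Real.pi * n| ≤ Real.pi / 2) : |f b - 2 * Real.pi * n| ≤ Real.pi / 2 := by
  have hpi := Real.pi_pos
  have key : ∀ g : ℝ → ℝ, ContinuousOn g S → (∀ x ∈ S, 0 ≤ Real.cos (g x)) →
      g a ≤ Real.pi / 2 → g b ≤ Real.pi / 2 := by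
    intro g hg hc h1
    by_contra h2
    push Not at h2
    have h3 : min (g b) Real.pi ∈ g '' S := by
      refine (hS.image g hg).Icc_subset ⟨a, ha, rfl⟩ ⟨b, hb, rfl⟩ ⟨?_, min_le_left _ _⟩
      exact le_min (by linarith) (by linarith)
    obtain ⟨x, hx, hxe⟩ := h3
    have h4 := hc x hx
    have h5 : Real.cos (g x) < 0 := by
      rw [hxe]
      refine Real.cos_neg_of_pi_div_two_lt_of_lt (lt_min h2 (by linarith)) ?_
      exact (min_le_right _ _).trans_lt (by linarith)
    linarith
  rw [abs_le] at hn ⊢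
  have hc' : ∀ x ∈ S, 0 ≤ Real.cos (f x - 2 * Real.pi * n) := fun x hx => by
    rw [show f x - 2 * Real.pi * n = f x - n * (2 * Real.pi) by ring,
      Real.cos_sub_int_mul_two_pi]
    exact hcos x hx
  constructor
  · have := key (fun x => -(f x - 2 * Real.pi * n)) (by fun_prop)
      (fun x hx => by rw [Real.cos_neg]; exact hc' x hx) (by linarith)
    linarith
  · exact key (fun x => (f x - 2 * Real.pi * n)) (by fun_prop) hc' (by linarith)

theorem band_propagate_lt {S : Set ℝ} (hS : IsPreconnected S) {f : ℝ → ℝ} (hf : ContinuousOn f S)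
    (hcos : ∀ x ∈ S, 0 < Real.cos (f x)) {n : ℤ} {a b : ℝ} (ha : a ∈ S) (hb : b ∈ S)
    (hn : |f a - 2 * Real.pi * n| < Real.pi / 2) : |f b - 2 * Real.pi * n| < Real.pi / 2 := by
  refine lt_of_le_of_ne
    (band_propagate_le hS hf (fun x hx => (hcos x hx).le) ha hb hn.le) fun he => ?_
  have h3 : Real.cos |f b - 2 * Real.pi * n| = 0 := by rw [he, Real.cos_pi_div_two]
  rw [Real.cos_abs, show f b - 2 * Real.pi * n = f b - n * (2 * Real.pi) by ring,
    Real.cos_sub_int_mul_two_pi] at h3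
  linarith [hcos b hb]

/-- A time window together with the levels that a strand crosses during that window. -/
structure Window where
  (α a s b β lo A B hi δ : ℝ)
  hαa : α < a
  has : a ≤ s
  hsb : s ≤ b
  hbβ : b < β
  hs : s - α ≤ β - a
  hAB : A < B
  hδ : 0 < δ

/-- A planar curve crossing the window from the left to the right. -/
structure Strand (W : Window) (p : ℝ → ℂ) : Prop where
  cont : ContinuousOn p (Icc W.α W.β)
  ltA : ∀ t ∈ Icc W.α W.a, (p t).re < W.A
  gtB : ∀ t ∈ Icc W.b W.β, W.B < (p t).re
  lo : (p W.α).re < W.lo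
  gtlo : ∀ t ∈ Icc W.a W.β, W.lo < (p t).re
  hi : W.hi < (p W.β).re
  lthi : ∀ t ∈ Icc W.α W.b, (p t).re < W.hi
  slo : W.lo + W.δ ≤ (p W.s).re
  shi : (p W.s).re ≤ W.hi - W.δ

namespace Window
variable (W : Window)
theorem ab : W.a ≤ W.b := W.has.trans W.hsb
theorem αβ : W.α < W.β := W.hαa.trans_le (W.ab.trans W.hbβ.le)
end Window

theorem Strand.exists_entrance {W : Window} {p : ℝ → ℂ} (h : Strand W p) :
    ∃ σ τ : ℝ, W.a ≤ σ ∧ σ ≤ τ ∧ τ ≤ W.b ∧ (p σ).re = W.A ∧ (p τ).re = W.B ∧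
      (∀ t ∈ Icc σ τ, W.A ≤ (p t).re) ∧ ∀ t ∈ Icc W.α τ, (p t).re ≤ W.B := by
  have hab := W.ab
  have h1 := W.hαa
  have h2 := W.hbβ
  have hc : ContinuousOn (fun t => (p t).re) (Icc W.α W.β) :=
    Complex.continuous_re.comp_continuousOn h.cont
  -- first time at level `B`
  let S₁ := Icc W.α W.b ∩ (fun t => (p t).re) ⁻¹' Ici W.B
  have hS₁ : IsCompact S₁ := by
    refine isCompact_Icc.of_isClosed_subset ?_ inter_subset_left
    exact (hc.mono (Icc_subset_Icc_right h2.le)).preimage_isClosed_of_isClosed isClosed_Icc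
      isClosed_Ici
  have hS₁n : S₁.Nonempty := ⟨W.b, ⟨by linarith, le_rfl⟩, (h.gtB W.b ⟨le_rfl, h2.le⟩).le⟩
  obtain ⟨τ, hτ, hτm⟩ := hS₁.exists_isLeast hS₁n
  have hτB : ∀ t ∈ Icc W.α τ, (p t).re ≤ W.B := by
    have : ∀ t ∈ Ico W.α τ, (p t).re ≤ W.B := fun t ht => by
      by_contra hcon
      push Not at hcon
      have := hτm (show t ∈ S₁ from ⟨⟨ht.1, ht.2.le.trans hτ.1.2⟩, hcon.le⟩)
      linarith [ht.2]
    have hαt : W.α < τ := by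
      rcases hτ.1.1.eq_or_lt with he | hl
      · have h5 := h.ltA W.α ⟨le_rfl, h1.le⟩
        have h6 : W.B ≤ (p τ).re := hτ.2
        rw [← he] at h6
        linarith [W.hAB]
      · exact hl
    intro t ht
    have hcl : closure (Ico W.α τ) = Icc W.α τ := closure_Ico hαt.ne
    have : ∀ t ∈ closure (Ico W.α τ), (p t).re ≤ W.B := by
      intro t ht
      refine ContinuousWithinAt.closure_le (f := fun t => (p t).re) (g := fun _ => W.B) ht ?_
        continuousWithinAt_const this
      refine (hc t ?_).mono ?_
      · rw [hcl] at ht; exact ⟨ht.1, ht.2.trans (hτ.1.2.trans h2.le)⟩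
      · exact Ico_subset_Icc_self.trans (Icc_subset_Icc_right (hτ.1.2.trans h2.le))
    exact this t (hcl ▸ ht)
  have hτe : (p τ).re = W.B := le_antisymm (hτB τ ⟨hτ.1.1, le_rfl⟩) hτ.2
  have haτ : W.a ≤ τ := by
    by_contra hcon
    push Not at hcon
    linarith [h.ltA τ ⟨hτ.1.1, hcon.le⟩, W.hAB]
  let S₂ := Icc W.a τ ∩ (fun t => (p t).re) ⁻¹' Iic W.A
  have hτβ : τ ≤ W.β := hτ.1.2.trans h2.le
  have hc2 : ContinuousOn (fun t => (p t).re) (Icc W.a τ) :=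
    hc.mono (Icc_subset_Icc h1.le hτβ)
  have hS₂ : IsCompact S₂ := by
    refine isCompact_Icc.of_isClosed_subset ?_ inter_subset_left
    exact hc2.preimage_isClosed_of_isClosed isClosed_Icc isClosed_Iic
  have hS₂n : S₂.Nonempty := ⟨W.a, ⟨le_rfl, haτ⟩, (h.ltA W.a ⟨h1.le, le_rfl⟩).le⟩
  obtain ⟨σ, hσ, hσm⟩ := hS₂.exists_isGreatest hS₂n
  have hσ' : ∀ t ∈ Ioc σ τ, W.A ≤ (p t).re := fun t ht => by
    by_contra hcon
    push Not at hcon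
    have := hσm (show t ∈ S₂ from ⟨⟨hσ.1.1.trans ht.1.le, ht.2⟩, hcon.le⟩)
    linarith [ht.1]
  have hστ : σ < τ := by
    rcases hσ.1.2.eq_or_lt with he | hl
    · have h6 : (p σ).re ≤ W.A := hσ.2
      rw [he, hτe] at h6
      linarith [W.hAB]
    · exact hl
  have hσA : ∀ t ∈ Icc σ τ, W.A ≤ (p t).re := by
    have hcl : closure (Ioc σ τ) = Icc σ τ := closure_Ioc hστ.ne
    intro t ht
    rw [← hcl] at ht
    refine ContinuousWithinAt.closure_le (g := fun t => (p t).re) (f := fun _ => W.A) ht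
      continuousWithinAt_const ?_ hσ'
    refine (hc2 t ?_).mono ?_
    · rw [hcl] at ht; exact ⟨hσ.1.1.trans ht.1, ht.2⟩
    · exact Ioc_subset_Icc_self.trans (Icc_subset_Icc_left hσ.1.1)
  exact ⟨σ, τ, hσ.1.1, hσ.1.2, hτ.1.2, le_antisymm hσ.2 (hσA σ ⟨le_rfl, hσ.1.2⟩), hτe, hσA, hτB⟩

open Classical in
/-- The height at which a strand enters the strip between the two levels. -/
noncomputable def strandHeight (W : Window) (p : ℝ → ℂ) : ℝ :=
  if h : Strand W p then (p h.exists_entrance.choose).im else 0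

theorem Strand.height_spec {W : Window} {p : ℝ → ℂ} (h : Strand W p) :
    ∃ σ τ : ℝ, W.a ≤ σ ∧ σ ≤ τ ∧ τ ≤ W.b ∧ (p σ).re = W.A ∧ (p τ).re = W.B ∧
      (∀ t ∈ Icc σ τ, W.A ≤ (p t).re) ∧ (∀ t ∈ Icc W.α τ, (p t).re ≤ W.B) ∧
      strandHeight W p = (p σ).im := by
  obtain ⟨τ, h1, h2, h3, h4, h5, h6, h7⟩ := h.exists_entrance.choose_spec
  exact ⟨_, τ, h1, h2, h3, h4, h5, h6, h7, by rw [strandHeight, dif_pos h]⟩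

/-- The directions from the strand `q` (first variable) to the strand `p` (second variable), given
by the imaginary part of `L`, lie in the `n`-th right and the `m`-th left half-plane band along the
four sides of the window. -/
structure Bands (W : Window) (L : ℝ × ℝ → ℂ) (n m : ℤ) : Prop where
  right₁ : ∀ t ∈ Icc W.a W.β, |(L (W.α, t)).im - 2 * Real.pi * n| ≤ Real.pi / 2
  right₂ : ∀ s ∈ Icc W.α W.b, |(L (s, W.β)).im - 2 * Real.pi * n| ≤ Real.pi / 2
  left₁ : ∀ s ∈ Icc W.a W.β, |(L (s, W.α)).im - Real.pi - 2 * Real.pi * m| ≤ Real.pi / 2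
  left₂ : ∀ t ∈ Icc W.α W.b, |(L (W.β, t)).im - Real.pi - 2 * Real.pi * m| ≤ Real.pi / 2

open Classical in
/-- `1` if `p` passes below `q`, and `0` otherwise. -/
noncomputable def belowInd (W : Window) (p q : ℝ → ℂ) : ℤ :=
  if strandHeight W p < strandHeight W q then 1 else 0

section
variable {W : Window} {p q : ℝ → ℂ} {L : ℝ × ℝ → ℂ}

theorem seg_right (hL : ContinuousOn L (Icc W.α W.β ×ˢ Icc W.α W.β))
    (hexp : ∀ s ∈ Icc W.α W.β, ∀ t ∈ Icc W.α W.β, Complex.exp (L (s, t)) = p t - q s)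
    {S : Set (ℝ × ℝ)} (hSI : S ⊆ Icc W.α W.β ×ˢ Icc W.α W.β) (γ : ℝ → ℝ × ℝ) (hγ : Continuous γ)
    {u v : ℝ} (hS : ∀ x ∈ Icc u v, γ x ∈ S) (hre : ∀ z ∈ S, (q z.1).re ≤ (p z.2).re)
    {n : ℤ} {x y : ℝ} (hx : x ∈ Icc u v) (hy : y ∈ Icc u v)
    (hn : |(L (γ x)).im - 2 * Real.pi * n| ≤ Real.pi / 2) :
    |(L (γ y)).im - 2 * Real.pi * n| ≤ Real.pi / 2 := by
  refine band_propagate_le (S := Icc u v) (f := fun x => (L (γ x)).im) isPreconnected_Icc ?_ ?_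
    hx hy hn
  · exact Complex.continuous_im.comp_continuousOn
      (hL.comp hγ.continuousOn fun x hx => hSI (hS x hx))
  · intro x hx
    refine cos_im_nonneg ?_
    have h1 := hSI (hS x hx)
    have h2 := hre _ (hS x hx)
    have h3 := hexp _ h1.1 _ h1.2
    rw [Prod.mk.eta] at h3
    rw [h3, Complex.sub_re]
    linarith

theorem seg_left (hL : ContinuousOn L (Icc W.α W.β ×ˢ Icc W.α W.β))
    (hexp : ∀ s ∈ Icc W.α W.β, ∀ t ∈ Icc W.α W.β, Complex.exp (L (s, t)) = p t - q s)
    {S : Set (ℝ × ℝ)} (hSI : S ⊆ Icc W.α W.β ×ˢ Icc W.α W.β) (γ : ℝ → ℝ × ℝ) (hγ : Continuous γ)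
    {u v : ℝ} (hS : ∀ x ∈ Icc u v, γ x ∈ S) (hre : ∀ z ∈ S, (p z.2).re ≤ (q z.1).re)
    {n : ℤ} {x y : ℝ} (hx : x ∈ Icc u v) (hy : y ∈ Icc u v)
    (hn : |(L (γ x)).im - Real.pi - 2 * Real.pi * n| ≤ Real.pi / 2) :
    |(L (γ y)).im - Real.pi - 2 * Real.pi * n| ≤ Real.pi / 2 := by
  refine band_propagate_le (S := Icc u v) (f := fun x => (L (γ x)).im - Real.pi)
    isPreconnected_Icc ?_ ?_ hx hy hn
  · exact (Complex.continuous_im.comp_continuousOn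
      (hL.comp hγ.continuousOn fun x hx => hSI (hS x hx))).sub continuousOn_const
  · intro x hx
    have h1 := hSI (hS x hx)
    have h2 := hre _ (hS x hx)
    have h3 := hexp _ h1.1 _ h1.2
    rw [Prod.mk.eta] at h3
    have h4 : (Complex.exp (L (γ x))).re ≤ 0 := by
      rw [h3, Complex.sub_re]
      linarith
    rw [Complex.exp_re] at h4
    rw [Real.cos_sub_pi]
    have := nonpos_of_mul_nonpos_right h4 (Real.exp_pos _)
    linarith

/-- Two disjoint strands: the direction bands along the window sides differ by `belowInd`. -/
theorem Strand.bands (hp : Strand W p) (hq : Strand W q)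
    (hL : ContinuousOn L (Icc W.α W.β ×ˢ Icc W.α W.β))
    (hexp : ∀ s ∈ Icc W.α W.β, ∀ t ∈ Icc W.α W.β, Complex.exp (L (s, t)) = p t - q s) :
    ∃ m : ℤ, Bands W L (m + belowInd W p q) m ∧ strandHeight W p ≠ strandHeight W q := by
  have hpi := Real.pi_pos
  obtain ⟨σp, τp, p1, p2, p3, p4, p5, p6, p7, hhp⟩ := hp.height_spec
  obtain ⟨σq, τq, q1, q2, q3, q4, q5, q6, q7, hhq⟩ := hq.height_spec
  have w1 := W.hαa
  have w2 := W.hbβ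
  have w3 := W.ab
  have w4 := W.αβ
  have hre : (p σp - q σq).re = 0 := by rw [Complex.sub_re, p4, q4, sub_self]
  have him : (p σp - q σq).im = strandHeight W p - strandHeight W q := by
    rw [Complex.sub_im, hhp, hhq]
  have hex := hexp σq ⟨by linarith, by linarith⟩ σp ⟨by linarith, by linarith⟩
  have hne : strandHeight W p ≠ strandHeight W q := by
    intro he
    have : p σp - q σq = 0 := Complex.ext hre (by rw [him, he, sub_self]; rfl)
    rw [this] at hex
    exact Complex.exp_ne_zero _ hex
  have hfin : ∀ n m : ℤ, |(L (σq, σp)).im - 2 * Real.pi * n| ≤ Real.pi / 2 →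
      |(L (σq, σp)).im - Real.pi - 2 * Real.pi * m| ≤ Real.pi / 2 → Bands W L n m := by
    intro n m hn hm
    have r1 := seg_right hL hexp (S := {z | z.1 = σq ∧ z.2 ∈ Icc σp τp})
      (by rintro ⟨s, t⟩ ⟨h1, h2⟩; simp only at h1 h2; subst h1
          exact ⟨⟨by linarith, by linarith⟩, ⟨by linarith [h2.1], by linarith [h2.2]⟩⟩)
      (fun x => (σq, x)) (by fun_prop) (fun x hx => ⟨rfl, hx⟩)
      (by rintro ⟨s, t⟩ ⟨h1, h2⟩; simp only at h1 h2; subst h1; simp only; rw [q4]; exact p6 t h2)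
      (x := σp) (y := τp) ⟨le_rfl, p2⟩ ⟨p2, le_rfl⟩ hn
    have r2 := seg_right hL hexp (S := {z | z.1 ∈ Icc W.α σq ∧ z.2 = τp})
      (by rintro ⟨s, t⟩ ⟨h2, h1⟩; simp only at h1 h2; subst h1
          exact ⟨⟨by linarith [h2.1], by linarith [h2.2]⟩, ⟨by linarith, by linarith⟩⟩)
      (fun x => (x, τp)) (by fun_prop) (fun x hx => ⟨hx, rfl⟩)
      (by rintro ⟨s, t⟩ ⟨h2, h1⟩; simp only at h1 h2; subst h1; simp only; rw [p5]
          exact q7 s ⟨h2.1, h2.2.trans q2⟩)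
      (x := σq) (y := W.α) ⟨by linarith, le_rfl⟩ ⟨le_rfl, by linarith⟩ r1
    have r3 := fun t (ht : t ∈ Icc W.a W.β) => seg_right hL hexp
      (S := {z | z.1 = W.α ∧ z.2 ∈ Icc W.a W.β})
      (by rintro ⟨s, t⟩ ⟨h1, h2⟩; simp only at h1 h2; subst h1
          exact ⟨⟨by linarith, by linarith⟩, ⟨by linarith [h2.1], by linarith [h2.2]⟩⟩)
      (fun x => (W.α, x)) (by fun_prop) (fun x hx => ⟨rfl, hx⟩)
      (by rintro ⟨s, t⟩ ⟨h1, h2⟩; simp only at h1 h2; subst h1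
          exact (hq.lo.trans (hp.gtlo t h2)).le)
      (x := τp) (y := t) ⟨by linarith, by linarith⟩ ht r2
    have r4 := fun s (hs : s ∈ Icc W.α W.b) => seg_right hL hexp
      (S := {z | z.1 ∈ Icc W.α W.b ∧ z.2 = W.β})
      (by rintro ⟨s, t⟩ ⟨h2, h1⟩; simp only at h1 h2; subst h1
          exact ⟨⟨by linarith [h2.1], by linarith [h2.2]⟩, ⟨by linarith, by linarith⟩⟩)
      (fun x => (x, W.β)) (by fun_prop) (fun x hx => ⟨hx, rfl⟩)
      (by rintro ⟨s, t⟩ ⟨h2, h1⟩; simp only at h1 h2; subst h1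
          exact ((hq.lthi s h2).trans hp.hi).le)
      (x := W.α) (y := s) ⟨by linarith, by linarith⟩ hs (r3 W.β ⟨by linarith, le_rfl⟩)
    have l1 := seg_left hL hexp (S := {z | z.1 ∈ Icc σq τq ∧ z.2 = σp})
      (by rintro ⟨s, t⟩ ⟨h2, h1⟩; simp only at h1 h2; subst h1
          exact ⟨⟨by linarith [h2.1], by linarith [h2.2]⟩, ⟨by linarith, by linarith⟩⟩)
      (fun x => (x, σp)) (by fun_prop) (fun x hx => ⟨hx, rfl⟩)
      (by rintro ⟨s, t⟩ ⟨h2, h1⟩; simp only at h1 h2; subst h1; simp only; rw [p4]; exact q6 s h2)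
      (x := σq) (y := τq) ⟨le_rfl, q2⟩ ⟨q2, le_rfl⟩ hm
    have l2 := seg_left hL hexp (S := {z | z.1 = τq ∧ z.2 ∈ Icc W.α σp})
      (by rintro ⟨s, t⟩ ⟨h1, h2⟩; simp only at h1 h2; subst h1
          exact ⟨⟨by linarith, by linarith⟩, ⟨by linarith [h2.1], by linarith [h2.2]⟩⟩)
      (fun x => (τq, x)) (by fun_prop) (fun x hx => ⟨rfl, hx⟩)
      (by rintro ⟨s, t⟩ ⟨h1, h2⟩; simp only at h1 h2; subst h1; simp only; rw [q5]
          exact p7 t ⟨h2.1, h2.2.trans p2⟩)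
      (x := σp) (y := W.α) ⟨by linarith, le_rfl⟩ ⟨le_rfl, by linarith⟩ l1
    have l3 := fun s (hs : s ∈ Icc W.a W.β) => seg_left hL hexp
      (S := {z | z.1 ∈ Icc W.a W.β ∧ z.2 = W.α})
      (by rintro ⟨s, t⟩ ⟨h2, h1⟩; simp only at h1 h2; subst h1
          exact ⟨⟨by linarith [h2.1], by linarith [h2.2]⟩, ⟨by linarith, by linarith⟩⟩)
      (fun x => (x, W.α)) (by fun_prop) (fun x hx => ⟨hx, rfl⟩)
      (by rintro ⟨s, t⟩ ⟨h2, h1⟩; simp only at h1 h2; subst h1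
          exact (hp.lo.trans (hq.gtlo s h2)).le)
      (x := τq) (y := s) ⟨by linarith, by linarith⟩ hs l2
    have l4 := fun t (ht : t ∈ Icc W.α W.b) => seg_left hL hexp
      (S := {z | z.1 = W.β ∧ z.2 ∈ Icc W.α W.b})
      (by rintro ⟨s, t⟩ ⟨h1, h2⟩; simp only at h1 h2; subst h1
          exact ⟨⟨by linarith, by linarith⟩, ⟨by linarith [h2.1], by linarith [h2.2]⟩⟩)
      (fun x => (W.β, x)) (by fun_prop) (fun x hx => ⟨rfl, hx⟩)
      (by rintro ⟨s, t⟩ ⟨h1, h2⟩; simp only at h1 h2; subst h1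
          exact ((hp.lthi t h2).trans hq.hi).le)
      (x := W.α) (y := t) ⟨by linarith, by linarith⟩ ht (l3 W.β ⟨by linarith, le_rfl⟩)
    exact ⟨r3, r4, l3, l4⟩
  -- the direction at the entrance times is vertical
  have hre' := congrArg Complex.re hex
  have him' := congrArg Complex.im hex
  rw [Complex.exp_re, hre] at hre'
  rw [Complex.exp_im, him] at him'
  have hcos : Real.cos (L (σq, σp)).im = 0 := by
    rcases mul_eq_zero.1 hre' with h | h
    · exact absurd h (Real.exp_pos _).ne'
    · exact h
  obtain ⟨j, hj⟩ := exists_band hcos.ge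
  have hj' : |(L (σq, σp)).im - 2 * Real.pi * j| = Real.pi / 2 := by
    refine le_antisymm hj (not_lt.1 fun hlt => ?_)
    have := Real.cos_pos_of_mem_Ioo (abs_lt.1 hlt)
    rw [show (L (σq, σp)).im - 2 * Real.pi * j = (L (σq, σp)).im - j * (2 * Real.pi) by ring,
      Real.cos_sub_int_mul_two_pi, hcos] at this
    exact this.false
  have hsin : Real.sin (L (σq, σp)).im = Real.sin ((L (σq, σp)).im - 2 * Real.pi * j) := by
    rw [show (L (σq, σp)).im - 2 * Real.pi * j = (L (σq, σp)).im - j * (2 * Real.pi) by ring,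
      Real.sin_sub_int_mul_two_pi]
  rcases lt_or_gt_of_ne hne with hlt | hgt
  · refine ⟨j - 1, ?_, hne⟩
    rw [belowInd, if_pos hlt, sub_add_cancel]
    refine hfin _ _ hj ?_
    have : (L (σq, σp)).im - 2 * Real.pi * j = -(Real.pi / 2) := by
      rcases (abs_eq (by positivity)).1 hj' with h | h
      · rw [h, Real.sin_pi_div_two] at hsin
        rw [hsin] at him'
        linarith [Real.exp_pos (L (σq, σp)).re]
      · exact h
    push_cast
    rw [abs_le]
    constructor <;> nlinarith
  · refine ⟨j, ?_, hne⟩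
    rw [belowInd, if_neg hgt.not_gt, add_zero]
    refine hfin _ _ hj ?_
    have : (L (σq, σp)).im - 2 * Real.pi * j = Real.pi / 2 := by
      rcases (abs_eq (by positivity)).1 hj' with h | h
      · exact h
      · rw [h, Real.sin_neg, Real.sin_pi_div_two] at hsin
        rw [hsin] at him'
        linarith [Real.exp_pos (L (σq, σp)).re]
    rw [abs_le]
    constructor <;> linarith

end

theorem cos_im_sub_pos {L₁ L₂ : ℂ}
    (h : ‖Complex.exp L₁ - Complex.exp L₂‖ < ‖Complex.exp L₂‖) :
    0 < Real.cos (L₁.im - L₂.im) := by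
  rw [← Complex.sub_im]
  refine cos_im_pos ?_
  rw [Complex.exp_sub]
  have h2 := Complex.exp_ne_zero L₂
  have h3 : ‖Complex.exp L₁ / Complex.exp L₂ - 1‖ < 1 := by
    rw [div_sub_one h2, norm_div, div_lt_one (norm_pos_iff.2 h2)]
    exact h
  have h4 := (Complex.abs_re_le_norm _).trans_lt h3
  rw [Complex.sub_re, Complex.one_re, abs_lt] at h4
  linarith

theorem cos_im_sub_neg {L₁ L₂ : ℂ}
    (h : ‖Complex.exp L₁ + Complex.exp L₂‖ < ‖Complex.exp L₂‖) :
    Real.cos (L₁.im - L₂.im) < 0 := by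
  have := cos_im_sub_pos (L₁ := L₁ + Real.pi * Complex.I) (L₂ := L₂) (by
    rw [Complex.exp_add, Complex.exp_pi_mul_I,
      show ∀ a b : ℂ, a * -1 - b = -(a + b) from fun a b => by ring, norm_neg]
    exact h)
  simp only [Complex.add_im, Complex.mul_im, Complex.ofReal_re, Complex.I_im, mul_one,
    Complex.ofReal_im, Complex.I_re, mul_zero, add_zero] at this
  rw [show L₁.im + Real.pi - L₂.im = L₁.im - L₂.im + Real.pi by ring, Real.cos_add_pi] at this
  linarith

theorem exists_log_strands {W : Window} {p q : ℝ → ℂ} (hp : ContinuousOn p (Icc W.α W.β))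
    (hq : ContinuousOn q (Icc W.α W.β))
    (hne : ∀ s ∈ Icc W.α W.β, ∀ t ∈ Icc W.α W.β, p t ≠ q s) :
    ∃ L : ℝ × ℝ → ℂ, Continuous L ∧
      ∀ s ∈ Icc W.α W.β, ∀ t ∈ Icc W.α W.β, Complex.exp (L (s, t)) = p t - q s := by
  let pr : ℝ → ℝ := fun t => (projIcc W.α W.β W.αβ.le t : ℝ)
  have hpr : Continuous pr := continuous_subtype_val.comp continuous_projIcc
  have hprm : ∀ t, pr t ∈ Icc W.α W.β := fun t => (projIcc W.α W.β W.αβ.le t).2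
  have hpre : ∀ t ∈ Icc W.α W.β, pr t = t := fun t ht => by
    simp only [pr, projIcc_of_mem W.αβ.le ht]
  obtain ⟨L, hL, he⟩ := exists_continuous_log (A := ℝ × ℝ)
    (g := fun z => p (pr z.2) - q (pr z.1))
    ((hp.comp_continuous (hpr.comp continuous_snd) fun z => hprm _).sub
      (hq.comp_continuous (hpr.comp continuous_fst) fun z => hprm _))
    (fun z => sub_ne_zero.2 (hne _ (hprm _) _ (hprm _)))
  refine ⟨L, hL, fun s hs t ht => ?_⟩
  rw [he]
  simp only [hpre s hs, hpre t ht]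

theorem abs_band_sub {x y : ℝ} {n m j : ℤ} (hx : |x - 2 * Real.pi * n| ≤ Real.pi / 2)
    (hy : |y - 2 * Real.pi * m| ≤ Real.pi / 2) (h : |x - y - 2 * Real.pi * j| < Real.pi / 2) :
    j = n - m := by
  have hpi := Real.pi_pos
  refine int_eq_of_band ?_
  rw [abs_le] at hx hy
  rw [abs_lt] at h ⊢
  push_cast
  constructor <;> nlinarith

/-- The index is stable under small perturbations of the first strand. -/
theorem belowInd_congr {W : Window} {p p' q : ℝ → ℂ} (hp : Strand W p) (hp' : Strand W p')
    (hq : Strand W q)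
    (h : ∀ s ∈ Icc W.α W.β, ∀ t ∈ Icc W.α W.β, ‖p t - p' t‖ < ‖p' t - q s‖) :
    belowInd W p q = belowInd W p' q := by
  have w := W.αβ
  have w1 := W.hαa
  have w2 := W.hbβ
  have w3 := W.ab
  have hne : ∀ s ∈ Icc W.α W.β, ∀ t ∈ Icc W.α W.β, p t ≠ q s := fun s hs t ht he => by
    have := h s hs t ht
    rw [he, norm_sub_rev] at this
    exact this.false
  have hne' : ∀ s ∈ Icc W.α W.β, ∀ t ∈ Icc W.α W.β, p' t ≠ q s := fun s hs t ht he => by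
    have := h s hs t ht
    rw [he, sub_self, norm_zero] at this
    linarith [norm_nonneg (p t - q s)]
  obtain ⟨L, hL, hLe⟩ := exists_log_strands hp.cont hq.cont hne
  obtain ⟨L', hL', hLe'⟩ := exists_log_strands hp'.cont hq.cont hne'
  obtain ⟨m, hB, -⟩ := hp.bands hq hL.continuousOn hLe
  obtain ⟨m', hB', -⟩ := hp'.bands hq hL'.continuousOn hLe'
  have hcos : ∀ s ∈ Icc W.α W.β, ∀ t ∈ Icc W.α W.β,
      0 < Real.cos ((L (s, t)).im - (L' (s, t)).im) := fun s hs t ht => by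
    refine cos_im_sub_pos ?_
    rw [hLe s hs t ht, hLe' s hs t ht, sub_sub_sub_cancel_right]
    exact h s hs t ht
  have hα : W.α ∈ Icc W.α W.β := ⟨le_rfl, w.le⟩
  have hβ : W.β ∈ Icc W.α W.β := ⟨w.le, le_rfl⟩
  obtain ⟨j, hj⟩ := exists_strict_band (hcos W.α hα W.β hβ)
  have hj2 := band_propagate_lt (S := Icc W.α W.β) isPreconnected_Icc
    (f := fun t => (L (W.α, t)).im - (L' (W.α, t)).im) (by fun_prop)
    (fun t ht => hcos W.α hα t ht) hβ hα hj
  have hj3 := band_propagate_lt (S := Icc W.α W.β) isPreconnected_Icc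
    (f := fun s => (L (s, W.α)).im - (L' (s, W.α)).im) (by fun_prop)
    (fun s hs => hcos s hs W.α hα) hα hβ hj2
  have e1 := abs_band_sub (hB.right₁ W.β ⟨by linarith, le_rfl⟩)
    (hB'.right₁ W.β ⟨by linarith, le_rfl⟩) hj
  have e2 := abs_band_sub (hB.left₁ W.β ⟨by linarith, le_rfl⟩)
    (hB'.left₁ W.β ⟨by linarith, le_rfl⟩) (j := j) (by
      rwa [sub_sub_sub_cancel_right])
  omega

/-- Passes of `P` around a closed curve `c`: if the outer arc of `c` stays away from the window
then all passes close to each other are on the same side. -/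
theorem belowInd_eq_of_closed {W : Window} {P c : ℝ → ℂ} (hP : Continuous P) (hc : Continuous c)
    (hne : ∀ s t, P t ≠ c s) {τ : ℝ} (hτ : W.β ≤ τ + W.α) (hper : ∀ s, c (s + τ) = c s)
    (hq : Strand W c) {t t' : ℝ} (hp : Strand W fun u => P (t + u - W.s))
    (hp' : Strand W fun u => P (t' + u - W.s))
    (hd : ∀ x ∈ Icc W.β (τ + W.α), ‖P t - P t'‖ < ‖P t' - c x‖) :
    belowInd W (fun u => P (t + u - W.s)) c = belowInd W (fun u => P (t' + u - W.s)) c := by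
  have w := W.αβ
  have w1 := W.hαa
  have w2 := W.hbβ
  have w3 := W.ab
  have w4 := W.has
  have w5 := W.hsb
  obtain ⟨L, hL, hLe⟩ := exists_continuous_log (A := ℝ × ℝ) (g := fun z => P z.2 - c z.1)
    (by fun_prop) (fun z => sub_ne_zero.2 (hne _ _))
  obtain ⟨m, hB, -⟩ := hp.bands hq (L := fun z => L (z.1, t + z.2 - W.s)) (by fun_prop)
    (fun s _ u _ => hLe _)
  obtain ⟨m', hB', -⟩ := hp'.bands hq (L := fun z => L (z.1, t' + z.2 - W.s)) (by fun_prop)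
    (fun s _ u _ => hLe _)
  -- the winding number of `c` around `P t` is constant
  have hwind : ∀ z z' : ℝ × ℝ, L (z.1 + τ, z.2) - L z = L (z'.1 + τ, z'.2) - L z' := by
    have hmemint : ∀ z : ℝ × ℝ, ∃ n : ℤ, L (z.1 + τ, z.2) - L z = n * (2 * Real.pi * Complex.I) := by
      intro z
      have h1 := hLe (z.1 + τ, z.2)
      simp only [hper] at h1
      obtain ⟨n, hn⟩ := Complex.exp_eq_exp_iff_exists_int.1 (h1.trans (hLe z).symm)
      exact ⟨n, by rw [hn]; ring⟩
    choose N hN using hmemint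
    have hpi2 : (2 * Real.pi * Complex.I : ℂ) ≠ 0 := Complex.two_pi_I_ne_zero
    have hNc : Continuous fun z => (N z : ℝ) := by
      have : (fun z => (N z : ℝ)) =
          fun z => ((L (z.1 + τ, z.2) - L z) / (2 * Real.pi * Complex.I)).re := by
        funext z
        rw [hN, mul_div_cancel_right₀ _ hpi2, Complex.intCast_re]
      rw [this]
      fun_prop
    have hNc' : Continuous N := (Int.isClosedEmbedding_coe_real.isEmbedding.continuous_iff).2 hNc
    intro z z'
    rw [hN, hN, PreconnectedSpace.constant inferInstance hNc' (x := z) (y := z')]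
  have hcos : ∀ x ∈ Icc W.β (τ + W.α), 0 < Real.cos ((L (x, t)).im - (L (x, t')).im) := by
    intro x hx
    refine cos_im_sub_pos ?_
    rw [hLe, hLe, sub_sub_sub_cancel_right]
    exact hd x hx
  obtain ⟨j, hj⟩ := exists_strict_band (hcos W.β ⟨le_rfl, hτ⟩)
  have hj2 := band_propagate_lt (S := Icc W.β (τ + W.α)) isPreconnected_Icc
    (f := fun x => (L (x, t)).im - (L (x, t')).im) (by fun_prop) hcos
    ⟨le_rfl, hτ⟩ ⟨hτ, le_rfl⟩ hj
  have hw := congrArg Complex.im (hwind (W.α, t) (W.α, t'))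
  simp only [Complex.sub_im, add_comm W.α τ] at hw
  have l1 := hB.left₂ W.s ⟨by linarith, by linarith⟩
  have l2 := hB'.left₂ W.s ⟨by linarith, by linarith⟩
  have r1 := hB.right₁ W.s ⟨by linarith, by linarith⟩
  have r2 := hB'.right₁ W.s ⟨by linarith, by linarith⟩
  simp only [add_sub_cancel_right] at l1 l2 r1 r2
  have e1 := abs_band_sub l1 l2 (j := j) (by rwa [sub_sub_sub_cancel_right])
  have e2 := abs_band_sub r1 r2 (j := j) (by
    rwa [show (L (W.α, t)).im - (L (W.α, t')).im
      = (L (τ + W.α, t)).im - (L (τ + W.α, t')).im by linarith])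
  omega

/-- A curve `P` that avoids the arc `c`, where `c` crosses the window twice (at base times `r₁` and
`r₂`) and `P` shadows `c` arbitrarily late. -/
structure DoublePass (W : Window) (P c : ℝ → ℂ) (r₁ r₂ t₁ : ℝ) : Prop where
  hP : Continuous P
  hc : Continuous c
  ne : ∀ s t, P t ≠ c s
  hr : r₁ + W.β < r₂ + W.α
  inj : InjOn c (Icc (r₁ + W.α) (r₂ + W.β))
  hq₁ : Strand W fun u => c (r₁ + u)
  hq₂ : Strand W fun u => c (r₂ + u)
  gap : ‖c (r₁ + W.s) - c (r₂ + W.s)‖ < W.δ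
  near : ∀ t, t₁ ≤ t → ‖P t - c (r₁ + W.s)‖ ≤ W.δ → Strand W fun u => P (t + u - W.s)
  shadow : ∀ η > 0, ∀ M, ∃ τ ≥ M, ∀ x ∈ Icc (r₁ + W.α) (r₂ + W.β), ‖P (τ + x) - c x‖ < η

namespace DoublePass

variable {W : Window} {P c : ℝ → ℂ} {r₁ r₂ t₁ : ℝ}

/-- `k` is the number of turns of the arc of `c` between the two passes, seen from `P t`. -/
def Turns (W : Window) (L : ℝ × ℝ → ℂ) (r₁ r₂ t : ℝ) (k : ℤ) : Prop :=
  |(L (r₂ + W.s, t)).im - (L (r₁ + W.s, t)).im - 2 * Real.pi * k| < Real.pi / 2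

theorem Turns.unique {L : ℝ × ℝ → ℂ} {t : ℝ} {k k' : ℤ} (h : Turns W L r₁ r₂ t k)
    (h' : Turns W L r₁ r₂ t k') : k = k' := by
  refine int_eq_of_band ?_
  have hpi := Real.pi_pos
  unfold Turns at h h'
  rw [abs_lt] at *
  constructor <;> linarith [h.1, h.2, h'.1, h'.2]

variable {L : ℝ × ℝ → ℂ}

theorem cos_pos_of_far (h : DoublePass W P c r₁ r₂ t₁)
    (hLe : ∀ z : ℝ × ℝ, Complex.exp (L z) = P z.2 - c z.1) {t : ℝ}
    (ht : W.δ < ‖P t - c (r₁ + W.s)‖) :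
    0 < Real.cos ((L (r₂ + W.s, t)).im - (L (r₁ + W.s, t)).im) := by
  refine cos_im_sub_pos ?_
  rw [hLe, hLe, sub_sub_sub_cancel_left]
  exact h.gap.trans ht

theorem bands₁ (h : DoublePass W P c r₁ r₂ t₁) (hL : Continuous L)
    (hLe : ∀ z : ℝ × ℝ, Complex.exp (L z) = P z.2 - c z.1) {t : ℝ}
    (hp : Strand W fun u => P (t + u - W.s)) :
    ∃ m : ℤ, Bands W (fun z => L (r₁ + z.1, t + z.2 - W.s))
      (m + belowInd W (fun u => P (t + u - W.s)) fun u => c (r₁ + u)) m :=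
  (hp.bands h.hq₁ (by fun_prop) fun _ _ _ _ => hLe _).imp fun _ h => h.1

theorem bands₂ (h : DoublePass W P c r₁ r₂ t₁) (hL : Continuous L)
    (hLe : ∀ z : ℝ × ℝ, Complex.exp (L z) = P z.2 - c z.1) {t : ℝ}
    (hp : Strand W fun u => P (t + u - W.s)) :
    ∃ m : ℤ, Bands W (fun z => L (r₂ + z.1, t + z.2 - W.s))
      (m + belowInd W (fun u => P (t + u - W.s)) fun u => c (r₂ + u)) m :=
  (hp.bands h.hq₂ (by fun_prop) fun _ _ _ _ => hLe _).imp fun _ h => h.1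

theorem far_start (h : DoublePass W P c r₁ r₂ t₁) {t : ℝ}
    (hp : Strand W fun u => P (t + u - W.s)) :
    W.δ < ‖P (t + W.α - W.s) - c (r₁ + W.s)‖ := by
  have h1 := hp.lo
  have h2 := h.hq₁.slo
  have h3 := (abs_le.1 (Complex.abs_re_le_norm (P (t + W.α - W.s) - c (r₁ + W.s)))).1
  rw [Complex.sub_re] at h3
  linarith

theorem far_end (h : DoublePass W P c r₁ r₂ t₁) {t : ℝ}
    (hp : Strand W fun u => P (t + u - W.s)) :
    W.δ < ‖P (t + W.β - W.s) - c (r₁ + W.s)‖ := by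
  have h1 := hp.hi
  have h2 := h.hq₁.shi
  have h3 := (abs_le.1 (Complex.abs_re_le_norm (P (t + W.β - W.s) - c (r₁ + W.s)))).2
  rw [Complex.sub_re] at h3
  linarith

theorem exists_turns_of_far (h : DoublePass W P c r₁ r₂ t₁)
    (hLe : ∀ z : ℝ × ℝ, Complex.exp (L z) = P z.2 - c z.1) {t : ℝ}
    (ht : W.δ < ‖P t - c (r₁ + W.s)‖) : ∃ k, Turns W L r₁ r₂ t k :=
  exists_strict_band (h.cos_pos_of_far hLe ht)

/-- Change of the number of turns across one pass of `P`. -/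
theorem turns_pass (h : DoublePass W P c r₁ r₂ t₁) (hL : Continuous L)
    (hLe : ∀ z : ℝ × ℝ, Complex.exp (L z) = P z.2 - c z.1) {t : ℝ}
    (hp : Strand W fun u => P (t + u - W.s)) {k k' : ℤ}
    (hk : Turns W L r₁ r₂ (t + W.α - W.s) k) (hk' : Turns W L r₁ r₂ (t + W.β - W.s) k') :
    k' - k = belowInd W (fun u => P (t + u - W.s)) (fun u => c (r₂ + u)) -
      belowInd W (fun u => P (t + u - W.s)) fun u => c (r₁ + u) := by
  obtain ⟨m₁, b₁⟩ := h.bands₁ hL hLe hp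
  obtain ⟨m₂, b₂⟩ := h.bands₂ hL hLe hp
  have w2 := W.hbβ
  have w1 := W.hαa
  have w4 := W.has
  have w5 := W.hsb
  have e1 := abs_band_sub (b₂.left₁ W.s ⟨by linarith, by linarith⟩)
    (b₁.left₁ W.s ⟨by linarith, by linarith⟩) (j := k) (by
      rw [sub_sub_sub_cancel_right]; exact hk)
  have e2 := abs_band_sub (b₂.right₂ W.s ⟨by linarith, by linarith⟩)
    (b₁.right₂ W.s ⟨by linarith, by linarith⟩) (j := k') hk'
  omega

theorem turns_const (h : DoublePass W P c r₁ r₂ t₁) (hL : Continuous L)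
    (hLe : ∀ z : ℝ × ℝ, Complex.exp (L z) = P z.2 - c z.1) {S T : ℝ} (hST : S ≤ T)
    (hfar : ∀ t ∈ Icc S T, W.δ < ‖P t - c (r₁ + W.s)‖) {k : ℤ} (hk : Turns W L r₁ r₂ S k) :
    Turns W L r₁ r₂ T k :=
  band_propagate_lt (S := Icc S T) isPreconnected_Icc
    (f := fun t => (L (r₂ + W.s, t)).im - (L (r₁ + W.s, t)).im) (by fun_prop)
    (fun t ht => h.cos_pos_of_far hLe (hfar t ht)) ⟨le_rfl, hST⟩ ⟨hST, le_rfl⟩ hk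

/-- The number of turns is monotone from the end of a pass to the start of a later one. -/
theorem turns_mono (h : DoublePass W P c r₁ r₂ t₁) (hL : Continuous L)
    (hLe : ∀ z : ℝ × ℝ, Complex.exp (L z) = P z.2 - c z.1) {ε : ℤ}
    (hε : ∀ p : ℝ → ℂ, 0 ≤ ε * (belowInd W p (fun u => c (r₂ + u)) -
      belowInd W p fun u => c (r₁ + u))) (N : ℕ) :
    ∀ t t' : ℝ, t₁ ≤ t + W.β - W.s → Strand W (fun u => P (t + u - W.s)) →
      Strand W (fun u => P (t' + u - W.s)) → t + W.β - W.s ≤ t' + W.α - W.s →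
      t' + W.α - (t + W.β) ≤ N * (W.β - W.s) →
      ∀ k k' : ℤ, Turns W L r₁ r₂ (t + W.β - W.s) k → Turns W L r₁ r₂ (t' + W.α - W.s) k' →
      ε * k ≤ ε * k' := by
  have w1 := W.hαa
  have w2 := W.hbβ
  have w4 := W.has
  have w5 := W.hsb
  have w6 := W.hs
  induction N with
  | zero =>
    intro t t' ht hp hp' hle hN k k' hk hk'
    have : t + W.β - W.s = t' + W.α - W.s := by
      simp only [CharP.cast_eq_zero, zero_mul] at hN
      linarith
    rw [← this] at hk'
    rw [hk.unique hk']
  | succ N ih =>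
    intro t t' ht hp hp' hle hN k k' hk hk'
    let S := Icc (t + W.β - W.s) (t' + W.α - W.s) ∩ {x | ‖P x - c (r₁ + W.s)‖ ≤ W.δ}
    have hS : IsCompact S := isCompact_Icc.inter_right
      (isClosed_le ((h.hP.sub continuous_const).norm) continuous_const)
    rcases S.eq_empty_or_nonempty with he | hne
    · have hfar : ∀ x ∈ Icc (t + W.β - W.s) (t' + W.α - W.s),
          W.δ < ‖P x - c (r₁ + W.s)‖ := fun x hx => by
        by_contra hcon
        have : x ∈ S := ⟨hx, not_lt.1 hcon⟩
        rw [he] at this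
        exact this
      rw [(h.turns_const hL hLe hle hfar hk).unique hk']
    · obtain ⟨x, hx, hxm⟩ := hS.exists_isLeast hne
      have hpx := h.near x (ht.trans hx.1.1) hx.2
      have g1 : t + W.β - W.s ≤ x + W.α - W.s := by
        by_contra hcon
        push Not at hcon
        have h1 := hp.gtlo (x + W.α - t) ⟨by linarith [hx.1.1], by linarith⟩
        have h2 := hpx.lo
        rw [show t + (x + W.α - t) - W.s = x + W.α - W.s by ring] at h1
        linarith
      have g2 : x + W.β - W.s ≤ t' + W.α - W.s := by
        by_contra hcon
        push Not at hcon
        have h1 := hpx.gtlo (t' + W.α - x) ⟨by linarith [hx.1.2], by linarith⟩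
        have h2 := hp'.lo
        rw [show x + (t' + W.α - x) - W.s = t' + W.α - W.s by ring] at h1
        linarith
      have hfar : ∀ y ∈ Icc (t + W.β - W.s) (x + W.α - W.s),
          W.δ < ‖P y - c (r₁ + W.s)‖ := fun y hy => by
        by_contra hcon
        have := hxm (show y ∈ S from ⟨⟨hy.1, by linarith [hy.2, hx.1.2]⟩, not_lt.1 hcon⟩)
        linarith [hy.2]
      have hk1 := h.turns_const hL hLe g1 hfar hk
      obtain ⟨k2, hk2⟩ := h.exists_turns_of_far hLe (h.far_end hpx)
      have h1 := h.turns_pass hL hLe hpx hk1 hk2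
      have h2 := hε fun u => P (x + u - W.s)
      rw [← h1] at h2
      have h3 := ih x t' (by linarith) hpx hp' g2 (by push_cast at hN; nlinarith) k2 k' hk2 hk'
      nlinarith

theorem belowInd_mono {p q q' : ℝ → ℂ} (h : strandHeight W q ≤ strandHeight W q') :
    belowInd W p q ≤ belowInd W p q' := by
  unfold belowInd
  split_ifs with h1 h2
  · exact le_rfl
  · exact absurd (h1.trans_le h) h2
  · exact zero_le_one
  · exact le_rfl

theorem turns_le (h : DoublePass W P c r₁ r₂ t₁) (hL : Continuous L)
    (hLe : ∀ z : ℝ × ℝ, Complex.exp (L z) = P z.2 - c z.1) {ε : ℤ}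
    (hε : ∀ p : ℝ → ℂ, 0 ≤ ε * (belowInd W p (fun u => c (r₂ + u)) -
      belowInd W p fun u => c (r₁ + u))) {t t' : ℝ} (ht : t₁ ≤ t + W.β - W.s)
    (hp : Strand W (fun u => P (t + u - W.s))) (hp' : Strand W (fun u => P (t' + u - W.s)))
    (hle : t + W.β - W.s ≤ t' + W.α - W.s) {k k' : ℤ} (hk : Turns W L r₁ r₂ (t + W.β - W.s) k)
    (hk' : Turns W L r₁ r₂ (t' + W.α - W.s) k') : ε * k ≤ ε * k' := by
  have w : 0 < W.β - W.s := by linarith [W.hsb, W.hbβ]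
  obtain ⟨N, hN⟩ := exists_nat_ge ((t' + W.α - (t + W.β)) / (W.β - W.s))
  exact h.turns_mono hL hLe hε N t t' ht hp hp' hle ((div_le_iff₀ w).1 hN) k k' hk hk'

theorem exists_sep (h : DoublePass W P c r₁ r₂ t₁) {g : ℝ} (hg : 0 < g) :
    ∃ d > 0, ∀ x ∈ Icc (r₁ + W.α) (r₂ + W.β), ∀ y ∈ Icc (r₁ + W.α) (r₂ + W.β),
      g ≤ |x - y| → d ≤ ‖c x - c y‖ := by
  let S : Set (ℝ × ℝ) := (Icc (r₁ + W.α) (r₂ + W.β) ×ˢ Icc (r₁ + W.α) (r₂ + W.β)) ∩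
    {z | g ≤ |z.1 - z.2|}
  have hS : IsCompact S := (isCompact_Icc.prod isCompact_Icc).inter_right
    (isClosed_le continuous_const (by fun_prop))
  have hc := h.hc
  rcases S.eq_empty_or_nonempty with he | hne
  · refine ⟨1, one_pos, fun x hx y hy hxy => ?_⟩
    have : (x, y) ∈ S := ⟨⟨hx, hy⟩, hxy⟩
    rw [he] at this
    exact this.elim
  · obtain ⟨z, hz, hzm⟩ := hS.exists_isMinOn hne
      (f := fun z => ‖c z.1 - c z.2‖) (by fun_prop)
    refine ⟨_, norm_pos_iff.2 (sub_ne_zero.2 fun he => ?_), fun x hx y hy hxy =>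
      hzm (show (x, y) ∈ S from ⟨⟨hx, hy⟩, hxy⟩)⟩
    have h1 := hz.2
    rw [mem_ofPred_eq, h.inj hz.1.1 hz.1.2 he, sub_self, abs_zero] at h1
    linarith

theorem elim (h : DoublePass W P c r₁ r₂ t₁) : False := by
  have hpi := Real.pi_pos
  have w1 := W.hαa
  have w2 := W.hbβ
  have w3 := W.αβ
  have w4 := W.has
  have w5 := W.hsb
  have hr := h.hr
  have hP := h.hP
  have hc := h.hc
  obtain ⟨L, hL, hLe⟩ := exists_continuous_log (A := ℝ × ℝ) (g := fun z => P z.2 - c z.1)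
    (by fun_prop) (fun z => sub_ne_zero.2 (h.ne _ _))
  obtain ⟨d, hd, hsep⟩ := h.exists_sep
    (g := min (W.s - W.α) (r₂ + W.α - (r₁ + W.β))) (lt_min (by linarith) (by linarith))
  have hgap := h.gap
  set η := min (W.δ - ‖c (r₁ + W.s) - c (r₂ + W.s)‖) (d / 3) with hη
  have hη0 : 0 < η := lt_min (by linarith) (by linarith)
  have hη1 : η ≤ W.δ - ‖c (r₁ + W.s) - c (r₂ + W.s)‖ := min_le_left _ _
  have hη2 : η ≤ d / 3 := min_le_right _ _
  -- the two strands of `c` do not meet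
  set q₁ : ℝ → ℂ := fun u => c (r₁ + u) with hq₁
  set q₂ : ℝ → ℂ := fun u => c (r₂ + u) with hq₂
  have hsep12 : ∀ s ∈ Icc W.α W.β, ∀ t ∈ Icc W.α W.β, d ≤ ‖q₁ t - q₂ s‖ := fun s hs t ht => by
    refine hsep _ ⟨by linarith [ht.1], by linarith [ht.2]⟩ _
      ⟨by linarith [hs.1], by linarith [hs.2]⟩ ((min_le_right _ _).trans ?_)
    rw [abs_sub_comm]
    exact le_trans (by linarith [ht.2, hs.1]) (le_abs_self _)
  have hne12 : strandHeight W q₁ ≠ strandHeight W q₂ := by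
    obtain ⟨L', hL', hLe'⟩ := exists_log_strands h.hq₁.cont h.hq₂.cont fun s hs t ht he => by
      have := hsep12 s hs t ht
      simp only [hq₁, hq₂, he, sub_self, norm_zero] at this
      linarith
    exact (h.hq₁.bands h.hq₂ hL'.continuousOn hLe').choose_spec.2
  obtain ⟨ε, hε0, hε⟩ : ∃ ε : ℤ, ε ≠ 0 ∧ ∀ p : ℝ → ℂ,
      0 ≤ ε * (belowInd W p q₂ - belowInd W p q₁) := by
    rcases le_total (strandHeight W q₁) (strandHeight W q₂) with hh | hh
    · exact ⟨1, one_ne_zero, fun p => by linarith [belowInd_mono (W := W) (p := p) hh]⟩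
    · exact ⟨-1, by norm_num, fun p => by linarith [belowInd_mono (W := W) (p := p) hh]⟩
  -- passes of `P` near the two strands at a shadowing time
  have hpass : ∀ τ, t₁ - (r₁ + W.α) ≤ τ →
      (∀ x ∈ Icc (r₁ + W.α) (r₂ + W.β), ‖P (τ + x) - c x‖ < η) →
      Strand W (fun u => P (τ + (r₁ + W.s) + u - W.s)) ∧
      Strand W (fun u => P (τ + (r₂ + W.s) + u - W.s)) := by
    intro τ hτ hsh
    constructor
    · refine h.near _ (by linarith) ((hsh _ ⟨by linarith, by linarith⟩).le.trans ?_)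
      linarith [norm_nonneg (c (r₁ + W.s) - c (r₂ + W.s))]
    · refine h.near _ (by linarith) ?_
      have h1 := hsh (r₂ + W.s) ⟨by linarith, by linarith⟩
      have h2 := norm_sub_le_norm_sub_add_norm_sub (P (τ + (r₂ + W.s))) (c (r₂ + W.s))
        (c (r₁ + W.s))
      rw [norm_sub_rev (c (r₂ + W.s))] at h2
      linarith
  obtain ⟨τ, hτ, hsh⟩ := h.shadow η hη0 (t₁ - (r₁ + W.α))
  obtain ⟨τ', hτ', hsh'⟩ := h.shadow η hη0 (max (t₁ - (r₁ + W.α)) (τ + (r₂ + W.β) - (r₁ + W.α)))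
  obtain ⟨hp1, hp2⟩ := hpass τ hτ hsh
  obtain ⟨hp1', -⟩ := hpass τ' ((le_max_left _ _).trans hτ') hsh'
  have hττ' := (le_max_right _ _).trans hτ'
  obtain ⟨k0, hk0⟩ := h.exists_turns_of_far hLe (h.far_start hp1)
  obtain ⟨k1, hk1⟩ := h.exists_turns_of_far hLe (h.far_end hp1)
  obtain ⟨k2, hk2⟩ := h.exists_turns_of_far hLe (h.far_start hp2)
  obtain ⟨k3, hk3⟩ := h.exists_turns_of_far hLe (h.far_end hp2)
  obtain ⟨k4, hk4⟩ := h.exists_turns_of_far hLe (h.far_start hp1')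
  have hk04 : k4 = k0 := by
    have hcos : ∀ x ∈ Icc (r₁ + W.s) (r₂ + W.s), 0 < Real.cos
        ((L (x, τ' + (r₁ + W.s) + W.α - W.s)).im - (L (x, τ + (r₁ + W.s) + W.α - W.s)).im) := by
      intro x hx
      refine cos_im_sub_pos ?_
      rw [hLe, hLe, sub_sub_sub_cancel_right]
      simp only
      have h1 := hsh (r₁ + W.α) ⟨le_rfl, by linarith⟩
      have h2 := hsh' (r₁ + W.α) ⟨le_rfl, by linarith⟩
      rw [show τ + (r₁ + W.s) + W.α - W.s = τ + (r₁ + W.α) by ring,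
        show τ' + (r₁ + W.s) + W.α - W.s = τ' + (r₁ + W.α) by ring]
      have h3 : d ≤ ‖c (r₁ + W.α) - c x‖ := hsep _ ⟨le_rfl, by linarith⟩ _
        ⟨by linarith [hx.1], by linarith [hx.2]⟩ ((min_le_left _ _).trans (by
          rw [abs_sub_comm]
          exact le_trans (by linarith [hx.1]) (le_abs_self _)))
      have h4 := norm_sub_le_norm_sub_add_norm_sub (P (τ' + (r₁ + W.α))) (c (r₁ + W.α))
        (P (τ + (r₁ + W.α)))
      have h5 := norm_sub_le_norm_sub_add_norm_sub (c (r₁ + W.α)) (P (τ + (r₁ + W.α))) (c x)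
      rw [norm_sub_rev (c (r₁ + W.α)) (P (τ + (r₁ + W.α)))] at h4 h5
      linarith
    obtain ⟨j, hj⟩ := exists_strict_band (hcos (r₁ + W.s) ⟨le_rfl, by linarith⟩)
    have hj2 := band_propagate_lt (S := Icc (r₁ + W.s) (r₂ + W.s)) isPreconnected_Icc
      (f := fun x => (L (x, τ' + (r₁ + W.s) + W.α - W.s)).im -
        (L (x, τ + (r₁ + W.s) + W.α - W.s)).im) (by fun_prop) hcos ⟨le_rfl, by linarith⟩
      ⟨by linarith, le_rfl⟩ hj
    refine int_eq_of_band ?_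
    unfold Turns at hk4 hk0
    rw [abs_lt] at hj hj2 hk4 hk0 ⊢
    constructor <;> linarith [hj.1, hj2.1, hk4.1, hk0.1, hj.2, hj2.2, hk4.2, hk0.2]
  have e1 := h.turns_pass hL hLe hp1 hk0 hk1
  have e2 := h.turns_pass hL hLe hp2 hk2 hk3
  have i1 := hε fun u => P (τ + (r₁ + W.s) + u - W.s)
  have i2 := hε fun u => P (τ + (r₂ + W.s) + u - W.s)
  rw [← e1] at i1
  rw [← e2] at i2
  have i3 := h.turns_le hL hLe hε (by linarith) hp1 hp2 (by linarith) hk1 hk2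
  have i4 := h.turns_le hL hLe hε (by linarith) hp2 hp1' (by linarith) hk3 hk4
  rw [hk04] at i4
  rw [mul_sub] at i1 i2
  have e3 : k1 = k0 := mul_left_cancel₀ hε0 (by linarith)
  have e4 : k3 = k2 := mul_left_cancel₀ hε0 (by linarith)
  -- stability of the index
  have s1 : belowInd W (fun u => P (τ + (r₁ + W.s) + u - W.s)) q₂ = belowInd W q₁ q₂ := by
    refine belowInd_congr hp1 h.hq₁ h.hq₂ fun s hs t ht => ?_
    have h1 := hsh (r₁ + t) ⟨by linarith [ht.1], by linarith [ht.2]⟩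
    rw [show τ + (r₁ + W.s) + t - W.s = τ + (r₁ + t) by ring]
    have := hsep12 s hs t ht
    simp only [hq₁, hq₂] at this ⊢
    linarith
  have s2 : belowInd W (fun u => P (τ + (r₂ + W.s) + u - W.s)) q₁ = belowInd W q₂ q₁ := by
    refine belowInd_congr hp2 h.hq₂ h.hq₁ fun s hs t ht => ?_
    have h1 := hsh (r₂ + t) ⟨by linarith [ht.1], by linarith [ht.2]⟩
    rw [show τ + (r₂ + W.s) + t - W.s = τ + (r₂ + t) by ring]
    have := hsep12 t ht s hs
    rw [norm_sub_rev] at this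
    simp only [hq₁, hq₂] at this ⊢
    linarith
  -- `P` stays on the same side of `c` along the arc
  have hside : belowInd W (fun u => P (τ + (r₁ + W.s) + u - W.s)) q₁ =
      belowInd W (fun u => P (τ + (r₂ + W.s) + u - W.s)) q₂ := by
    obtain ⟨m₁, b₁⟩ := h.bands₁ hL hLe hp1
    obtain ⟨m₂, b₂⟩ := h.bands₂ hL hLe hp2
    have hcos : ∀ x ∈ Icc r₁ r₂, 0 < Real.cos ((L (x + W.β, τ + (x + W.α))).im -
        (L (x + W.α, τ + (x + W.β))).im - Real.pi) := by
      intro x hx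
      rw [Real.cos_sub_pi]
      refine neg_pos.2 (cos_im_sub_neg ?_)
      rw [hLe, hLe]
      simp only
      have h1 := hsh (x + W.α) ⟨by linarith [hx.1], by linarith [hx.2]⟩
      have h2 := hsh (x + W.β) ⟨by linarith [hx.1], by linarith [hx.2]⟩
      have h3 : d ≤ ‖c (x + W.β) - c (x + W.α)‖ := hsep _ ⟨by linarith [hx.1], by linarith [hx.2]⟩
        _ ⟨by linarith [hx.1], by linarith [hx.2]⟩ ((min_le_left _ _).trans
          (le_trans (by linarith) (le_abs_self _)))
      have h4 := norm_sub_le_norm_sub_add_norm_sub (c (x + W.β)) (P (τ + (x + W.β)))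
        (c (x + W.α))
      rw [norm_sub_rev (c (x + W.β)) (P (τ + (x + W.β)))] at h4
      have h5 := norm_add_le (P (τ + (x + W.α)) - c (x + W.α)) (P (τ + (x + W.β)) - c (x + W.β))
      rw [show P (τ + (x + W.α)) - c (x + W.β) + (P (τ + (x + W.β)) - c (x + W.α)) =
        P (τ + (x + W.α)) - c (x + W.α) + (P (τ + (x + W.β)) - c (x + W.β)) by ring]
      linarith
    have hr12 : r₁ ≤ r₂ := by linarith
    obtain ⟨j, hj⟩ := exists_strict_band (hcos r₁ ⟨le_rfl, hr12⟩)
    have hj2 := band_propagate_lt (S := Icc r₁ r₂) isPreconnected_Icc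
      (f := fun x => (L (x + W.β, τ + (x + W.α))).im -
        (L (x + W.α, τ + (x + W.β))).im - Real.pi) (by fun_prop) hcos ⟨le_rfl, hr12⟩
      ⟨hr12, le_rfl⟩ hj
    have l1 := b₁.left₂ W.α ⟨le_rfl, by linarith⟩
    have l2 := b₁.right₁ W.β ⟨by linarith, le_rfl⟩
    have l3 := b₂.left₂ W.α ⟨le_rfl, by linarith⟩
    have l4 := b₂.right₁ W.β ⟨by linarith, le_rfl⟩
    simp only [show ∀ r x, τ + (r + W.s) + x - W.s = τ + (r + x) from fun r x => by ring]
      at l1 l2 l3 l4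
    have f1 := abs_band_sub l1 l2 (j := j) (by convert hj using 2; ring)
    have f2 := abs_band_sub l3 l4 (j := j) (by convert hj2 using 2; ring)
    simp only [show ∀ r x, τ + (r + W.s) + x - W.s = τ + (r + x) from fun r x => by ring]
    simp only [hq₁, hq₂] at f1 f2 ⊢
    omega
  have hfin : belowInd W q₁ q₂ = belowInd W q₂ q₁ := by
    have e1' : k1 - k0 = belowInd W (fun u => P (τ + (r₁ + W.s) + u - W.s)) q₂ -
      belowInd W (fun u => P (τ + (r₁ + W.s) + u - W.s)) q₁ := e1
    have e2' : k3 - k2 = belowInd W (fun u => P (τ + (r₂ + W.s) + u - W.s)) q₂ -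
      belowInd W (fun u => P (τ + (r₂ + W.s) + u - W.s)) q₁ := e2
    linarith
  unfold belowInd at hfin
  rcases lt_or_gt_of_ne hne12 with hlt | hlt
  · rw [if_pos hlt, if_neg hlt.not_gt] at hfin
    omega
  · rw [if_pos hlt, if_neg hlt.not_gt] at hfin
    omega

end DoublePass

section Cones

variable {X : Type*} [NormedAddCommGroup X] {C : Set X} {κ : ℝ}

/-- The vectors whose relative distance to the complement of `C` is at least `κ`. -/
def deepCone (C : Set X) (κ : ℝ) : Set X := {v | ∀ u ∉ C, κ * ‖v‖ ≤ ‖v - u‖}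

theorem zero_mem_deepCone : (0 : X) ∈ deepCone C κ := fun u _ => by simp

theorem isClosed_deepCone : IsClosed (deepCone C κ) := by
  have : deepCone C κ = ⋂ u ∈ Cᶜ, {v | κ * ‖v‖ ≤ ‖v - u‖} := by
    ext v
    simp [deepCone]
  rw [this]
  exact isClosed_biInter fun u _ => isClosed_le (by fun_prop) (by fun_prop)

theorem deepCone_subset (h0 : (0 : X) ∈ C) (hκ : 0 < κ) : deepCone C κ ⊆ C := by
  intro v hv
  by_contra h
  have := hv v h
  rw [sub_self, norm_zero] at this
  have hv0 : v = 0 := norm_le_zero_iff.1 (by nlinarith [norm_nonneg v])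
  exact h (hv0 ▸ h0)

theorem deepCone_mono {κ' : ℝ} (h : κ' ≤ κ) : deepCone C κ ⊆ deepCone C κ' := fun v hv u hu =>
  (mul_le_mul_of_nonneg_right h (norm_nonneg v)).trans (hv u hu)

/-- Small relative perturbations of deep vectors are deep. -/
theorem add_mem_deepCone {v w : X} (hv : v ∈ deepCone C κ) (hκ : 0 < κ) (hκ1 : κ ≤ 1)
    (hw : ‖w‖ ≤ κ / 4 * ‖v‖) : v + w ∈ deepCone C (κ / 2) := by
  intro u hu
  have h1 := hv u hu
  have h2 : ‖v - u‖ ≤ ‖v + w - u‖ + ‖w‖ := by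
    rw [show v - u = (v + w - u) - w by abel]
    exact norm_sub_le _ _
  have h3 := norm_add_le v w
  have h4 : κ * ‖v + w‖ ≤ κ * (‖v‖ + ‖w‖) := by gcongr
  have h5 : κ * ‖w‖ ≤ 1 * ‖w‖ := by gcongr
  linarith [mul_nonneg hκ.le (norm_nonneg v)]

variable [NormedSpace ℝ X]

theorem smul_mem_deepCone (hC : ∀ (t : ℝ) (v : X), v ∈ C → t • v ∈ C) {v : X}
    (hv : v ∈ deepCone C κ) (t : ℝ) : t • v ∈ deepCone C κ := by
  intro u hu
  rcases eq_or_ne t 0 with rfl | ht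
  · simp
  have h1 := hv (t⁻¹ • u) fun h => hu (by simpa [smul_smul, ht] using hC t _ h)
  calc κ * ‖t • v‖ = |t| * (κ * ‖v‖) := by rw [norm_smul, Real.norm_eq_abs]; ring
    _ ≤ |t| * ‖v - t⁻¹ • u‖ := by gcongr
    _ = ‖t • v - u‖ := by
      rw [← Real.norm_eq_abs, ← norm_smul, smul_sub, smul_smul, mul_inv_cancel₀ ht, one_smul]

theorem StronglyFocusing.mem_deepCone {R : X →L[ℝ] X}
    (hC : ∀ (t : ℝ) (v : X), v ∈ C → t • v ∈ C) (hR : StronglyFocusing R C κ) {v : X}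
    (hv : v ∈ C) : R v ∈ deepCone C κ := by
  rcases eq_or_ne (R v) 0 with h0 | h0
  · rw [h0]
    exact zero_mem_deepCone
  have hn : ‖R v‖ ≠ 0 := norm_ne_zero_iff.2 h0
  have h1 : ‖R v‖⁻¹ • R v ∈ deepCone C κ := by
    intro u hu
    have h2 : ‖‖R v‖⁻¹ • R v‖ = 1 := by
      rw [norm_smul, norm_inv, norm_norm, inv_mul_cancel₀ hn]
    rw [h2, mul_one]
    exact hR.2 _ ⟨‖R v‖⁻¹ • v, hC _ _ hv, by simp⟩ h2 u hu
  simpa [smul_smul, hn] using smul_mem_deepCone hC h1 ‖R v‖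

/-- Uniform strict differentiability near a compact set. -/
theorem exists_uniform_deriv_bound {f : X → X} {f' : X → X →L[ℝ] X}
    (hf : ∀ x, HasFDerivAt f (f' x) x) (hf' : Continuous f') {S : Set X} (hS : IsCompact S)
    {ε : ℝ} (hε : 0 < ε) : ∃ ρ > 0, ∀ z ∈ S, ∀ x ∈ closedBall z ρ, ∀ y ∈ closedBall z ρ,
      ‖f x - f y - f' z (x - y)‖ ≤ ε * ‖x - y‖ := by
  obtain ⟨ρ, hρ, h⟩ : ∃ ρ > 0, ∀ z ∈ S, ∀ x, dist z x < ρ → dist (f' z) (f' x) < ε := by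
    have h1 := hS.uniformContinuousAt_of_continuousAt f' (fun a _ => hf'.continuousAt)
      (Metric.dist_mem_uniformity hε)
    obtain ⟨ρ, hρ, h2⟩ := Metric.mem_uniformity_dist.1 h1
    exact ⟨ρ, hρ, fun z hz x hx => h2 hx hz⟩
  refine ⟨ρ / 2, by positivity, fun z hz x hx y hy => ?_⟩
  refine (convex_closedBall z (ρ / 2)).norm_image_sub_le_of_norm_hasFDerivWithin_le'
    (fun w _ => (hf w).hasFDerivWithinAt) (fun w hw => ?_) hy hx
  rw [← dist_eq_norm, dist_comm]
  rw [mem_closedBall, dist_comm] at hw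
  exact (h z hz w (by linarith)).le

/-- Operators mapping `C` into itself injectively, depending on a compact parameter, are bounded
below on deep vectors. -/
theorem exists_lower_bound [CompleteSpace X] (hC : IsKCone C 2) {A : X → X →L[ℝ] X}
    (hA : Continuous A) {S : Set X} (hS : IsCompact S) (hAC : ∀ z ∈ S, ∀ v ∈ C, A z v ∈ C)
    (hA0 : ∀ z ∈ S, ∀ v ∈ C, v ≠ 0 → A z v ≠ 0) (hκ : 0 < κ) :
    ∃ m > 0, ∀ z ∈ S, ∀ v ∈ deepCone C κ, m * ‖v‖ ≤ ‖A z v‖ := by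
  have h0 : (0 : X) ∈ C := by
    obtain ⟨W, hW, -⟩ := hC.2.2.1
    exact hW W.zero_mem
  by_contra! hcon
  have hseq : ∀ n : ℕ, ∃ z ∈ S, ∃ c ∈ deepCone C κ, ‖c‖ = 1 ∧ ‖A z c‖ < 1 / ((n : ℝ) + 1) := by
    intro n
    obtain ⟨z, hz, v, hv, h⟩ := hcon (1 / ((n : ℝ) + 1)) (by positivity)
    have hv0 : ‖v‖ ≠ 0 := fun h0 => by
      rw [norm_eq_zero.1 h0] at h
      simp at h
    refine ⟨z, hz, ‖v‖⁻¹ • v, smul_mem_deepCone hC.2.1 hv _, ?_, ?_⟩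
    · rw [norm_smul, norm_inv, norm_norm, inv_mul_cancel₀ hv0]
    · rw [map_smul, norm_smul, norm_inv, norm_norm, inv_mul_lt_iff₀ (by positivity), mul_comm]
      exact h
  choose z hz c hc hc1 hAc using hseq
  obtain ⟨z₀, hz₀, φ, hφ, hlim⟩ := hS.tendsto_subseq hz
  have hAz : Tendsto (fun n => A z₀ (c (φ n))) atTop (nhds 0) := by
    have h1 : Tendsto (fun n => ‖A (z (φ n)) - A z₀‖) atTop (nhds 0) := by
      have := ((hA.tendsto z₀).comp hlim).sub_const (A z₀)
      rw [sub_self] at this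
      exact tendsto_zero_iff_norm_tendsto_zero.1 this
    have h2 : Tendsto (fun n => 1 / (((φ n : ℕ) : ℝ) + 1)) atTop (nhds 0) :=
      tendsto_one_div_add_atTop_nhds_zero_nat.comp hφ.tendsto_atTop
    refine squeeze_zero_norm (fun n => ?_) (by simpa using h1.add h2)
    have h3 : A z₀ (c (φ n)) = A (z (φ n)) (c (φ n)) - (A (z (φ n)) - A z₀) (c (φ n)) := by simp
    rw [h3]
    have h4 := (A (z (φ n)) - A z₀).le_opNorm (c (φ n))
    rw [hc1, mul_one] at h4
    have h5 := norm_sub_le (A (z (φ n)) (c (φ n))) ((A (z (φ n)) - A z₀) (c (φ n)))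
    have h6 := hAc (φ n)
    rw [one_div] at h6
    linarith
  have hball : ∀ x : X, ‖x‖ < 1 → A z₀ x ∈ C := by
    intro x hx
    have h1 : ∀ n, A z₀ (c (φ n)) + κ • A z₀ x ∈ C := fun n => by
      rw [← map_smul, ← map_add]
      refine hAC z₀ hz₀ _ ?_
      by_contra hn
      have := hc (φ n) _ hn
      rw [hc1, sub_add_cancel_left, norm_neg, norm_smul, Real.norm_eq_abs, abs_of_pos hκ] at this
      nlinarith
    have h2 : κ • A z₀ x ∈ C := by
      refine hC.1.mem_of_tendsto (b := atTop) ?_ (Eventually.of_forall h1)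
      simpa using hAz.add_const (κ • A z₀ x)
    simpa [smul_smul, hκ.ne'] using hC.2.1 κ⁻¹ _ h2
  have hrange : ((A z₀ : X →ₗ[ℝ] X).range : Set X) ⊆ C := by
    rintro _ ⟨x, rfl⟩
    have h1 : A z₀ ((2 * (‖x‖ + 1))⁻¹ • x) ∈ C := hball _ (by
      rw [norm_smul, norm_inv, inv_mul_lt_iff₀ (norm_pos_iff.2 (by positivity)), Real.norm_eq_abs,
        abs_of_pos (by positivity)]
      linarith [norm_nonneg x])
    have h2 := hC.2.1 (2 * (‖x‖ + 1)) _ h1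
    rw [map_smul, smul_smul, mul_inv_cancel₀ (by positivity), one_smul] at h2
    exact h2
  have hfin : FiniteDimensional ℝ (A z₀ : X →ₗ[ℝ] X).range := by
    rw [FiniteDimensional, ← Module.rank_lt_aleph0_iff]
    exact (hC.2.2.2 _ hrange).trans_lt (by exact_mod_cast Cardinal.natCast_lt_aleph0 (n := 2))
  have : CompleteSpace (A z₀ : X →ₗ[ℝ] X).range := FiniteDimensional.complete ℝ _
  let B : X →L[ℝ] (A z₀ : X →ₗ[ℝ] X).range := (A z₀).codRestrict _ fun x => ⟨x, rfl⟩
  have hB : Function.Surjective B := by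
    rintro ⟨_, x, rfl⟩
    exact ⟨x, rfl⟩
  obtain ⟨M, hM, hpre⟩ := B.exists_preimage_norm_le hB
  have hsmall : ∀ᶠ n in atTop, M * ‖A z₀ (c (φ n))‖ < min κ 1 := by
    have := (tendsto_zero_iff_norm_tendsto_zero.1 hAz).const_mul M
    rw [mul_zero] at this
    exact this.eventually_lt_const (lt_min hκ one_pos)
  obtain ⟨n, hn⟩ := hsmall.exists
  obtain ⟨x, hx, hxn⟩ := hpre (B (c (φ n)))
  have hxn' : ‖x‖ < min κ 1 := hxn.trans_lt hn
  have hker : A z₀ (c (φ n) - x) = 0 := by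
    have h1 := congrArg Subtype.val hx
    have h2 : A z₀ x = A z₀ (c (φ n)) := h1
    rw [map_sub, h2, sub_self]
  have hne : c (φ n) - x ≠ 0 := fun h => by
    have := hc1 (φ n)
    rw [sub_eq_zero.1 h] at this
    linarith [min_le_right κ 1]
  have hnC : c (φ n) - x ∉ C := fun h => hA0 z₀ hz₀ _ h hne hker
  have := hc (φ n) _ hnC
  rw [hc1, mul_one, sub_sub_cancel] at this
  linarith [min_le_left κ 1]

theorem IsKCone.zero_mem {k : ℕ} (hC : IsKCone C k) : (0 : X) ∈ C := by
  obtain ⟨W, hW, -⟩ := hC.2.2.1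
  exact hW W.zero_mem

theorem IsKCone.neg_mem {k : ℕ} (hC : IsKCone C k) {v : X} (hv : v ∈ C) : -v ∈ C := by
  simpa using hC.2.1 (-1) v hv

theorem IsKCone.sub_comm_mem {k : ℕ} (hC : IsKCone C k) {v w : X} (hv : v - w ∈ C) : w - v ∈ C := by
  simpa using hC.neg_mem hv

theorem IsKCone.zero_notMem_interior {k : ℕ} (hC : IsKCone C k) (hCu : C ≠ univ) :
    (0 : X) ∉ interior C := by
  intro h
  refine hCu (eq_univ_of_forall fun v => ?_)
  obtain ⟨ε, hε, hb⟩ := Metric.isOpen_iff.1 isOpen_interior 0 h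
  have h1 : (ε / (2 * (‖v‖ + 1))) • v ∈ C := by
    refine interior_subset (hb ?_)
    have hv := norm_nonneg v
    rw [mem_ball_zero_iff, norm_smul, Real.norm_eq_abs, abs_of_pos (by positivity),
      div_mul_eq_mul_div, div_lt_iff₀ (by positivity)]
    nlinarith
  have h2 := hC.2.1 (ε / (2 * (‖v‖ + 1)))⁻¹ _ h1
  rwa [smul_smul, inv_mul_cancel₀ (by positivity), one_smul] at h2

theorem norm_le_of_mem_deepCone_add {u d : X}
    (hC : ∀ (t : ℝ) (v : X), v ∈ C → t • v ∈ C) (hu : u ∈ deepCone C κ)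
    (hd : d ∉ C) {σ : ℝ} (hσ : σ ≠ 0) : κ * ‖u‖ ≤ ‖u + σ • d‖ := by
  have := hu (-σ • d) fun h => hd (by simpa [smul_smul, hσ] using hC (-σ)⁻¹ _ h)
  simpa using this

/-- One step of the domination argument. -/
theorem deepCone_step {κ m ε γ B : ℝ} (hκ : 0 < κ) (hκ1 : κ ≤ 1) (hε : 0 ≤ ε)
    (hγ : 0 ≤ γ) (hB : 0 ≤ B) (hC : ∀ (t : ℝ) (v : X), v ∈ C → t • v ∈ C) {A : X →L[ℝ] X}
    (hAB : ‖A‖ ≤ B) (hAC : ∀ v ∈ C, A v ∈ deepCone C κ) (h0 : (0 : X) ∈ C)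
    (hAm : ∀ v ∈ deepCone C (κ / 2), m * ‖v‖ ≤ ‖A v‖)
    (hsmall : (ε + γ * (B + ε)) * (1 + 4 / κ) ≤ κ / 4 * m) {u d u' d' : X}
    (hu : ‖u' - A u‖ ≤ ε * ‖u‖) (hd : ‖d' - A d‖ ≤ ε * ‖d‖) (hdC : d ∉ C) {s : ℝ} (hs : 0 ≤ s)
    (h : ∀ σ, |σ| ≤ s → u + σ • d ∈ deepCone C (κ / 2)) :
    ∀ σ, |σ| ≤ (1 + γ) * s → u' + σ • d' ∈ deepCone C (κ / 2) := by
  intro σ' hσ'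
  obtain ⟨σ, hσ, rfl⟩ : ∃ σ, |σ| ≤ s ∧ (1 + γ) * σ = σ' := by
    refine ⟨σ' / (1 + γ), ?_, by field_simp⟩
    rw [abs_div, abs_of_pos (by positivity : 0 < 1 + γ), div_le_iff₀ (by positivity)]
    linarith
  have hv := h σ hσ
  have hu0 : u ∈ deepCone C (κ / 2) := by simpa using h 0 (by simpa using hs)
  set v := u + σ • d with hvdef
  have h1 : κ / 2 * ‖u‖ ≤ ‖v‖ := by
    rcases eq_or_ne σ 0 with h0 | h0
    · rw [hvdef, h0, zero_smul, add_zero]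
      nlinarith [norm_nonneg u]
    · exact norm_le_of_mem_deepCone_add hC hu0 hdC h0
  have h2 : ‖u‖ ≤ 2 / κ * ‖v‖ := by
    rw [div_mul_eq_mul_div, le_div_iff₀ hκ]
    linarith
  have h3 : |σ| * ‖d‖ ≤ ‖v‖ + ‖u‖ := by
    rw [← Real.norm_eq_abs, ← norm_smul, show σ • d = v - u by rw [hvdef]; abel]
    exact norm_sub_le _ _
  have hd' : ‖d'‖ ≤ (B + ε) * ‖d‖ := by
    calc ‖d'‖ = ‖A d + (d' - A d)‖ := by rw [add_sub_cancel]
      _ ≤ ‖A d‖ + ‖d' - A d‖ := norm_add_le _ _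
      _ ≤ B * ‖d‖ + ε * ‖d‖ := add_le_add (A.le_of_opNorm_le hAB d) hd
      _ = _ := by ring
  have hAv : A v ∈ deepCone C κ := hAC v (deepCone_subset h0 (by positivity) hv)
  have hdec : u' + ((1 + γ) * σ) • d' =
      A v + ((u' - A u) + σ • (d' - A d) + (γ * σ) • d') := by
    rw [hvdef, map_add, map_smul, smul_sub, add_mul, one_mul, add_smul]
    abel
  rw [hdec]
  refine add_mem_deepCone hAv hκ hκ1 ?_
  calc ‖(u' - A u) + σ • (d' - A d) + (γ * σ) • d'‖
      ≤ ‖u' - A u‖ + ‖σ • (d' - A d)‖ + ‖(γ * σ) • d'‖ := norm_add₃_le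
    _ = ‖u' - A u‖ + |σ| * ‖d' - A d‖ + γ * |σ| * ‖d'‖ := by
      rw [norm_smul, norm_smul, Real.norm_eq_abs, Real.norm_eq_abs, abs_mul, abs_of_nonneg hγ]
    _ ≤ ε * ‖u‖ + |σ| * (ε * ‖d‖) + γ * |σ| * ((B + ε) * ‖d‖) := by gcongr
    _ = ε * ‖u‖ + (ε + γ * (B + ε)) * (|σ| * ‖d‖) := by ring
    _ ≤ (ε + γ * (B + ε)) * ‖u‖ + (ε + γ * (B + ε)) * (‖v‖ + ‖u‖) := by
      gcongr
      nlinarith [mul_nonneg hγ (add_nonneg hB hε)]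
    _ ≤ (ε + γ * (B + ε)) * (2 / κ * ‖v‖) + (ε + γ * (B + ε)) * (‖v‖ + 2 / κ * ‖v‖) := by
      gcongr
    _ = (ε + γ * (B + ε)) * (1 + 4 / κ) * ‖v‖ := by ring
    _ ≤ κ / 4 * m * ‖v‖ := by gcongr
    _ ≤ κ / 4 * ‖A v‖ := by
      rw [mul_assoc]
      gcongr
      exact hAm v hv

end Cones

section Domination

variable {X : Type*} [NormedAddCommGroup X] [NormedSpace ℝ X] {C : Set X} {Φ : Semiflow X}
  {DΦ : ℝ → X → X →L[ℝ] X}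

theorem deriv_mem_deepCone (hC : ∀ (t : ℝ) (v : X), v ∈ C → t • v ∈ C) {κ ρ : ℝ} (hρ : 0 < ρ)
    {f : X → X} {f' : X →L[ℝ] X} {z : X} (hf : HasFDerivAt f f' z)
    (h : ∀ x ∈ closedBall z ρ, x - z ∈ C → f x - f z ∈ deepCone C κ) {v : X} (hv : v ∈ C) :
    f' v ∈ deepCone C κ := by
  have h1 := (hf.hasLineDerivAt v).tendsto_slope_zero
  refine isClosed_deepCone.mem_of_tendsto h1 ?_
  have h2 : ∀ᶠ t : ℝ in nhds 0, z + t • v ∈ closedBall z ρ := by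
    have : ContinuousAt (fun t : ℝ => z + t • v) 0 := by fun_prop
    refine this.eventually_mem ?_
    simpa using closedBall_mem_nhds z hρ
  filter_upwards [nhdsWithin_le_nhds h2] with t ht
  exact smul_mem_deepCone hC (h _ ht (by simpa using hC t v hv)) _

theorem exists_domination [CompleteSpace X] (hC : IsKCone C 2) (hCu : C ≠ univ)
    (hΦ : StronglyFocusingMonotone Φ DΦ C) {S : Set X} (hS : IsCompact S) (hSi : Invariant Φ S) :
    ∃ T > 0, ∃ κ > 0, ∃ ρ > 0, ∃ γ > 0, ∃ M > 0,
      (∀ z ∈ S, ∀ x ∈ closedBall z ρ, ∀ y ∈ closedBall z ρ, x - y ∈ C →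
        Φ.toFun T x - Φ.toFun T y ∈ deepCone C κ) ∧
      ∀ (N : ℕ) (x y w : ℕ → X), (∀ n < N, x (n + 1) = Φ.toFun T (x n)) →
        (∀ n < N, y (n + 1) = Φ.toFun T (y n)) → (∀ n < N, w (n + 1) = Φ.toFun T (w n)) →
        (∀ n < N, ∃ z ∈ S, x n ∈ closedBall z ρ ∧ y n ∈ closedBall z ρ ∧ w n ∈ closedBall z ρ) →
        (∀ n ≤ N, y n - x n ∈ C → y n = x n) → w 0 - x 0 ∈ deepCone C κ →
        (1 + γ) ^ N * (‖w 0 - x 0‖ * ‖y N - x N‖) ≤ M * (‖y 0 - x 0‖ * ‖w N - x N‖) := by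
  obtain ⟨δ, hδ, T, hT, κ₀, hκ₀, hfoc⟩ := hΦ.2.2.2.2 S hS hSi
  have h0 := hC.zero_mem
  have hsm := hC.2.1
  set κ := min κ₀ 1 with hκdef
  have hκ : 0 < κ := lt_min hκ₀ one_pos
  have hκ1 : κ ≤ 1 := min_le_right _ _
  have hdeep : ∀ z ∈ S, ∀ x ∈ closedBall z δ, ∀ y ∈ closedBall z δ, x - y ∈ C →
      Φ.toFun T x - Φ.toFun T y ∈ deepCone C κ := by
    intro z hz x hx y hy hxy
    obtain ⟨R, hR, hRe⟩ := hfoc z hz x hx y hy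
    rw [← hRe]
    exact deepCone_mono (min_le_left _ _) (hR.mem_deepCone hsm hxy)
  have hAC : ∀ z ∈ S, ∀ v ∈ C, DΦ T z v ∈ deepCone C κ := fun z hz v hv =>
    deriv_mem_deepCone hsm hδ (hΦ.1 T hT.le z)
      (fun x hx hxz => hdeep z hz x hx z (mem_closedBall_self hδ.le) hxz) hv
  have hDc := hΦ.2.1 T hT.le
  obtain ⟨m, hm, hAm⟩ := exists_lower_bound hC hDc hS
    (fun z hz v hv => deepCone_subset h0 hκ (hAC z hz v hv))
    (fun z hz v hv hv0 he => hC.zero_notMem_interior hCu (he ▸ hΦ.2.2.2.1 T hT z v hv hv0))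
    (half_pos hκ)
  obtain ⟨B, hB0, hB⟩ : ∃ B, 0 ≤ B ∧ ∀ z ∈ S, ‖DΦ T z‖ ≤ B := by
    obtain ⟨B, hB⟩ := (hS.image hDc).isBounded.exists_norm_le
    exact ⟨max B 0, le_max_right _ _, fun z hz =>
      (hB _ (mem_image_of_mem _ hz)).trans (le_max_left _ _)⟩
  set q := κ / 4 * m / (1 + 4 / κ) with hq
  have hq0 : 0 < q := by positivity
  set ε := min 1 (q / 2) with hεdef
  have hε : 0 < ε := lt_min one_pos (by positivity)
  set γ := q / (2 * (B + 1)) with hγdef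
  have hγ : 0 < γ := by positivity
  have hsmall : (ε + γ * (B + ε)) * (1 + 4 / κ) ≤ κ / 4 * m := by
    have h1 : ε + γ * (B + ε) ≤ q / 2 + γ * (B + 1) := by
      gcongr
      exacts [min_le_right _ _, min_le_left _ _]
    have h2 : γ * (B + 1) = q / 2 := by
      rw [hγdef]
      field_simp
    rw [← le_div_iff₀ (by positivity), ← hq]
    linarith
  obtain ⟨ρ, hρ, hest⟩ := exists_uniform_deriv_bound (hΦ.1 T hT.le) hDc hS hε
  refine ⟨T, hT, κ, hκ, min ρ δ, lt_min hρ hδ, γ, hγ, (2 / κ + 1) * (4 / κ), by positivity,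
    fun z hz x hx y hy => hdeep z hz x (closedBall_subset_closedBall (min_le_right _ _) hx) y
      (closedBall_subset_closedBall (min_le_right _ _) hy), ?_⟩
  intro N x y w hx hy hw hnear hxy hu0
  by_cases hd0 : ∃ n ≤ N, y n = x n
  · obtain ⟨n, hnN, hn⟩ := hd0
    have : y N = x N := by
      induction N, hnN using Nat.le_induction with
      | base => exact hn
      | succ k hk ih =>
        rw [hx k (by omega), hy k (by omega)]
        congr 1
        exact ih (fun j hj => hx j (by omega)) (fun j hj => hy j (by omega))
          (fun j hj => hw j (by omega)) (fun j hj => hnear j (by omega))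
          (fun j hj => hxy j (by omega))
    rw [this, sub_self, norm_zero, mul_zero, mul_zero]
    positivity
  push Not at hd0
  have hdC : ∀ n ≤ N, y n - x n ∉ C := fun n hn h => hd0 n hn (hxy n hn h)
  have hdpos : 0 < ‖y 0 - x 0‖ := norm_pos_iff.2 (sub_ne_zero.2 (hd0 0 N.zero_le))
  set s := κ / 4 * ‖w 0 - x 0‖ / ‖y 0 - x 0‖ with hs
  have hs0 : 0 ≤ s := by positivity
  have key : ∀ n ≤ N, ∀ σ : ℝ, |σ| ≤ (1 + γ) ^ n * s →
      (w n - x n) + σ • (y n - x n) ∈ deepCone C (κ / 2) := by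
    intro n
    induction n with
    | zero =>
      intro _ σ hσ
      refine add_mem_deepCone hu0 hκ hκ1 ?_
      rw [pow_zero, one_mul, hs, le_div_iff₀ hdpos] at hσ
      rwa [norm_smul, Real.norm_eq_abs]
    | succ n ih =>
      intro hn σ hσ
      obtain ⟨z, hz, hzx, hzy, hzw⟩ := hnear n (by omega)
      have hsub := closedBall_subset_closedBall (x := z) (min_le_left ρ δ)
      rw [hx n (by omega), hy n (by omega), hw n (by omega)]
      refine deepCone_step hκ hκ1 hε.le hγ.le hB0 hsm (hB z hz) (hAC z hz) h0 (hAm z hz) hsmall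
        (hest z hz _ (hsub hzw) _ (hsub hzx)) (hest z hz _ (hsub hzy) _ (hsub hzx))
        (hdC n (by omega)) (by positivity) (ih (by omega)) σ ?_
      rwa [← mul_assoc, ← pow_succ']
  have hN := key N le_rfl ((1 + γ) ^ N * s) (by rw [abs_of_nonneg (by positivity)])
  have hend : ((1 + γ) ^ N * s) * ‖y N - x N‖ ≤ (2 / κ + 1) * ‖w N - x N‖ := by
    rcases hs0.eq_or_lt with hs' | hs'
    · rw [← hs', mul_zero, zero_mul]
      positivity
    set σ := (1 + γ) ^ N * s with hσ
    have hσ0 : 0 < σ := by positivity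
    set v := (w N - x N) + σ • (y N - x N) with hv
    have h1 := norm_le_of_mem_deepCone_add hsm hN (hdC N le_rfl) (neg_ne_zero.2 hσ0.ne')
    rw [hv, neg_smul, add_neg_cancel_right, ← hv] at h1
    have h2 : ‖v‖ ≤ 2 / κ * ‖w N - x N‖ := by
      rw [div_mul_eq_mul_div, le_div_iff₀ hκ]
      linarith
    have h3 := norm_sub_le v (w N - x N)
    rw [hv, add_sub_cancel_left, ← hv, norm_smul, Real.norm_eq_abs, abs_of_pos hσ0] at h3
    linarith
  have hsd : s * ‖y 0 - x 0‖ = κ / 4 * ‖w 0 - x 0‖ := by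
    rw [hs]
    field_simp
  have h4 : (1 + γ) ^ N * (‖w 0 - x 0‖ * ‖y N - x N‖) =
      (4 / κ) * ((((1 + γ) ^ N * s) * ‖y N - x N‖) * ‖y 0 - x 0‖) := by
    rw [show (((1 + γ) ^ N * s) * ‖y N - x N‖) * ‖y 0 - x 0‖ =
      (1 + γ) ^ N * (s * ‖y 0 - x 0‖) * ‖y N - x N‖ by ring, hsd]
    field_simp
  rw [h4]
  calc 4 / κ * ((((1 + γ) ^ N * s) * ‖y N - x N‖) * ‖y 0 - x 0‖)
      ≤ 4 / κ * (((2 / κ + 1) * ‖w N - x N‖) * ‖y 0 - x 0‖) := by gcongr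
    _ = _ := by ring

end Domination

/-- A fixed nonprincipal ultrafilter on `ℕ`; limits along it replace passing to subsequences. -/
noncomputable abbrev seqFilter : Filter ℕ := (hyperfilter ℕ : Filter ℕ)

theorem seqFilter_le_atTop : seqFilter ≤ atTop := by
  rw [← Nat.cofinite_eq_atTop]
  exact hyperfilter_le_cofinite

theorem IsCompact.exists_seqFilter_lim {E : Type*} [TopologicalSpace E] {K : Set E}
    (hK : IsCompact K) {a : ℕ → E} (ha : ∀ᶠ n in seqFilter, a n ∈ K) :
    ∃ p ∈ K, Tendsto a seqFilter (nhds p) :=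
  hK.ultrafilter_le_nhds ((hyperfilter ℕ).map a) (le_principal_iff.2 ha)

theorem tendsto_seqFilter_atTop_of_le {t : ℕ → ℝ} (h : ∀ n : ℕ, (n : ℝ) ≤ t n) :
    Tendsto t seqFilter atTop :=
  (tendsto_atTop_mono h tendsto_natCast_atTop_atTop).mono_left seqFilter_le_atTop

section Trajectory

variable {X : Type*} [NormedAddCommGroup X] [NormedSpace ℝ X] {Φ : Semiflow X} {ψ : ℝ → X → X}
  {x p q : X}

namespace Semiflow

theorem tendsto_apply (Φ : Semiflow X) {ι : Type*} {l : Filter ι} {τ : ι → ℝ} {y : ι → X} {τ₀ : ℝ}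
    {y₀ : X} (hτ : Tendsto τ l (nhds τ₀)) (hy : Tendsto y l (nhds y₀))
    (h : ∀ᶠ n in l, 0 ≤ τ n) (h0 : 0 ≤ τ₀) :
    Tendsto (fun n => Φ.toFun (τ n) (y n)) l (nhds (Φ.toFun τ₀ y₀)) := by
  have h1 : ContinuousWithinAt (fun p : ℝ × X => Φ.toFun p.1 p.2) (Ici 0 ×ˢ univ) (τ₀, y₀) :=
    Φ.cont _ ⟨h0, trivial⟩
  have h2 : Tendsto (fun n => (τ n, y n)) l (nhdsWithin (τ₀, y₀) (Ici 0 ×ˢ univ)) :=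
    tendsto_nhdsWithin_iff.2 ⟨hτ.prodMk_nhds hy, h.mono fun n hn => ⟨hn, trivial⟩⟩
  exact h1.tendsto.comp h2

theorem continuous_apply (Φ : Semiflow X) {t : ℝ} (ht : 0 ≤ t) : Continuous (Φ.toFun t) :=
  continuous_iff_continuousAt.2 fun _ => Φ.tendsto_apply tendsto_const_nhds tendsto_id
    (Eventually.of_forall fun _ => ht) ht

theorem continuousOn_time (Φ : Semiflow X) (x : X) :
    ContinuousOn (fun t => Φ.toFun t x) (Ici 0) := fun _ ht =>
  Φ.tendsto_apply (tendsto_nhdsWithin_of_tendsto_nhds tendsto_id) tendsto_const_nhds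
    (eventually_mem_nhdsWithin) ht

end Semiflow

theorem mem_omegaSet_of_tendsto {t : ℕ → ℝ} (ht : Tendsto t seqFilter atTop)
    (h : Tendsto (fun n => Φ.toFun (t n) x) seqFilter (nhds p)) : p ∈ omegaSet Φ x := by
  refine mem_iInter₂.2 fun s _ => ?_
  refine mem_closure_of_tendsto h ?_
  filter_upwards [ht.eventually_ge_atTop s] with n hn
  exact ⟨t n, hn, rfl⟩

theorem exists_tendsto_of_mem_omegaSet (hp : p ∈ omegaSet Φ x) : ∃ t : ℕ → ℝ,
    (∀ n : ℕ, (n : ℝ) ≤ t n) ∧ Tendsto t seqFilter atTop ∧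
      Tendsto (fun n => Φ.toFun (t n) x) seqFilter (nhds p) := by
  have h : ∀ n : ℕ, ∃ t, (n : ℝ) ≤ t ∧ dist (Φ.toFun t x) p < 1 / ((n : ℝ) + 1) := fun n => by
    have h1 := mem_iInter₂.1 hp (n : ℝ) (mem_Ici.2 n.cast_nonneg)
    obtain ⟨_, ⟨t, ht, rfl⟩, h2⟩ := Metric.mem_closure_iff.1 h1 (1 / ((n : ℝ) + 1)) (by positivity)
    exact ⟨t, ht, by rwa [dist_comm]⟩
  choose t ht hd using h
  refine ⟨t, ht, tendsto_seqFilter_atTop_of_le ht, ?_⟩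
  rw [tendsto_iff_dist_tendsto_zero]
  exact squeeze_zero (fun _ => dist_nonneg) (fun n => (hd n).le)
    (tendsto_one_div_add_atTop_nhds_zero_nat.mono_left seqFilter_le_atTop)

/-- The semiorbit of `x` is contained in a compact set. -/
def PrecompactOrbit (Φ : Semiflow X) (x : X) : Prop :=
  ∃ S, IsCompact S ∧ ∀ t, 0 ≤ t → Φ.toFun t x ∈ S

namespace PrecompactOrbit

theorem exists_lim (h : PrecompactOrbit Φ x) {t : ℕ → ℝ} (ht : Tendsto t seqFilter atTop) :
    ∃ p ∈ omegaSet Φ x, Tendsto (fun n => Φ.toFun (t n) x) seqFilter (nhds p) := by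
  obtain ⟨S, hS, hxS⟩ := h
  obtain ⟨p, -, hp⟩ := hS.exists_seqFilter_lim (a := fun n => Φ.toFun (t n) x)
    ((ht.eventually_ge_atTop 0).mono fun n hn => hxS _ hn)
  exact ⟨p, mem_omegaSet_of_tendsto ht hp, hp⟩

theorem isCompact_omegaSet (h : PrecompactOrbit Φ x) : IsCompact (omegaSet Φ x) := by
  obtain ⟨S, hS, hxS⟩ := h
  refine hS.of_isClosed_subset (isClosed_biInter fun _ _ => isClosed_closure) fun p hp => ?_
  obtain ⟨t, ht0, -, htp⟩ := exists_tendsto_of_mem_omegaSet hp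
  exact hS.isClosed.mem_of_tendsto htp
    (Eventually.of_forall fun n => hxS _ (n.cast_nonneg.trans (ht0 n)))

theorem tendsto_shift_semiflow {t s : ℕ → ℝ} {s₀ : ℝ}
    (ht : Tendsto t seqFilter atTop) (hp : Tendsto (fun n => Φ.toFun (t n) x) seqFilter (nhds p))
    (hs : Tendsto s seqFilter (nhds s₀)) (hs0 : ∀ᶠ n in seqFilter, 0 ≤ s n) (h0 : 0 ≤ s₀) :
    Tendsto (fun n => Φ.toFun (t n + s n) x) seqFilter (nhds (Φ.toFun s₀ p)) := by
  refine (Φ.tendsto_apply hs hp hs0 h0).congr' ?_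
  filter_upwards [hs0, ht.eventually_ge_atTop 0] with n h1 h2
  rw [← Φ.map_add _ _ h1 h2, add_comm]

theorem invariant_omegaSet (h : PrecompactOrbit Φ x) : Invariant Φ (omegaSet Φ x) := by
  intro r hr
  refine Subset.antisymm ?_ fun p hp => ?_
  · rintro _ ⟨p, hp, rfl⟩
    obtain ⟨t, -, ht, htp⟩ := exists_tendsto_of_mem_omegaSet hp
    exact mem_omegaSet_of_tendsto (tendsto_atTop_add_const_right _ r ht)
      (tendsto_shift_semiflow ht htp (tendsto_const_nhds (x := r))
        (Eventually.of_forall fun _ => hr) hr)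
  · obtain ⟨t, -, ht, htp⟩ := exists_tendsto_of_mem_omegaSet hp
    have ht' := tendsto_atTop_add_const_right _ (-r) ht
    obtain ⟨q, hq, htq⟩ := h.exists_lim ht'
    refine ⟨q, hq, tendsto_nhds_unique ?_ htp⟩
    simpa using tendsto_shift_semiflow ht' htq (tendsto_const_nhds (x := r))
      (Eventually.of_forall fun _ => hr) hr

theorem exists_near (h : PrecompactOrbit Φ x) {ρ : ℝ} (hρ : 0 < ρ) :
    ∃ t₀, 0 ≤ t₀ ∧ ∀ t, t₀ ≤ t → ∃ z ∈ omegaSet Φ x, dist (Φ.toFun t x) z < ρ := by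
  by_contra! hcon
  choose! t ht hd using fun n : ℕ => hcon n n.cast_nonneg
  obtain ⟨p, hp, htp⟩ := h.exists_lim (tendsto_seqFilter_atTop_of_le ht)
  obtain ⟨n, hn⟩ := (htp.eventually (ball_mem_nhds p hρ)).exists
  exact absurd hn (not_lt.2 (hd n p hp))

/-- `Φ_{t_n}(x) → p` and `s_n → s` give `Φ_{t_n + s_n}(x) → ψ_s(p)`, for every real `s`. -/
theorem tendsto_shift (h : PrecompactOrbit Φ x) (hψ : IsFlowExtensionOn Φ ψ (omegaSet Φ x))
    {t s : ℕ → ℝ} {s₀ : ℝ} (ht : Tendsto t seqFilter atTop)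
    (hp : Tendsto (fun n => Φ.toFun (t n) x) seqFilter (nhds p))
    (hs : Tendsto s seqFilter (nhds s₀)) :
    Tendsto (fun n => Φ.toFun (t n + s n) x) seqFilter (nhds (ψ s₀ p)) := by
  set m := |s₀| + 1 with hm
  have hm0 : 0 ≤ m := by positivity
  have ht' := tendsto_atTop_add_const_right _ (-m) ht
  obtain ⟨q, hq, htq⟩ := h.exists_lim ht'
  have hqp : Φ.toFun m q = p := by
    refine tendsto_nhds_unique ?_ hp
    simpa using tendsto_shift_semiflow ht' htq (tendsto_const_nhds (x := m))
      (Eventually.of_forall fun _ => hm0) hm0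
  have hms : 0 < m + s₀ := by linarith [neg_abs_le s₀]
  have h1 := tendsto_shift_semiflow ht' htq (hs.const_add m)
    ((Tendsto.eventually_const_lt hms (hs.const_add m)).mono fun _ h => h.le) hms.le
  rw [← hqp, ← hψ.1 m hm0 q hq, hψ.2.2.1 _ _ _ hq, add_comm s₀, hψ.1 _ hms.le q hq]
  refine h1.congr fun n => ?_
  congr 1
  ring

end PrecompactOrbit

namespace IsFlowExtensionOn

variable {K : Set X}

theorem map_zero (hψ : IsFlowExtensionOn Φ ψ K) (hp : p ∈ K) : ψ 0 p = p := by
  rw [hψ.1 0 le_rfl p hp, Φ.map_zero]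

theorem map_add (hψ : IsFlowExtensionOn Φ ψ K) (hp : p ∈ K) (s t : ℝ) :
    ψ s (ψ t p) = ψ (s + t) p := hψ.2.2.1 s t p hp

theorem map_neg (hψ : IsFlowExtensionOn Φ ψ K) (hp : p ∈ K) (s : ℝ) : ψ (-s) (ψ s p) = p := by
  rw [hψ.map_add hp, neg_add_cancel, hψ.map_zero hp]

theorem tendsto_apply (hψ : IsFlowExtensionOn Φ ψ K) {ι : Type*} {l : Filter ι} {τ : ι → ℝ}
    {y : ι → X} {τ₀ : ℝ} {y₀ : X} (hτ : Tendsto τ l (nhds τ₀)) (hy : Tendsto y l (nhds y₀))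
    (hyK : ∀ᶠ n in l, y n ∈ K) (h0 : y₀ ∈ K) :
    Tendsto (fun n => ψ (τ n) (y n)) l (nhds (ψ τ₀ y₀)) := by
  have h1 : ContinuousWithinAt (fun p : ℝ × X => ψ p.1 p.2) (univ ×ˢ K) (τ₀, y₀) :=
    hψ.2.2.2 _ ⟨trivial, h0⟩
  have h2 : Tendsto (fun n => (τ n, y n)) l (nhdsWithin (τ₀, y₀) (univ ×ˢ K)) :=
    tendsto_nhdsWithin_iff.2 ⟨hτ.prodMk_nhds hy, hyK.mono fun n hn => ⟨trivial, hn⟩⟩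
  exact h1.tendsto.comp h2

theorem continuous_time (hψ : IsFlowExtensionOn Φ ψ K) (hp : p ∈ K) :
    Continuous fun t => ψ t p :=
  continuous_iff_continuousAt.2 fun _ => hψ.tendsto_apply tendsto_id tendsto_const_nhds
    (Eventually.of_forall fun _ => hp) hp

theorem injOn (hψ : IsFlowExtensionOn Φ ψ K) (s : ℝ) : InjOn (ψ s) K := fun p hp q hq h => by
  rw [← hψ.map_neg hp s, h, hψ.map_neg hq s]

end IsFlowExtensionOn

end Trajectory

section Generic

variable {X : Type*} [NormedAddCommGroup X] [NormedSpace ℝ X] {C : Set X} {Φ : Semiflow X}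
  {DΦ : ℝ → X → X →L[ℝ] X} {x : X}

theorem not_mem_interior_of_eq (hC : IsKCone C 2) (hCu : C ≠ univ) {a b : X}
    (h : a - b ∈ interior C) : a ≠ b := fun he =>
  hC.zero_notMem_interior hCu (by rwa [he, sub_self] at h)

theorem isOpen_pseudoOrdered (hC : IsKCone C 2) (hm : StronglyMonotone Φ C) :
    IsOpen {y | PseudoOrdered Φ C y} := by
  rw [isOpen_iff_mem_nhds]
  rintro y ⟨t₁, t₂, h1, h2, hne, hord⟩
  by_cases hCu : C = univ
  · have h3 : IsOpen {y | Φ.toFun t₁ y ≠ Φ.toFun t₂ y} :=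
      isOpen_ne_fun (Φ.continuous_apply h1) (Φ.continuous_apply h2)
    filter_upwards [h3.mem_nhds hne] with z hz
    exact ⟨t₁, t₂, h1, h2, hz, hCu ▸ mem_univ _⟩
  · have h1' : 0 ≤ 1 + t₁ := by linarith
    have h2' : 0 ≤ 1 + t₂ := by linarith
    have hcont : Continuous fun y => Φ.toFun (1 + t₁) y - Φ.toFun (1 + t₂) y :=
      (Φ.continuous_apply h1').sub (Φ.continuous_apply h2')
    have h3 : Φ.toFun (1 + t₁) y - Φ.toFun (1 + t₂) y ∈ interior C := by
      rw [Φ.map_add _ _ zero_le_one h1, Φ.map_add _ _ zero_le_one h2]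
      exact hm.2 1 one_pos _ _ hord hne
    filter_upwards [(isOpen_interior.preimage hcont).mem_nhds h3] with z hz
    exact ⟨_, _, h1', h2', not_mem_interior_of_eq hC hCu hz, interior_subset hz⟩

theorem mem_equilibria_of_small {p : X} {τ₀ : ℝ} (hτ₀ : 0 < τ₀)
    (h : ∀ τ, 0 ≤ τ → τ ≤ τ₀ → Φ.toFun τ p = p) : p ∈ equilibria Φ := by
  intro t ht
  obtain ⟨n, hn⟩ := exists_nat_gt (t / τ₀)
  have hn0 : (0 : ℝ) < n := (div_nonneg ht hτ₀.le).trans_lt hn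
  have hs : t / n ≤ τ₀ := by
    rw [div_le_iff₀ hn0]
    rw [div_lt_iff₀ hτ₀] at hn
    linarith
  have hs0 : 0 ≤ t / n := by positivity
  have key : ∀ k : ℕ, Φ.toFun (k * (t / n)) p = p := by
    intro k
    induction k with
    | zero => simp [Φ.map_zero]
    | succ k ih =>
      rw [show ((k + 1 : ℕ) : ℝ) * (t / n) = k * (t / n) + t / n by push_cast; ring,
        Φ.map_add _ _ (by positivity) hs0, h _ hs0 hs, ih]
  have := key n
  rwa [mul_div_cancel₀ _ hn0.ne'] at this

theorem PrecompactOrbit.exists_small_time (h : PrecompactOrbit Φ x) {ρ : ℝ} (hρ : 0 < ρ) :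
    ∃ τ₀ > 0, ∀ τ, 0 ≤ τ → τ ≤ τ₀ → ∀ t, 0 ≤ t →
      ‖Φ.toFun (τ + t) x - Φ.toFun t x‖ < ρ := by
  obtain ⟨S, hS, hxS⟩ := h
  by_contra! hcon
  choose τ hτ0 hτ1 t ht hd using fun n : ℕ => hcon (1 / ((n : ℝ) + 1)) (by positivity)
  obtain ⟨q, -, hq⟩ := hS.exists_seqFilter_lim (a := fun n => Φ.toFun (t n) x)
    (Eventually.of_forall fun n => hxS _ (ht n))
  have hτ : Tendsto τ seqFilter (nhds 0) := squeeze_zero hτ0 hτ1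
    (tendsto_one_div_add_atTop_nhds_zero_nat.mono_left seqFilter_le_atTop)
  have h1 := Φ.tendsto_apply hτ hq (Eventually.of_forall hτ0) le_rfl
  rw [Φ.map_zero] at h1
  have h2 := (h1.sub hq).norm
  rw [sub_self, norm_zero] at h2
  obtain ⟨n, hn⟩ := (h2.eventually_lt_const hρ).exists
  rw [← Φ.map_add _ _ (hτ0 n) (ht n)] at hn
  exact absurd hn (not_lt.2 (hd n))

/-- If no point near `x` is pseudo-ordered then the orbit of `x` is stable in the direction of
the cone. -/
theorem exists_stable_of_not_pseudoOrdered (hC : IsKCone C 2) (hCu : C ≠ univ)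
    (hm : StronglyMonotone Φ C) {S : Set X} (hS : IsCompact S) {r : ℝ} (hr : 0 < r)
    (hball : ∀ y ∈ ball x r, (∀ t, 0 ≤ t → Φ.toFun t y ∈ S) ∧ ¬ PseudoOrdered Φ C y)
    {ρ : ℝ} (hρ : 0 < ρ) :
    ∃ δ > 0, ∀ y, y - x ∈ C → ‖y - x‖ < δ → ∀ t, 0 ≤ t → ‖Φ.toFun t y - Φ.toFun t x‖ ≤ ρ := by
  by_contra! hcon
  choose y hyC hyd s hs0 hfar using fun n : ℕ => hcon (1 / ((n : ℝ) + 1)) (by positivity)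
  have hyx : Tendsto y seqFilter (nhds x) := by
    rw [tendsto_iff_norm_sub_tendsto_zero]
    exact squeeze_zero (fun _ => norm_nonneg _) (fun n => (hyd n).le)
      (tendsto_one_div_add_atTop_nhds_zero_nat.mono_left seqFilter_le_atTop)
  have hyball : ∀ᶠ n in seqFilter, y n ∈ ball x r := hyx.eventually (ball_mem_nhds x hr)
  have hs : Tendsto s seqFilter atTop := by
    refine tendsto_atTop.2 fun b => ?_
    by_contra hb
    have hb' : ∀ᶠ n in seqFilter, s n ∈ Icc 0 b :=
      (Ultrafilter.eventually_not.2 hb).mono fun n hn => ⟨hs0 n, (not_le.1 hn).le⟩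
    obtain ⟨s₀, hs₀, hlim⟩ := isCompact_Icc.exists_seqFilter_lim hb'
    have h1 := Φ.tendsto_apply hlim hyx (Eventually.of_forall hs0) hs₀.1
    have h2 := Φ.tendsto_apply hlim (tendsto_const_nhds (x := x)) (Eventually.of_forall hs0) hs₀.1
    have h3 := (h1.sub h2).norm
    rw [sub_self, norm_zero] at h3
    obtain ⟨n, hn⟩ := (h3.eventually_lt_const hρ).exists
    exact absurd hn (not_lt.2 (hfar n).le)
  have hs1 : ∀ᶠ n in seqFilter, 0 ≤ s n - 1 :=
    (hs.eventually_ge_atTop 1).mono fun n hn => sub_nonneg.2 hn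
  obtain ⟨q, -, hq⟩ := hS.exists_seqFilter_lim (a := fun n => Φ.toFun (s n - 1) (y n))
    ((hs1.and hyball).mono fun n hn => (hball _ hn.2).1 _ hn.1)
  obtain ⟨p, -, hp⟩ := hS.exists_seqFilter_lim (a := fun n => Φ.toFun (s n - 1) x)
    (hs1.mono fun n hn => (hball x (mem_ball_self hr)).1 _ hn)
  have hq1 : Tendsto (fun n => Φ.toFun (s n) (y n)) seqFilter (nhds (Φ.toFun 1 q)) := by
    refine (((Φ.continuous_apply zero_le_one).tendsto q).comp hq).congr' ?_
    filter_upwards [hs1] with n hn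
    simp only [Function.comp_apply]
    rw [← Φ.map_add _ _ zero_le_one hn, add_sub_cancel]
  have hp1 : Tendsto (fun n => Φ.toFun (s n) x) seqFilter (nhds (Φ.toFun 1 p)) := by
    refine (((Φ.continuous_apply zero_le_one).tendsto p).comp hp).congr' ?_
    filter_upwards [hs1] with n hn
    simp only [Function.comp_apply]
    rw [← Φ.map_add _ _ zero_le_one hn, add_sub_cancel]
  have hqp : q - p ∈ C := hC.1.mem_of_tendsto (hq.sub hp)
    (hs1.mono fun n hn => hm.1 _ hn _ _ (hyC n))
  have hne : q ≠ p := by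
    rintro rfl
    have h3 := (hq1.sub hp1).norm
    rw [sub_self, norm_zero] at h3
    obtain ⟨n, hn⟩ := (h3.eventually_lt_const hρ).exists
    exact absurd hn (not_lt.2 (hfar n).le)
  have hmemint := hm.2 1 one_pos _ _ hqp hne
  obtain ⟨m, hmm⟩ : ∃ m, Φ.toFun 1 q - Φ.toFun (s m) x ∈ interior C :=
    ((hp1.const_sub (Φ.toFun 1 q)).eventually (isOpen_interior.mem_nhds hmemint)).exists
  have h4 := (hq1.sub (((Φ.continuous_apply (hs0 m)).tendsto x).comp hyx)).eventually
    (isOpen_interior.mem_nhds hmm)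
  obtain ⟨n, hn, hnb⟩ := (h4.and hyball).exists
  exact (hball _ hnb).2 ⟨s n, s m, hs0 n, hs0 m, not_mem_interior_of_eq hC hCu hn,
    interior_subset hn⟩

theorem IsKCone.exists_ne_zero (hC : IsKCone C 2) : ∃ e ∈ C, e ≠ 0 := by
  obtain ⟨W, hW, hr⟩ := hC.2.2.1
  have : Nontrivial W := by
    rw [← rank_pos_iff_nontrivial (R := ℝ), hr]
    norm_num
  obtain ⟨e, he⟩ := exists_ne (0 : W)
  exact ⟨e, hW e.2, by simpa using he⟩

theorem omegaSet_subset_equilibria [CompleteSpace X] (hC : IsKCone C 2)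
    (hΦ : StronglyFocusingMonotone Φ DΦ C) {S : Set X} (hS : IsCompact S) {r : ℝ} (hr : 0 < r)
    (hball : ∀ y ∈ ball x r, (∀ t, 0 ≤ t → Φ.toFun t y ∈ S) ∧ ¬ PseudoOrdered Φ C y) :
    omegaSet Φ x ⊆ equilibria Φ := by
  have hx := hball x (mem_ball_self hr)
  have hpre : PrecompactOrbit Φ x := ⟨S, hS, hx.1⟩
  by_cases hCu : C = univ
  · have hfix : ∀ t, 0 ≤ t → Φ.toFun t x = x := fun t ht => by
      by_contra hne
      exact hx.2 ⟨t, 0, ht, le_rfl, by rwa [Φ.map_zero], hCu ▸ mem_univ _⟩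
    intro p hp
    obtain ⟨t, ht0, -, htp⟩ := exists_tendsto_of_mem_omegaSet hp
    have : p = x := tendsto_nhds_unique htp
      (tendsto_const_nhds.congr fun n => (hfix _ (n.cast_nonneg.trans (ht0 n))).symm)
    rw [this]
    exact hfix
  have hm := hΦ.2.2.1
  obtain ⟨T, hT, κ, hκ, ρ, hρ, γ, hγ, M, hM, hdeep, hdom⟩ := exists_domination hC hCu hΦ
    hpre.isCompact_omegaSet hpre.invariant_omegaSet
  obtain ⟨e, heC, he0⟩ := hC.exists_ne_zero
  obtain ⟨δ, hδ, hstab⟩ := exists_stable_of_not_pseudoOrdered hC hCu hm hS hr hball (half_pos hρ)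
  obtain ⟨w, hwC, hwne, hw⟩ : ∃ w, w - x ∈ C ∧ w ≠ x ∧
      ∀ t, 0 ≤ t → ‖Φ.toFun t w - Φ.toFun t x‖ ≤ ρ / 2 := by
    have he : 0 < ‖e‖ := norm_pos_iff.2 he0
    refine ⟨x + (δ / (2 * ‖e‖)) • e, ?_, ?_, ?_⟩
    · simpa using hC.2.1 _ e heC
    · simp [he0, hδ.ne']
    · refine hstab _ (by simpa using hC.2.1 _ e heC) ?_
      rw [add_sub_cancel_left, norm_smul, Real.norm_eq_abs, abs_of_pos (by positivity)]
      field_simp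
      linarith
  obtain ⟨τ₀, hτ₀, hτ⟩ := hpre.exists_small_time (half_pos hρ)
  obtain ⟨t₀, ht₀, hnear⟩ := hpre.exists_near (half_pos hρ)
  have hballs : ∀ t, t₀ ≤ t → ∀ τ, 0 ≤ τ → τ ≤ τ₀ → ∃ z ∈ omegaSet Φ x,
      Φ.toFun t x ∈ closedBall z ρ ∧ Φ.toFun (τ + t) x ∈ closedBall z ρ ∧
      Φ.toFun t w ∈ closedBall z ρ := by
    intro t ht τ h0 h1
    obtain ⟨z, hz, hd⟩ := hnear t ht
    have ht0 := ht₀.trans ht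
    have h2 := hτ τ h0 h1 t ht0
    have h3 := hw t ht0
    rw [← dist_eq_norm] at h2 h3
    refine ⟨z, hz, ?_, ?_, ?_⟩ <;> rw [mem_closedBall]
    · linarith
    · linarith [dist_triangle (Φ.toFun (τ + t) x) (Φ.toFun t x) z]
    · linarith [dist_triangle (Φ.toFun t w) (Φ.toFun t x) z]
  have htime : ∀ n : ℕ, 0 ≤ t₀ + T + n * T := fun n => by positivity
  set u₀ := Φ.toFun (t₀ + T) w - Φ.toFun (t₀ + T) x with hu₀
  have hu₀deep : u₀ ∈ deepCone C κ := by
    obtain ⟨z, hz, h1, -, h2⟩ := hballs t₀ le_rfl 0 le_rfl hτ₀.le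
    rw [hu₀, add_comm t₀, Φ.map_add _ _ hT.le ht₀, Φ.map_add _ _ hT.le ht₀]
    exact hdeep z hz _ h2 _ h1 (hm.1 _ ht₀ _ _ hwC)
  have hu₀ne : 0 < ‖u₀‖ := norm_pos_iff.2 (sub_ne_zero.2
    (not_mem_interior_of_eq hC hCu (hm.2 _ (by positivity) _ _ hwC hwne)))
  have hd : ∀ τ, 0 ≤ τ → τ ≤ τ₀ → Tendsto (fun N : ℕ =>
      Φ.toFun (τ + (t₀ + T + N * T)) x - Φ.toFun (t₀ + T + N * T) x) atTop (nhds 0) := by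
    intro τ h0 h1
    have hb : ∀ N : ℕ, ‖Φ.toFun (τ + (t₀ + T + N * T)) x - Φ.toFun (t₀ + T + N * T) x‖ ≤
        M * ((ρ / 2) * (ρ / 2)) / ‖u₀‖ * (1 / (1 + γ)) ^ N := by
      intro N
      have h2 := hdom N (fun n => Φ.toFun (t₀ + T + n * T) x)
        (fun n => Φ.toFun (τ + (t₀ + T + n * T)) x) (fun n => Φ.toFun (t₀ + T + n * T) w)
        (fun n _ => by
          rw [← Φ.map_add _ _ hT.le (htime n)]
          congr 1
          push_cast
          ring)
        (fun n _ => by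
          rw [← Φ.map_add _ _ hT.le (add_nonneg h0 (htime n))]
          congr 1
          push_cast
          ring)
        (fun n _ => by
          rw [← Φ.map_add _ _ hT.le (htime n)]
          congr 1
          push_cast
          ring)
        (fun n _ => hballs _ (by nlinarith [(n.cast_nonneg : (0 : ℝ) ≤ n)]) τ h0 h1)
        (fun n _ hn => by
          by_contra hne
          exact hx.2 ⟨_, _, add_nonneg h0 (htime n), htime n, hne, hn⟩)
        (by simpa using hu₀deep)
      simp only [Nat.cast_zero, zero_mul, add_zero] at h2
      rw [← hu₀] at h2
      have h3 : ‖Φ.toFun (τ + (t₀ + T)) x - Φ.toFun (t₀ + T) x‖ ≤ ρ / 2 :=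
        (hτ τ h0 h1 _ (by positivity)).le
      have h4 := hw _ (htime N)
      have h5 : M * (‖Φ.toFun (τ + (t₀ + T)) x - Φ.toFun (t₀ + T) x‖ *
          ‖Φ.toFun (t₀ + T + N * T) w - Φ.toFun (t₀ + T + N * T) x‖) ≤
          M * ((ρ / 2) * (ρ / 2)) := by gcongr
      rw [one_div, inv_pow, ← div_eq_mul_inv, div_div, le_div_iff₀ (by positivity)]
      linarith
    refine squeeze_zero_norm hb ?_
    have h6 : Tendsto (fun N : ℕ => (1 / (1 + γ)) ^ N) atTop (nhds 0) :=
      tendsto_pow_atTop_nhds_zero_of_lt_one (by positivity) (by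
        rw [div_lt_one (by positivity)]
        linarith)
    simpa using h6.const_mul (M * ((ρ / 2) * (ρ / 2)) / ‖u₀‖)
  intro p hp
  obtain ⟨t, -, ht, htp⟩ := exists_tendsto_of_mem_omegaSet hp
  set N : ℕ → ℕ := fun n => ⌊(t n - t₀ - T) / T⌋₊ with hN
  set s : ℕ → ℝ := fun n => t₀ + T + N n * T with hsdef
  have hNt : Tendsto N seqFilter atTop :=
    tendsto_nat_floor_atTop.comp ((tendsto_atTop_add_const_right _ (-(t₀ + T)) ht).congr
      (fun n => by ring) |>.atTop_div_const hT)
  have hst : Tendsto s seqFilter atTop :=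
    tendsto_atTop_add_const_left _ _ ((tendsto_natCast_atTop_atTop.comp hNt).atTop_mul_const hT)
  have hrem : ∀ᶠ n in seqFilter, t n - s n ∈ Icc 0 T := by
    filter_upwards [ht.eventually_ge_atTop (t₀ + T)] with n hn
    have h1 := Nat.floor_le (a := (t n - t₀ - T) / T) (div_nonneg (by linarith) hT.le)
    have h2 := Nat.lt_floor_add_one ((t n - t₀ - T) / T)
    rw [le_div_iff₀ hT] at h1
    rw [div_lt_iff₀ hT] at h2
    simp only [hsdef, hN]
    constructor <;> nlinarith
  obtain ⟨r₀, hr₀, hlim⟩ := isCompact_Icc.exists_seqFilter_lim hrem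
  obtain ⟨q, hq, hsq⟩ := hpre.exists_lim hst
  have hpq : Φ.toFun r₀ q = p := by
    refine tendsto_nhds_unique ?_ htp
    simpa using PrecompactOrbit.tendsto_shift_semiflow hst hsq hlim
      (hrem.mono fun n hn => hn.1) hr₀.1
  refine mem_equilibria_of_small hτ₀ fun τ h0 h1 => ?_
  have hfix : Φ.toFun τ q = q := by
    have h2 := PrecompactOrbit.tendsto_shift_semiflow hst hsq (tendsto_const_nhds (x := τ))
      (Eventually.of_forall fun _ => h0) h0
    have h3 := (hd τ h0 h1).comp hNt
    have h4 : Tendsto (fun n => Φ.toFun (s n + τ) x) seqFilter (nhds q) := by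
      have := h3.add hsq
      rw [zero_add] at this
      refine this.congr fun n => ?_
      simp only [Function.comp_apply, hsdef]
      rw [sub_add_cancel, add_comm τ]
    exact tendsto_nhds_unique h2 h4
  rw [← hpq, ← Φ.map_add _ _ h0 hr₀.1, add_comm, Φ.map_add _ _ hr₀.1 h0, hfix]

end Generic

section Order

variable {X : Type*} [NormedAddCommGroup X] [NormedSpace ℝ X] {C : Set X} {Φ : Semiflow X}
  {ψ : ℝ → X → X} {x : X}

namespace IsFlowExtensionOn

variable {K : Set X} {p : X}

theorem apply_of_mem_equilibria (hψ : IsFlowExtensionOn Φ ψ K) (hp : p ∈ K)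
    (hE : p ∈ equilibria Φ) (s : ℝ) : ψ s p = p := by
  rcases le_total 0 s with h | h
  · rw [hψ.1 s h p hp, hE s h]
  · have h1 : ψ (-s) p = p := by rw [hψ.1 _ (by linarith) p hp, hE _ (by linarith)]
    have h2 := hψ.map_neg hp (-s)
    rwa [neg_neg, h1] at h2

theorem mem_equilibria_iff (hψ : IsFlowExtensionOn Φ ψ K) (hp : p ∈ K) :
    p ∈ equilibria Φ ↔ ∀ s, ψ s p = p :=
  ⟨fun h s => hψ.apply_of_mem_equilibria hp h s, fun h t ht => by rw [← hψ.1 t ht p hp, h]⟩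

theorem apply_mem_equilibria_iff (hψ : IsFlowExtensionOn Φ ψ K) (hp : p ∈ K) (s : ℝ) :
    ψ s p ∈ equilibria Φ ↔ p ∈ equilibria Φ := by
  constructor
  · intro h
    have h1 := hψ.apply_of_mem_equilibria (hψ.2.1 s p hp) h (-s)
    rw [hψ.map_neg hp] at h1
    rwa [h1]
  · intro h
    rwa [hψ.apply_of_mem_equilibria hp h s]

/-- The stabilizer of a point under the flow. -/
def stabilizer (hψ : IsFlowExtensionOn Φ ψ K) (hp : p ∈ K) : AddSubgroup ℝ where
  carrier := {s | ψ s p = p}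
  zero_mem' := hψ.map_zero hp
  add_mem' {a b} ha hb := by
    simp only [mem_ofPred_eq] at ha hb ⊢
    rw [← hψ.map_add hp, hb, ha]
  neg_mem' {a} ha := by
    simp only [mem_ofPred_eq] at ha ⊢
    nth_rw 1 [← ha]
    rw [hψ.map_neg hp]

theorem mem_stabilizer (hψ : IsFlowExtensionOn Φ ψ K) (hp : p ∈ K) {s : ℝ} :
    s ∈ hψ.stabilizer hp ↔ ψ s p = p := Iff.rfl

theorem isClosed_stabilizer (hψ : IsFlowExtensionOn Φ ψ K) (hp : p ∈ K) :
    IsClosed (hψ.stabilizer hp : Set ℝ) :=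
  isClosed_eq (hψ.continuous_time hp) continuous_const

theorem mem_equilibria_of_dense (hψ : IsFlowExtensionOn Φ ψ K) (hp : p ∈ K)
    (h : Dense (hψ.stabilizer hp : Set ℝ)) : p ∈ equilibria Φ := by
  rw [hψ.mem_equilibria_iff hp]
  intro s
  have := h.closure_eq ▸ (hψ.isClosed_stabilizer hp).closure_eq
  have hs : s ∈ (hψ.stabilizer hp : Set ℝ) := this ▸ mem_univ s
  exact hs

theorem exists_minimal_period (hψ : IsFlowExtensionOn Φ ψ K) (hp : p ∈ K)
    (hE : p ∉ equilibria Φ) {T : ℝ} (hT : T ≠ 0) (hTp : ψ T p = p) :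
    ∃ τ > 0, ∀ s, ψ s p = p ↔ ∃ n : ℤ, s = n * τ := by
  rcases (hψ.stabilizer hp).dense_or_cyclic with h | ⟨a, ha⟩
  · exact absurd (hψ.mem_equilibria_of_dense hp h) hE
  have key : ∀ s, ψ s p = p ↔ ∃ n : ℤ, s = n * a := fun s => by
    rw [← hψ.mem_stabilizer hp, ha, ← AddSubgroup.zmultiples_eq_closure,
      AddSubgroup.mem_zmultiples_iff]
    simp [eq_comm]
  have ha0 : a ≠ 0 := by
    rintro rfl
    obtain ⟨n, hn⟩ := (key T).1 hTp
    exact hT (by simpa using hn)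
  refine ⟨|a|, abs_pos.2 ha0, fun s => ?_⟩
  rw [key]
  rcases abs_choice a with h | h <;> rw [h]
  constructor <;> rintro ⟨n, rfl⟩ <;> exact ⟨-n, by push_cast; ring⟩

theorem mem_equilibria_of_const_on (hψ : IsFlowExtensionOn Φ ψ K) (hp : p ∈ K) {a b : ℝ}
    (hab : a < b) {c : X} (h : ∀ s ∈ Icc a b, ψ s p = c) : p ∈ equilibria Φ := by
  refine mem_equilibria_of_small (sub_pos.2 hab) fun τ h0 h1 => ?_
  rw [← hψ.1 τ h0 p hp]
  have h2 : ψ (a + τ) p = ψ a p := by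
    rw [h a ⟨le_rfl, hab.le⟩, h _ ⟨by linarith, by linarith⟩]
  rw [← hψ.map_add hp] at h2
  exact hψ.injOn a (hψ.2.1 _ _ hp) hp h2

end IsFlowExtensionOn

/-- A precompact orbit of a semiflow which is strongly monotone with respect to a cone of rank two,
with a flow extension on its limit set. -/
structure ConeTrajectory (Φ : Semiflow X) (C : Set X) (ψ : ℝ → X → X) (x : X) : Prop where
  cone : IsKCone C 2
  mono : StronglyMonotone Φ C
  pre : PrecompactOrbit Φ x
  flow : IsFlowExtensionOn Φ ψ (omegaSet Φ x)

namespace ConeTrajectory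

variable {p q a b : X}

theorem sub_mem (h : ConeTrajectory Φ C ψ x) (ha : a ∈ omegaSet Φ x) (hb : b ∈ omegaSet Φ x)
    (hab : a - b ∈ C) {t : ℝ} (ht : 0 ≤ t) : ψ t a - ψ t b ∈ C := by
  rw [h.flow.1 t ht a ha, h.flow.1 t ht b hb]
  exact h.mono.1 t ht a b hab

theorem sub_mem_interior (h : ConeTrajectory Φ C ψ x) (ha : a ∈ omegaSet Φ x)
    (hb : b ∈ omegaSet Φ x) (hab : a - b ∈ C) (hne : a ≠ b) {t : ℝ} (ht : 0 < t) :
    ψ t a - ψ t b ∈ interior C := by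
  rw [h.flow.1 t ht.le a ha, h.flow.1 t ht.le b hb]
  exact h.mono.2 t ht a b hab hne

theorem sub_mem_interior' (h : ConeTrajectory Φ C ψ x) (ha : a ∈ omegaSet Φ x)
    (hb : b ∈ omegaSet Φ x) {r : ℝ} (hr : 0 < r) (hab : ψ (-r) a - ψ (-r) b ∈ C) (hne : a ≠ b) :
    a - b ∈ interior C := by
  have h1 := h.sub_mem_interior (h.flow.2.1 _ _ ha) (h.flow.2.1 _ _ hb) hab
    (fun he => hne (h.flow.injOn (-r) ha hb he)) hr
  rwa [h.flow.map_add ha, h.flow.map_add hb, add_neg_cancel, h.flow.map_zero ha,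
    h.flow.map_zero hb] at h1

theorem orbit_ordered_of_forall (h : ConeTrajectory Φ C ψ x)
    (hs : ∀ p ∈ omegaSet Φ x, ∀ s, 0 < s → p - ψ s p ∈ C) (hp : p ∈ omegaSet Φ x) (s : ℝ) :
    p - ψ s p ∈ C := by
  rcases lt_trichotomy 0 s with h0 | rfl | h0
  · exact hs p hp s h0
  · rw [h.flow.map_zero hp, sub_self]
    exact h.cone.zero_mem
  · have h1 := hs _ (h.flow.2.1 s p hp) (-s) (by linarith)
    rw [h.flow.map_neg hp] at h1
    exact h.cone.sub_comm_mem h1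

/-- Every orbit in the limit set of an injective pseudo-ordered orbit is ordered. -/
theorem orbit_ordered (h : ConeTrajectory Φ C ψ x) (hx : PseudoOrdered Φ C x)
    (hinj : InjOn (fun t => Φ.toFun t x) (Ici 0)) (hp : p ∈ omegaSet Φ x) (s : ℝ) :
    p - ψ s p ∈ C := by
  set Sig : Set ℝ := {s | 0 < s ∧ ∃ t, 0 ≤ t ∧ Φ.toFun t x - Φ.toFun (t + s) x ∈ C} with hSig
  have hlim : ∀ s ∈ Sig, ∀ p ∈ omegaSet Φ x, p - ψ s p ∈ C := by
    rintro s ⟨hs0, t, ht, hts⟩ p hp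
    obtain ⟨r, -, hr, hrp⟩ := exists_tendsto_of_mem_omegaSet hp
    have h1 := h.pre.tendsto_shift h.flow hr hrp (tendsto_const_nhds (x := s))
    refine h.cone.1.mem_of_tendsto (hrp.sub h1) ?_
    filter_upwards [hr.eventually_ge_atTop t] with n hn
    have h2 := h.mono.1 (r n - t) (by linarith) _ _ hts
    rwa [← Φ.map_add _ _ (by linarith) ht, ← Φ.map_add _ _ (by linarith) (by linarith),
      sub_add_cancel, ← add_assoc, sub_add_cancel] at h2
  have hne : Sig.Nonempty := by
    obtain ⟨t₁, t₂, h1, h2, hne, hord⟩ := hx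
    rcases lt_trichotomy t₁ t₂ with hlt | rfl | hlt
    · exact ⟨t₂ - t₁, by linarith, t₁, h1, by rwa [add_sub_cancel]⟩
    · exact absurd rfl hne
    · exact ⟨t₁ - t₂, by linarith, t₂, h2, by
        rw [add_sub_cancel]
        exact h.cone.sub_comm_mem hord⟩
  have hopen : IsOpen Sig := by
    rw [isOpen_iff_mem_nhds]
    rintro s ⟨hs0, t, ht, hts⟩
    have h1 : Φ.toFun (1 + t) x - Φ.toFun (1 + (t + s)) x ∈ interior C := by
      rw [Φ.map_add _ _ zero_le_one ht, Φ.map_add _ _ zero_le_one (by linarith)]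
      refine h.mono.2 1 one_pos _ _ hts fun he => ?_
      have := hinj (mem_Ici.2 ht) (mem_Ici.2 (by linarith)) he
      linarith
    have h2 : ContinuousAt (fun s => Φ.toFun (1 + t) x - Φ.toFun (1 + t + s) x) s := by
      refine continuousAt_const.sub (Φ.tendsto_apply (tendsto_const_nhds.add tendsto_id)
        tendsto_const_nhds ?_ (by positivity))
      filter_upwards [lt_mem_nhds hs0] with n hn
      linarith
    rw [← add_assoc] at h1
    filter_upwards [h2.eventually_mem (isOpen_interior.mem_nhds h1), lt_mem_nhds hs0] with u hu hu0
    exact ⟨hu0, 1 + t, by linarith, interior_subset hu⟩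
  by_cases hall : Ioi 0 ⊆ Sig
  · exact h.orbit_ordered_of_forall (fun p hp s hs => hlim s (hall hs) p hp) hp s
  obtain ⟨s₀, hs₀c, hs₀, hs₀n⟩ : ∃ s₀ ∈ closure Sig, 0 < s₀ ∧ s₀ ∉ Sig := by
    by_contra! hcon
    obtain ⟨s₁, hs₁⟩ := hne
    exact hall (isPreconnected_Ioi.subset_of_closure_inter_subset hopen ⟨s₁, hs₁.1, hs₁⟩
      fun s hs => hcon s hs.1 hs.2)
  have hper : ∀ q ∈ omegaSet Φ x, ψ s₀ q = q := by
    intro q hq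
    by_contra hqne
    have h1 : q - ψ s₀ q ∈ C := by
      have hcl : IsClosed {s | q - ψ s q ∈ C} :=
        h.cone.1.preimage (continuous_const.sub (h.flow.continuous_time hq))
      exact closure_minimal (fun s hs => hlim s hs q hq) hcl hs₀c
    have h2 := h.sub_mem_interior hq (h.flow.2.1 _ _ hq) h1 (Ne.symm hqne) one_pos
    obtain ⟨r, -, hr, hrp⟩ := exists_tendsto_of_mem_omegaSet (h.flow.2.1 1 q hq)
    have h3 := hrp.sub (h.pre.tendsto_shift h.flow hr hrp (tendsto_const_nhds (x := s₀)))
    rw [h.flow.map_add hq, add_comm, ← h.flow.map_add hq] at h3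
    obtain ⟨n, hn, hn0⟩ := ((h3.eventually (isOpen_interior.mem_nhds h2)).and
      (hr.eventually_ge_atTop 0)).exists
    exact hs₀n ⟨hs₀, r n, hn0, interior_subset hn⟩
  by_cases hE : p ∈ equilibria Φ
  · rw [h.flow.apply_of_mem_equilibria hp hE, sub_self]
    exact h.cone.zero_mem
  obtain ⟨τ, hτ, hτp⟩ := h.flow.exists_minimal_period hp hE hs₀.ne' (hper p hp)
  have hred : ∀ s, ∃ u ∈ Ico 0 τ, ψ s p = ψ u p := by
    intro s
    refine ⟨s - ⌊s / τ⌋ * τ, ⟨?_, ?_⟩, ?_⟩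
    · have := Int.floor_le (s / τ)
      rw [le_div_iff₀ hτ] at this
      linarith
    · have := Int.lt_floor_add_one (s / τ)
      rw [div_lt_iff₀ hτ] at this
      linarith
    · have h1 : ψ (⌊s / τ⌋ * τ) p = p := (hτp _).2 ⟨_, rfl⟩
      nth_rw 2 [← h1]
      rw [h.flow.map_add hp, sub_add_cancel]
  have hne' : ∀ u ∈ Ioo 0 τ, ψ u p ≠ p := by
    intro u hu he
    obtain ⟨n, hn⟩ := (hτp u).1 he
    have h1 : (0 : ℝ) < n := by
      by_contra hn0
      have := hu.1
      rw [hn] at this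
      nlinarith
    have h2 : (n : ℝ) < 1 := by
      by_contra hn0
      have := hu.2
      rw [hn] at this
      nlinarith
    have h3 : (0 : ℤ) < n := by exact_mod_cast h1
    have h4 : n < (1 : ℤ) := by exact_mod_cast h2
    omega
  have hstr : ∀ u, p - ψ u p ∈ C → ψ u p ≠ p → p - ψ u p ∈ interior C := by
    intro u hu hune
    have h1 := h.sub_mem_interior hp (h.flow.2.1 _ _ hp) hu hune.symm hs₀
    rwa [h.flow.map_add hp, add_comm, ← h.flow.map_add hp, hper p hp] at h1
  have hcont : Continuous fun u => p - ψ u p := continuous_const.sub (h.flow.continuous_time hp)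
  have hsub : Ioo 0 τ ⊆ {u | p - ψ u p ∈ interior C} := by
    refine isPreconnected_Ioo.subset_of_closure_inter_subset (isOpen_interior.preimage hcont) ?_ ?_
    · obtain ⟨s₁, hs₁, hs₁p⟩ : ∃ s ∈ Sig, ψ s p ≠ p := by
        by_contra! hcon
        obtain ⟨s₁, hs₁⟩ := hne
        obtain ⟨ε, hε, hb⟩ := Metric.isOpen_iff.1 hopen s₁ hs₁
        refine hE (h.flow.mem_equilibria_of_const_on hp (a := s₁) (b := s₁ + ε / 2) (c := p)
          (by linarith) fun s hs => hcon s (hb ?_))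
        rw [mem_ball, Real.dist_eq, abs_lt]
        constructor <;> linarith [hs.1, hs.2]
      obtain ⟨u, hu, hue⟩ := hred s₁
      refine ⟨u, ⟨lt_of_le_of_ne hu.1 ?_, hu.2⟩, ?_⟩
      · rintro rfl
        rw [h.flow.map_zero hp] at hue
        exact hs₁p hue
      · have := hstr s₁ (hlim s₁ hs₁ p hp) hs₁p
        rwa [hue] at this
    · rintro u ⟨hu, hu2⟩
      refine hstr u ?_ (hne' u hu2)
      have hcl : closure {u | p - ψ u p ∈ interior C} ⊆ {u | p - ψ u p ∈ C} :=
        closure_minimal (fun v hv => interior_subset (s := C) hv) (h.cone.1.preimage hcont)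
      exact hcl hu
  obtain ⟨u, hu, hue⟩ := hred s
  rw [hue]
  rcases hu.1.eq_or_lt with rfl | hu0
  · rw [h.flow.map_zero hp, sub_self]
    exact h.cone.zero_mem
  · exact interior_subset (hsub ⟨hu0, hu.2⟩)

end ConeTrajectory

end Order

section AlphaLimits

variable {X : Type*} [NormedAddCommGroup X] {ψ : ℝ → X → X}

theorem mem_alphaSet_of_tendsto {z e : X} {r : ℕ → ℝ} (hr : Tendsto r seqFilter atTop)
    (h : Tendsto (fun n => ψ (-r n) z) seqFilter (nhds e)) : e ∈ alphaSet ψ z := by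
  refine mem_iInter₂.2 fun s _ => ?_
  refine mem_closure_of_tendsto h ?_
  filter_upwards [hr.eventually_ge_atTop s] with n hn
  exact ⟨r n, hn, rfl⟩

theorem exists_tendsto_of_mem_alphaSet {z e : X} (he : e ∈ alphaSet ψ z) : ∃ r : ℕ → ℝ,
    (∀ n : ℕ, (n : ℝ) ≤ r n) ∧ Tendsto r seqFilter atTop ∧
      Tendsto (fun n => ψ (-r n) z) seqFilter (nhds e) := by
  have h : ∀ n : ℕ, ∃ t, (n : ℝ) ≤ t ∧ dist (ψ (-t) z) e < 1 / ((n : ℝ) + 1) := fun n => by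
    have h1 := mem_iInter₂.1 he (n : ℝ) (mem_Ici.2 n.cast_nonneg)
    obtain ⟨_, ⟨t, ht, rfl⟩, h2⟩ := Metric.mem_closure_iff.1 h1 (1 / ((n : ℝ) + 1)) (by positivity)
    exact ⟨t, ht, by rwa [dist_comm]⟩
  choose t ht hd using h
  refine ⟨t, ht, tendsto_seqFilter_atTop_of_le ht, ?_⟩
  refine tendsto_iff_dist_tendsto_zero.2
    (squeeze_zero (fun _ => dist_nonneg) (fun n => (hd n).le) ?_)
  exact tendsto_one_div_add_atTop_nhds_zero_nat.mono_left seqFilter_le_atTop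

end AlphaLimits

section Alpha

variable {X : Type*} [NormedAddCommGroup X] [NormedSpace ℝ X] {C : Set X} {Φ : Semiflow X}
  {ψ : ℝ → X → X} {x : X}

theorem IsFlowExtensionOn.tendsto_shift {K : Set X} {p p' : X} {r : ℕ → ℝ}
    (hψ : IsFlowExtensionOn Φ ψ K) (hp : p ∈ K) (hp' : p' ∈ K)
    (h : Tendsto (fun n => ψ (r n) p) seqFilter (nhds p')) (s : ℝ) :
    Tendsto (fun n => ψ (s + r n) p) seqFilter (nhds (ψ s p')) := by
  refine (hψ.tendsto_apply (tendsto_const_nhds (x := s)) h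
    (Eventually.of_forall fun n => hψ.2.1 _ _ hp) hp').congr fun n => ?_
  rw [hψ.map_add hp]

/-- A trajectory for which every orbit of the limit set is ordered. -/
structure OrderedTrajectory (Φ : Semiflow X) (C : Set X) (ψ : ℝ → X → X) (x : X) : Prop
    extends ConeTrajectory Φ C ψ x where
  ordered : ∀ p ∈ omegaSet Φ x, ∀ s, p - ψ s p ∈ C

namespace OrderedTrajectory

variable {p q z z' q' e : X}

theorem ordered_lt (h : OrderedTrajectory Φ C ψ x) (hp : p ∈ omegaSet Φ x) {s u : ℝ}
    (hne : ψ s p ≠ ψ u p) : ψ s p - ψ u p ∈ interior C := by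
  have hs := h.flow.2.1 s p hp
  have hu := h.flow.2.1 u p hp
  refine h.sub_mem_interior' hs hu one_pos ?_ hne
  rw [h.flow.map_add hp, h.flow.map_add hp]
  have h1 := h.ordered _ (h.flow.2.1 (-1 + s) p hp) (u - s)
  rw [h.flow.map_add hp] at h1
  convert h1 using 3
  ring

theorem exists_forward_ordered (hp : p ∈ omegaSet Φ x) {B : Set X}
    (hB : IsCompact B) (hpB : ∀ b ∈ B, p - b ∈ interior C) :
    ∃ t, 0 ≤ t ∧ ∀ b ∈ B, Φ.toFun t x - b ∈ C := by
  have hcont : Continuous fun b => p - b := continuous_const.sub continuous_id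
  obtain ⟨δ, hδ, hsub⟩ := (hB.image hcont).exists_thickening_subset_open isOpen_interior
    (image_subset_iff.2 hpB)
  obtain ⟨t, -, ht, htp⟩ := exists_tendsto_of_mem_omegaSet hp
  obtain ⟨n, hn, hn0⟩ := ((htp.eventually (ball_mem_nhds p hδ)).and
    (ht.eventually_ge_atTop 0)).exists
  refine ⟨t n, hn0, fun b hb => interior_subset (hsub ?_)⟩
  refine mem_thickening_iff.2 ⟨p - b, ⟨b, hb, rfl⟩, ?_⟩
  rwa [dist_sub_right]

theorem sub_mem_of_forward (h : OrderedTrajectory Φ C ψ x) (he : e ∈ equilibria Φ) {t : ℝ}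
    (ht : 0 ≤ t) (hte : Φ.toFun t x - e ∈ C) (hq : q ∈ omegaSet Φ x) : q - e ∈ C := by
  obtain ⟨r, -, hr, hrq⟩ := exists_tendsto_of_mem_omegaSet hq
  refine h.cone.1.mem_of_tendsto (hrq.sub tendsto_const_nhds) ?_
  filter_upwards [hr.eventually_ge_atTop t] with n hn
  have h2 := h.mono.1 (r n - t) (by linarith) _ _ hte
  rwa [← Φ.map_add _ _ (by linarith) ht, sub_add_cancel, he _ (by linarith)] at h2

/-- The times by which the second orbit must be shifted to be unordered with the first one. -/
def offsets (C : Set X) (ψ : ℝ → X → X) (q z : X) : Set ℝ :=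
  {s | ∃ r, 0 ≤ r ∧ ψ (-r) q - ψ (s - r) z ∉ C}

theorem notMem_of_le (h : OrderedTrajectory Φ C ψ x) (hq : q ∈ omegaSet Φ x)
    (hz : z ∈ omegaSet Φ x) {s r r' : ℝ} (hr : ψ (-r) q - ψ (s - r) z ∉ C) (hrr : r ≤ r') :
    ψ (-r') q - ψ (s - r') z ∉ C := fun hcon => hr <| by
  have h1 := h.sub_mem (h.flow.2.1 _ _ hq) (h.flow.2.1 _ _ hz) hcon (sub_nonneg.2 hrr)
  rw [h.flow.map_add hq, h.flow.map_add hz] at h1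
  convert h1 using 3 <;> ring

theorem isOpen_offsets (h : OrderedTrajectory Φ C ψ x) (hz : z ∈ omegaSet Φ x) :
    IsOpen (offsets C ψ q z) := by
  have : offsets C ψ q z = ⋃ r ∈ Ici (0 : ℝ), {s | ψ (-r) q - ψ (s - r) z ∉ C} := by
    ext s
    simp [offsets]
  rw [this]
  refine isOpen_biUnion fun r _ => (h.cone.1.isOpen_compl).preimage (f := fun s =>
    ψ (-r) q - ψ (s - r) z) ?_
  exact continuous_const.sub ((h.flow.continuous_time hz).comp (by fun_prop))

theorem notMem_interior_of_offset (h : OrderedTrajectory Φ C ψ x) (hq : q ∈ omegaSet Φ x)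
    (hz : z ∈ omegaSet Φ x) {r : ℕ → ℝ} (hr : Tendsto r seqFilter atTop)
    (hq' : q' ∈ omegaSet Φ x) (hz' : z' ∈ omegaSet Φ x)
    (hrq : Tendsto (fun n => ψ (-r n) q) seqFilter (nhds q'))
    (hrz : Tendsto (fun n => ψ (-r n) z) seqFilter (nhds z'))
    {s : ℝ} (hs : s ∈ offsets C ψ q z) (u : ℝ) : ψ u q' - ψ (s + u) z' ∉ interior C := by
  obtain ⟨r₀, -, hr₀⟩ := hs
  intro hcon
  have h1 := (h.flow.tendsto_shift hq hq' hrq u).sub (h.flow.tendsto_shift hz hz' hrz (s + u))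
  obtain ⟨n, hn, hn0⟩ := ((h1.eventually (isOpen_interior.mem_nhds hcon)).and
    (hr.eventually_ge_atTop (u + r₀))).exists
  refine h.notMem_of_le hq hz hr₀ (r' := r n - u) (by linarith) ?_
  convert interior_subset hn using 3 <;> ring

theorem backward_limit_mem_equilibria (h : OrderedTrajectory Φ C ψ x) (hq : q ∈ omegaSet Φ x)
    (hz : z ∈ omegaSet Φ x) (hqz : q - z ∉ C) {r : ℕ → ℝ} (hr : Tendsto r seqFilter atTop)
    (hz' : z' ∈ omegaSet Φ x)
    (hrz : Tendsto (fun n => ψ (-r n) z) seqFilter (nhds z')) : z' ∈ equilibria Φ := by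
  by_contra hE
  obtain ⟨q', hq', hrq⟩ := h.pre.isCompact_omegaSet.exists_seqFilter_lim
    (a := fun n => ψ (-r n) q) (Eventually.of_forall fun n => h.flow.2.1 _ _ hq)
  have hnot : ∀ s ∈ offsets C ψ q z, ∀ u, ψ u q' - ψ (s + u) z' ∉ interior C := fun s hs =>
    h.notMem_interior_of_offset hq hz hr hq' hz' hrq hrz hs
  have h0 : (0 : ℝ) ∈ offsets C ψ q z :=
    ⟨0, le_rfl, by rwa [sub_zero, neg_zero, h.flow.map_zero hq, h.flow.map_zero hz]⟩
  have hop := h.isOpen_offsets (q := q) hz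
  have hcz := h.flow.continuous_time hz'
  by_cases hall : offsets C ψ q z = univ
  · have hnot' : ∀ u s, ψ u q' - ψ s z' ∉ interior C := fun u s => by
      have := hnot (s - u) (hall ▸ mem_univ _) u
      rwa [sub_add_cancel] at this
    obtain ⟨s₁, hs₁⟩ : ∃ s, ψ s z' ≠ z' := by
      by_contra! hcon
      exact hE ((h.flow.mem_equilibria_iff hz').2 hcon)
    obtain ⟨ε, hε, hb⟩ := Metric.isOpen_iff.1 ((isOpen_ne (x := z')).preimage hcz) s₁ hs₁
    have hJ : ∀ s ∈ Icc s₁ (s₁ + ε / 2), ψ s z' ≠ z' := fun s hs => hb <| by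
      rw [mem_ball, Real.dist_eq, abs_lt]
      constructor <;> linarith [hs.1, hs.2]
    obtain ⟨t, ht, hord⟩ := exists_forward_ordered hz'
      ((isCompact_Icc (a := s₁) (b := s₁ + ε / 2)).image hcz) (by
        rintro _ ⟨s, hs, rfl⟩
        have := h.ordered_lt hz' (s := 0) (u := s) (by
          rw [h.flow.map_zero hz']
          exact (hJ s hs).symm)
        rwa [h.flow.map_zero hz'] at this)
    obtain ⟨τ, -, hτ, hτq⟩ := exists_tendsto_of_mem_omegaSet hq'
    obtain ⟨p', hp', hτp⟩ := h.pre.isCompact_omegaSet.exists_seqFilter_lim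
      (a := fun n => ψ (τ n - t) z') (Eventually.of_forall fun n => h.flow.2.1 _ _ hz')
    have hqp : ∀ s ∈ Icc s₁ (s₁ + ε / 2), ψ s p' = q' := by
      intro s hs
      have h1 : q' - ψ s p' ∈ C := by
        refine h.cone.1.mem_of_tendsto (hτq.sub (h.flow.tendsto_shift hz' hp' hτp s)) ?_
        filter_upwards [hτ.eventually_ge_atTop t] with n hn
        have h2 := h.mono.1 (τ n - t) (by linarith) _ _ (hord _ ⟨s, hs, rfl⟩)
        rw [← Φ.map_add _ _ (by linarith) ht, sub_add_cancel,
          ← h.flow.1 _ (by linarith) _ (h.flow.2.1 _ _ hz'), h.flow.map_add hz'] at h2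
        rwa [add_comm]
      by_contra hne
      have h2 := h.sub_mem_interior hq' (h.flow.2.1 _ _ hp') h1 (Ne.symm hne) one_pos
      rw [h.flow.map_add hp'] at h2
      have h3 := (tendsto_const_nhds (x := ψ 1 q')).sub (h.flow.tendsto_shift hz' hp' hτp (1 + s))
      obtain ⟨n, hn⟩ := (h3.eventually (isOpen_interior.mem_nhds h2)).exists
      exact hnot' _ _ hn
    have hp'E := h.flow.mem_equilibria_of_const_on hp' (by linarith) hqp
    have hpq : p' = q' := by
      rw [← hqp s₁ ⟨le_rfl, by linarith⟩, h.flow.apply_of_mem_equilibria hp' hp'E]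
    have h1 : z' - p' ∈ C := h.cone.1.mem_of_tendsto (tendsto_const_nhds.sub hτp)
      (Eventually.of_forall fun n => h.ordered z' hz' _)
    have h2 := h.sub_mem_interior hp' hz' (h.cone.sub_comm_mem h1)
      (fun he => hE (he ▸ hp'E)) one_pos
    rw [hpq] at h2
    exact hnot' _ _ h2
  · obtain ⟨s₀, hs₀c, hs₀⟩ : ∃ s₀ ∈ closure (offsets C ψ q z), s₀ ∉ offsets C ψ q z := by
      by_contra! hcon
      exact hall (univ_subset_iff.1 (isPreconnected_univ.subset_of_closure_inter_subset hop
        ⟨0, trivial, h0⟩ fun s hs => hcon s hs.1))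
    have hord : ∀ r, 0 ≤ r → ψ (-r) q - ψ (s₀ - r) z ∈ C := by
      by_contra! hcon
      exact hs₀ hcon
    have h1 : q' - ψ s₀ z' ∈ C := by
      refine h.cone.1.mem_of_tendsto (hrq.sub (h.flow.tendsto_shift hz hz' hrz s₀)) ?_
      filter_upwards [hr.eventually_ge_atTop 0] with n hn
      exact hord _ hn
    have h2 : ψ 1 q' - ψ (s₀ + 1) z' ∉ interior C := by
      have hcl : IsClosed {s | ψ 1 q' - ψ (s + 1) z' ∉ interior C} :=
        isOpen_interior.isClosed_compl.preimage (f := fun s => ψ 1 q' - ψ (s + 1) z')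
          (continuous_const.sub (hcz.comp (by fun_prop)))
      exact closure_minimal (fun s hs => hnot s hs 1) hcl hs₀c
    have h3 : q' = ψ s₀ z' := by
      by_contra hne
      refine h2 ?_
      have := h.sub_mem_interior hq' (h.flow.2.1 _ _ hz') h1 hne one_pos
      rwa [h.flow.map_add hz', add_comm 1 s₀] at this
    obtain ⟨ε, hε, hb⟩ := Metric.isOpen_iff.1 hop 0 h0
    refine hE (h.flow.mem_equilibria_of_const_on hz' (a := 0) (b := ε / 2) (c := ψ s₀ z')
      (by linarith) fun s hs => ?_)
    by_contra hne
    have hs' : s ∈ offsets C ψ q z := hb <| by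
      rw [mem_ball, Real.dist_eq, abs_lt]
      constructor <;> linarith [hs.1, hs.2]
    have h4 := hnot s hs' 0
    rw [add_zero, h.flow.map_zero hq', h3] at h4
    exact h4 (h.ordered_lt hz' (Ne.symm hne))

end OrderedTrajectory

end Alpha

section AlphaDomination

variable {X : Type*} [NormedAddCommGroup X] [NormedSpace ℝ X] {C : Set X} {Φ : Semiflow X}
  {DΦ : ℝ → X → X →L[ℝ] X} {ψ : ℝ → X → X} {x : X}

namespace OrderedTrajectory

variable {p q z z' q' e : X}

theorem alphaSet_subset (h : OrderedTrajectory Φ C ψ x) (hz : z ∈ omegaSet Φ x) :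
    alphaSet ψ z ⊆ omegaSet Φ x := fun e he => by
  obtain ⟨r, -, -, hrz⟩ := exists_tendsto_of_mem_alphaSet he
  exact h.pre.isCompact_omegaSet.isClosed.mem_of_tendsto hrz
    (Eventually.of_forall fun n => h.flow.2.1 _ _ hz)

theorem isCompact_alphaSet (h : OrderedTrajectory Φ C ψ x) (hz : z ∈ omegaSet Φ x) :
    IsCompact (alphaSet ψ z) :=
  h.pre.isCompact_omegaSet.of_isClosed_subset (isClosed_biInter fun _ _ => isClosed_closure)
    (h.alphaSet_subset hz)

theorem exists_backward_lim (h : OrderedTrajectory Φ C ψ x) (hz : z ∈ omegaSet Φ x) {r : ℕ → ℝ}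
    (hr : Tendsto r seqFilter atTop) :
    ∃ e ∈ alphaSet ψ z, Tendsto (fun n => ψ (-r n) z) seqFilter (nhds e) := by
  obtain ⟨e, -, he⟩ := h.pre.isCompact_omegaSet.exists_seqFilter_lim
    (a := fun n => ψ (-r n) z) (Eventually.of_forall fun n => h.flow.2.1 _ _ hz)
  exact ⟨e, mem_alphaSet_of_tendsto hr he, he⟩

theorem nonempty_alphaSet (h : OrderedTrajectory Φ C ψ x) (hz : z ∈ omegaSet Φ x) :
    (alphaSet ψ z).Nonempty := by
  obtain ⟨e, he, -⟩ := h.exists_backward_lim hz (r := fun n => n)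
    (tendsto_seqFilter_atTop_of_le fun n => le_rfl)
  exact ⟨e, he⟩

theorem alphaSet_subset_equilibria (h : OrderedTrajectory Φ C ψ x) (hq : q ∈ omegaSet Φ x)
    (hz : z ∈ omegaSet Φ x) (hqz : q - z ∉ C) : alphaSet ψ z ⊆ equilibria Φ := fun e he => by
  obtain ⟨r, -, hr, hrz⟩ := exists_tendsto_of_mem_alphaSet he
  exact h.backward_limit_mem_equilibria hq hz hqz hr (h.alphaSet_subset hz he) hrz

theorem sub_mem_of_alpha (h : OrderedTrajectory Φ C ψ x) (hq : q ∈ omegaSet Φ x)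
    (hz : z ∈ omegaSet Φ x) (hzE : z ∉ equilibria Φ) (he : e ∈ alphaSet ψ z)
    (heE : e ∈ equilibria Φ) : q - e ∈ C := by
  have heK := h.alphaSet_subset hz he
  obtain ⟨r, -, -, hrz⟩ := exists_tendsto_of_mem_alphaSet he
  have h1 : z - e ∈ C := h.cone.1.mem_of_tendsto (tendsto_const_nhds.sub hrz)
    (Eventually.of_forall fun n => h.ordered z hz _)
  have h2 := h.sub_mem_interior hz heK h1 (fun hz' => hzE (hz' ▸ heE)) one_pos
  rw [h.flow.apply_of_mem_equilibria heK heE] at h2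
  obtain ⟨t, ht, hord⟩ := exists_forward_ordered (C := C) (h.flow.2.1 1 z hz)
    (isCompact_singleton (x := e)) (by rintro _ rfl; exact h2)
  exact h.sub_mem_of_forward heE ht (hord e rfl) hq

/-- In the far past two unordered orbits stay close to nearest points of the alpha limit set. -/
theorem eventually_near_alpha (h : OrderedTrajectory Φ C ψ x) (hq : q ∈ omegaSet Φ x)
    (hz : z ∈ omegaSet Φ x) (hzE : z ∉ equilibria Φ) (hqz : q - z ∉ C) {ρ : ℝ} (hρ : 0 < ρ)
    (L : ℝ) : ∃ R, 0 ≤ R ∧ ∀ r, R ≤ r → ∀ e ∈ alphaSet ψ z,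
      infDist (ψ (-r) z) (alphaSet ψ z) = dist (ψ (-r) z) e → ∀ σ ∈ Icc 0 L,
        dist (ψ (-(r + σ)) z) e < ρ ∧ dist (ψ (-(r + σ)) q) e < ρ := by
  by_contra! hcon
  choose! r hr e he hre σ hσ hd using fun n : ℕ => hcon n n.cast_nonneg
  have hrt := tendsto_seqFilter_atTop_of_le hr
  obtain ⟨z', hz', hrz⟩ := h.exists_backward_lim hz hrt
  have hz'K := h.alphaSet_subset hz hz'
  have hz'E := h.alphaSet_subset_equilibria hq hz hqz hz'
  obtain ⟨q', hq', hrq⟩ := h.pre.isCompact_omegaSet.exists_seqFilter_lim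
    (a := fun n => ψ (-r n) q) (Eventually.of_forall fun n => h.flow.2.1 _ _ hq)
  have hqz' : q' = z' := by
    by_contra hne
    have h1 := h.sub_mem_interior hq' hz'K (h.sub_mem_of_alpha hq' hz hzE hz' hz'E) hne one_pos
    refine h.notMem_interior_of_offset hq hz hrt hq' hz'K hrq hrz (s := 0) ?_ 1 ?_
    · exact ⟨0, le_rfl, by rwa [sub_zero, neg_zero, h.flow.map_zero hq, h.flow.map_zero hz]⟩
    · rwa [zero_add]
  rw [hqz'] at hrq
  obtain ⟨σ', hσ', hσlim⟩ := isCompact_Icc.exists_seqFilter_lim (a := σ)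
    (Eventually.of_forall hσ)
  have hshift : ∀ p ∈ omegaSet Φ x, Tendsto (fun n => ψ (-r n) p) seqFilter (nhds z') →
      Tendsto (fun n => ψ (-(r n + σ n)) p) seqFilter (nhds z') := fun p hp hlim => by
    have h1 := h.flow.tendsto_apply hσlim.neg hlim
      (Eventually.of_forall fun n => h.flow.2.1 _ _ hp) hz'K
    rw [h.flow.apply_of_mem_equilibria hz'K hz'E] at h1
    refine h1.congr fun n => ?_
    rw [h.flow.map_add hp]
    congr 1
    ring
  have helim : Tendsto e seqFilter (nhds z') := by
    have h1 :
        Tendsto (fun n => dist (ψ (-r n) z) z' + dist (ψ (-r n) z) z') seqFilter (nhds 0) := by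
      simpa using (tendsto_iff_dist_tendsto_zero.1 hrz).add (tendsto_iff_dist_tendsto_zero.1 hrz)
    refine tendsto_iff_dist_tendsto_zero.2 (squeeze_zero (fun _ => dist_nonneg) (fun n => ?_) h1)
    refine (dist_triangle_left _ _ (ψ (-r n) z)).trans (add_le_add_left ?_ _)
    rw [← hre]
    exact infDist_le_dist_of_mem hz'
  have hd1 := (hshift z hz hrz).dist helim
  have hd2 := (hshift q hq hrq).dist helim
  rw [dist_self] at hd1 hd2
  obtain ⟨n, hn1, hn2⟩ := ((hd1.eventually_lt_const hρ).and (hd2.eventually_lt_const hρ)).exists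
  exact absurd hn2 (not_lt.2 (hd n hn1))

/-- Every nonequilibrium of the limit set is ordered with the whole limit set. -/
theorem sub_mem_of_notMem_equilibria [CompleteSpace X] (h : OrderedTrajectory Φ C ψ x)
    (hΦ : StronglyFocusingMonotone Φ DΦ C) (hz : z ∈ omegaSet Φ x) (hzE : z ∉ equilibria Φ)
    (hq : q ∈ omegaSet Φ x) : q - z ∈ C := by
  by_contra hqz
  by_cases hCu : C = univ
  · exact hqz (hCu ▸ mem_univ q)
  obtain ⟨T, hT, κ, hκ, ρ, hρ, γ, hγ, M, hM, hdeep, hdom⟩ := exists_domination h.cone hCu hΦ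
    h.pre.isCompact_omegaSet h.pre.invariant_omegaSet
  obtain ⟨N, hN⟩ := pow_unbounded_of_one_lt (2 * M) (show 1 < 1 + γ by linarith)
  obtain ⟨R, hR0, hR⟩ := h.eventually_near_alpha hq hz hzE hqz hρ ((N + 1) * T)
  have hA := h.isCompact_alphaSet hz
  have hAK := h.alphaSet_subset hz
  have hAE := h.alphaSet_subset_equilibria hq hz hqz
  have hAne := h.nonempty_alphaSet hz
  set d : ℝ → X := fun r => ψ (-r) q - ψ (-r) z with hd
  set D : ℝ → ℝ := fun r => infDist (ψ (-r) z) (alphaSet ψ z) with hDdef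
  have hdC : ∀ r, 0 ≤ r → d r ∉ C := fun r hr => by
    have := h.notMem_of_le hq hz (s := 0) (r := 0) (by
      rwa [sub_zero, neg_zero, h.flow.map_zero hq, h.flow.map_zero hz]) hr
    rwa [zero_sub] at this
  have hD0 : ∀ r, 0 < D r := fun r => by
    refine (hA.isClosed.notMem_iff_infDist_pos hAne).1 fun hmem => hzE ?_
    exact (h.flow.apply_mem_equilibria_iff hz _).1 (hAE hmem)
  have hstep : ∀ p ∈ omegaSet Φ x, ∀ r, Φ.toFun T (ψ (-(r + T)) p) = ψ (-r) p := fun p hp r => by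
    rw [← h.flow.1 T hT.le _ (h.flow.2.1 _ _ hp), h.flow.map_add hp]
    congr 1
    ring
  have hnear : ∀ r, R ≤ r → ∃ e ∈ alphaSet ψ z, D r = dist (ψ (-r) z) e ∧ ∀ n : ℕ, n ≤ N + 1 →
      ψ (-(r + n * T)) z ∈ closedBall e ρ ∧ ψ (-(r + n * T)) q ∈ closedBall e ρ := fun r hr => by
    obtain ⟨e, he, hde⟩ := hA.exists_infDist_eq_dist hAne (ψ (-r) z)
    refine ⟨e, he, hde, fun n hn => ?_⟩
    have h1 := hR r hr e he hde (n * T) ⟨by positivity, by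
      have : (n : ℝ) ≤ N + 1 := by exact_mod_cast hn
      gcongr⟩
    exact ⟨h1.1.le, h1.2.le⟩
  have hdp : ∀ p ∈ omegaSet Φ x, ∀ e ∈ alphaSet ψ z, ∀ r, ψ (-(r + T)) p ∈ closedBall e ρ →
      ψ (-r) p - e ∈ deepCone C κ := fun p hp e he r hmem => by
    have h1 := hdeep e (hAK he) _ hmem e (mem_closedBall_self hρ.le)
      (h.sub_mem_of_alpha (h.flow.2.1 _ _ hp) hz hzE he (hAE he))
    rwa [hstep p hp, hAE he T hT.le] at h1
  have hbd : ∀ r, R ≤ r → ‖d r‖ ≤ (1 + 1 / κ) * D r := fun r hr => by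
    obtain ⟨e, he, hde, hn⟩ := hnear r hr
    have h1 := hdp q hq e he r (by simpa using (hn 1 (by omega)).2)
    have h2 := norm_le_of_mem_deepCone_add h.cone.2.1 h1 (hdC r (hR0.trans hr))
      (neg_ne_zero.2 one_ne_zero)
    have h3 : ψ (-r) q - e + (-1 : ℝ) • d r = ψ (-r) z - e := by
      simp only [hd]
      module
    rw [h3, ← dist_eq_norm (ψ (-r) z), ← hde] at h2
    have h4 : ‖ψ (-r) q - e‖ ≤ D r / κ := by
      rw [le_div_iff₀ hκ]
      linarith
    calc ‖d r‖ = ‖(ψ (-r) q - e) - (ψ (-r) z - e)‖ := by simp [hd]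
      _ ≤ ‖ψ (-r) q - e‖ + ‖ψ (-r) z - e‖ := norm_sub_le _ _
      _ ≤ D r / κ + D r := by
        refine add_le_add h4 ?_
        rw [← dist_eq_norm, ← hde]
      _ = _ := by ring
  have hhalf : ∀ r, R ≤ r → 2 * (‖d r‖ * D (r + N * T)) ≤ ‖d (r + N * T)‖ * D r := fun r hr => by
    obtain ⟨e, he, hde, hn⟩ := hnear r hr
    have hcast : ∀ n < N, ((N - n : ℕ) : ℝ) = (N - (n + 1) : ℕ) + 1 := fun n hn => by
      rw [← Nat.cast_add_one]
      congr 1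
      omega
    have hit : ∀ p ∈ omegaSet Φ x, ∀ n < N, ψ (-(r + (N - (n + 1) : ℕ) * T)) p
        = Φ.toFun T (ψ (-(r + (N - n : ℕ) * T)) p) := fun p hp n hn => by
      rw [hcast n hn, ← hstep p hp]
      congr 2
      ring
    have h1 := hdom N (fun n => ψ (-(r + (N - n : ℕ) * T)) z)
      (fun n => ψ (-(r + (N - n : ℕ) * T)) q)
      (fun _ => e) (hit z hz) (hit q hq) (fun n _ => (hAE he T hT.le).symm)
      (fun n _ => ⟨e, hAK he, (hn _ (by omega)).1, (hn _ (by omega)).2, mem_closedBall_self hρ.le⟩)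
      (fun n _ hmem => absurd hmem (hdC _ (by
        have := hR0.trans hr
        positivity))) (by
        have h2 := hdp z hz e he (r + N * T) (by
          have := (hn (N + 1) le_rfl).1
          push_cast at this
          convert this using 3
          ring)
        have h3 := smul_mem_deepCone h.cone.2.1 h2 (-1)
        simpa using h3)
    simp only [Nat.sub_zero, Nat.sub_self, Nat.cast_zero, zero_mul, add_zero] at h1
    rw [← dist_eq_norm e, dist_comm e, ← dist_eq_norm e, dist_comm e (ψ (-r) z), ← hde] at h1
    have h2 : D (r + N * T) ≤ dist (ψ (-(r + N * T)) z) e := infDist_le_dist_of_mem he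
    have h3 : 2 * M * (D (r + N * T) * ‖d r‖) ≤ M * (‖d (r + N * T)‖ * D r) := by
      refine le_trans ?_ h1
      have := (hD0 (r + N * T)).le
      gcongr
    have h4 : M * (2 * (‖d r‖ * D (r + N * T))) ≤ M * (‖d (r + N * T)‖ * D r) := by
      linarith
    exact le_of_mul_le_mul_left h4 hM
  have hiter : ∀ n : ℕ, ∀ r, R ≤ r → 2 ^ n * ‖d r‖ ≤ (1 + 1 / κ) * D r := by
    intro n
    induction n with
    | zero => intro r hr; simpa using hbd r hr
    | succ n ih =>
      intro r hr
      have hr' : R ≤ r + N * T := by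
        have : 0 ≤ N * T := by positivity
        linarith
      have h1 := ih _ hr'
      have h2 := hhalf r hr
      refine le_of_mul_le_mul_right ?_ (hD0 (r + N * T))
      calc 2 ^ (n + 1) * ‖d r‖ * D (r + N * T) = 2 ^ n * (2 * (‖d r‖ * D (r + N * T))) := by ring
        _ ≤ 2 ^ n * (‖d (r + N * T)‖ * D r) := by gcongr
        _ = 2 ^ n * ‖d (r + N * T)‖ * D r := by ring
        _ ≤ (1 + 1 / κ) * D (r + N * T) * D r := by
          have := (hD0 r).le
          gcongr
        _ = _ := by ring
  have hpos : 0 < ‖d R‖ := norm_pos_iff.2 fun h0 => hdC R hR0 (h0 ▸ h.cone.zero_mem)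
  obtain ⟨n, hn⟩ := pow_unbounded_of_one_lt ((1 + 1 / κ) * D R / ‖d R‖) one_lt_two
  rw [div_lt_iff₀ hpos] at hn
  exact absurd (hiter n R le_rfl) (not_le.2 hn)

end OrderedTrajectory

end AlphaDomination

section Separation

variable {X : Type*} [NormedAddCommGroup X] [NormedSpace ℝ X] {C : Set X} {Φ : Semiflow X}
  {DΦ : ℝ → X → X →L[ℝ] X} {ψ : ℝ → X → X} {x : X}

theorem posOrbit_eq_image_of_periodic {p : X} {T : ℝ} (hT : 0 < T) (hp : Φ.toFun T p = p) :
    posOrbit Φ p = (fun t => Φ.toFun t p) '' Icc 0 T := by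
  refine Subset.antisymm ?_ (by rintro _ ⟨t, ht, rfl⟩; exact ⟨t, ht.1, rfl⟩)
  rintro _ ⟨t, ht, rfl⟩
  have hn : ∀ n : ℕ, Φ.toFun (n * T) p = p := fun n => by
    induction n with
    | zero => simp [Φ.map_zero]
    | succ n ih =>
      rw [Nat.cast_succ, add_mul, one_mul, Φ.map_add _ _ (by positivity) hT.le, hp, ih]
  have h0 : 0 ≤ t / T := by positivity
  have h1 := Nat.floor_le h0
  have h2 := Nat.lt_floor_add_one (t / T)
  rw [le_div_iff₀ hT] at h1
  rw [div_lt_iff₀ hT] at h2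
  refine ⟨t - ⌊t / T⌋₊ * T, ⟨by linarith, by linarith⟩, ?_⟩
  simp only
  conv_lhs => rw [← hn ⌊t / T⌋₊]
  rw [← Φ.map_add _ _ (by linarith) (by positivity), sub_add_cancel]

theorem isCompact_posOrbit_of_periodic {p : X} {T : ℝ} (hT : 0 < T) (hp : Φ.toFun T p = p) :
    IsCompact (posOrbit Φ p) := by
  rw [posOrbit_eq_image_of_periodic hT hp]
  exact isCompact_Icc.image_of_continuousOn
    ((Φ.continuousOn_time p).mono Icc_subset_Ici_self)

theorem omegaSet_eq_posOrbit_of_periodic {p : X} {T : ℝ} (hT : 0 < T) (hp : Φ.toFun T p = p) :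
    omegaSet Φ p = posOrbit Φ p := by
  refine Subset.antisymm (fun q hq => ?_) ?_
  · obtain ⟨t, ht, -, htq⟩ := exists_tendsto_of_mem_omegaSet hq
    exact (isCompact_posOrbit_of_periodic hT hp).isClosed.mem_of_tendsto htq
      (Eventually.of_forall fun n => ⟨t n, n.cast_nonneg.trans (ht n), rfl⟩)
  · rintro _ ⟨t, ht, rfl⟩
    have hn : ∀ n : ℕ, Φ.toFun (n * T) p = p := fun n => by
      induction n with
      | zero => simp [Φ.map_zero]
      | succ n ih =>
        rw [Nat.cast_succ, add_mul, one_mul, Φ.map_add _ _ (by positivity) hT.le, hp, ih]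
    refine mem_omegaSet_of_tendsto (t := fun n => t + n * T) ?_ ?_
    · refine tendsto_atTop_add_const_left _ t (Tendsto.atTop_mul_const hT ?_)
      exact tendsto_seqFilter_atTop_of_le fun n => le_rfl
    · refine tendsto_const_nhds.congr fun n => ?_
      rw [Φ.map_add _ _ ht (by positivity), hn]

theorem posOrbit_eq_singleton_iff {p : X} : posOrbit Φ p = {p} ↔ p ∈ equilibria Φ := by
  constructor
  · intro h t ht
    have : Φ.toFun t p ∈ posOrbit Φ p := ⟨t, ht, rfl⟩
    rw [h] at this
    exact this
  · intro h
    ext q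
    constructor
    · rintro ⟨t, ht, rfl⟩
      exact h t ht
    · rintro rfl
      exact ⟨0, le_rfl, (Φ.map_zero _).symm⟩

theorem omegaSet_apply {t : ℝ} (ht : 0 ≤ t) : omegaSet Φ (Φ.toFun t x) = omegaSet Φ x := by
  refine Subset.antisymm (fun p hp => ?_) (fun p hp => ?_) <;>
    obtain ⟨r, hr0, hr, hrp⟩ := exists_tendsto_of_mem_omegaSet hp
  · refine mem_omegaSet_of_tendsto (tendsto_atTop_add_const_right _ t hr) (hrp.congr fun n => ?_)
    rw [Φ.map_add _ _ (n.cast_nonneg.trans (hr0 n)) ht]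
  · refine mem_omegaSet_of_tendsto (tendsto_atTop_add_const_right _ (-t) hr) (hrp.congr' ?_)
    filter_upwards [hr.eventually_ge_atTop t] with n hn
    rw [← Φ.map_add _ _ (by linarith) ht, neg_add_cancel_right]

namespace OrderedTrajectory

variable {z : X}

theorem near_of_notMem (h : OrderedTrajectory Φ C ψ x) (hz : z ∈ omegaSet Φ x)
    (hzC : ∀ q ∈ omegaSet Φ x, ∀ s, q - ψ s z ∈ C) {ρ : ℝ} (hρ : 0 < ρ) :
    ∃ T, 0 ≤ T ∧ ∀ t r, Φ.toFun t x - ψ r z ∉ C → ∀ R, 0 ≤ R → T ≤ t - R →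
      dist (Φ.toFun (t - R) x) (ψ (r - R) z) < ρ := by
  by_contra! hcon
  choose! t r hbad R hR ht hd using fun n : ℕ => hcon n n.cast_nonneg
  have htt := tendsto_seqFilter_atTop_of_le ht
  obtain ⟨k, hk, hxk⟩ := h.pre.exists_lim htt
  obtain ⟨y, hy, hzy⟩ := h.pre.isCompact_omegaSet.exists_seqFilter_lim
    (a := fun n => ψ (r n - R n) z) (Eventually.of_forall fun n => h.flow.2.1 _ _ hz)
  have hne : k ≠ y := by
    rintro rfl
    have h1 := hxk.dist hzy
    rw [dist_self] at h1
    obtain ⟨n, hn⟩ := (h1.eventually_lt_const hρ).exists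
    exact absurd hn (not_lt.2 (hd n))
  have h1 : ψ (-1) k - ψ (-1) y ∈ C := h.cone.1.mem_of_tendsto
    (tendsto_const_nhds.sub (h.flow.tendsto_shift hz hy hzy (-1)))
    (Eventually.of_forall fun n => hzC _ (h.flow.2.1 _ _ hk) _)
  have h2 := h.sub_mem_interior' hk hy one_pos h1 hne
  obtain ⟨n, hn⟩ := ((hxk.sub hzy).eventually (isOpen_interior.mem_nhds h2)).exists
  have h3 := h.mono.1 _ (hR n) _ _ (interior_subset hn)
  refine hbad n ?_
  rwa [← Φ.map_add _ _ (hR n) (n.cast_nonneg.trans (ht n)), add_sub_cancel,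
    ← h.flow.1 _ (hR n) _ (h.flow.2.1 _ _ hz), h.flow.map_add hz, add_sub_cancel] at h3

theorem eventually_ordered_or_asymptotic (h : OrderedTrajectory Φ C ψ x) (hz : z ∈ omegaSet Φ x)
    (hzC : ∀ q ∈ omegaSet Φ x, ∀ s, q - ψ s z ∈ C) (a b : ℝ) :
    (∃ t₀, 0 ≤ t₀ ∧ ∀ t, t₀ ≤ t → ∀ r ∈ Icc a b, Φ.toFun t x - ψ r z ∈ C) ∨
    ∃ k ∈ omegaSet Φ x, Tendsto (fun t => dist (Φ.toFun t x) (ψ t k)) atTop (nhds 0) := by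
  by_cases hor : ∃ t₀, 0 ≤ t₀ ∧ ∀ t, t₀ ≤ t → ∀ r ∈ Icc a b, Φ.toFun t x - ψ r z ∈ C
  · exact Or.inl hor
  right
  push Not at hor
  choose! t ht r hr hbad using fun n : ℕ => hor n n.cast_nonneg
  obtain ⟨k, hk, hzk⟩ := h.pre.isCompact_omegaSet.exists_seqFilter_lim
    (a := fun n => ψ (r n - t n) z) (Eventually.of_forall fun n => h.flow.2.1 _ _ hz)
  refine ⟨k, hk, Metric.tendsto_atTop.2 fun ε hε => ?_⟩
  obtain ⟨T, hT0, hT⟩ := h.near_of_notMem hz hzC (half_pos hε)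
  refine ⟨T, fun u hu => ?_⟩
  rw [Real.dist_0_eq_abs, abs_of_nonneg dist_nonneg]
  refine lt_of_le_of_lt ?_ (half_lt_self hε)
  refine le_of_tendsto (tendsto_const_nhds.dist (h.flow.tendsto_shift hz hk hzk u)) ?_
  filter_upwards [(tendsto_seqFilter_atTop_of_le ht).eventually_ge_atTop u] with n hn
  have h1 := hT _ _ (hbad n) (t n - u) (by linarith) (by linarith)
  rw [sub_sub_cancel] at h1
  convert h1.le using 3
  ring

end OrderedTrajectory

/-- A trajectory which is eventually ordered with, and distinct from, every compact piece of a
nonequilibrium orbit of its limit set. -/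
structure SeparatedTrajectory (Φ : Semiflow X) (C : Set X) (ψ : ℝ → X → X) (x : X) : Prop where
  pre : PrecompactOrbit Φ x
  flow : IsFlowExtensionOn Φ ψ (omegaSet Φ x)
  ordered : ∀ z ∈ omegaSet Φ x, z ∉ equilibria Φ → ∀ q ∈ omegaSet Φ x, q - z ∈ C
  separated : ∀ z ∈ omegaSet Φ x, z ∉ equilibria Φ → ∀ a b : ℝ, ∃ t₀, 0 ≤ t₀ ∧ ∀ t, t₀ ≤ t →
    ∀ r ∈ Icc a b, Φ.toFun t x - ψ r z ∈ C ∧ Φ.toFun t x ≠ ψ r z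

theorem OrderedTrajectory.exists_separatedTrajectory [CompleteSpace X]
    (h : OrderedTrajectory Φ C ψ x) (hΦ : StronglyFocusingMonotone Φ DΦ C) :
    omegaSet Φ x ⊆ equilibria Φ ∨
    (∃ z ∈ omegaSet Φ x, ∃ T : ℝ, 0 < T ∧ Φ.toFun T z = z ∧ posOrbit Φ z ≠ {z} ∧
      omegaSet Φ x = posOrbit Φ z) ∨
    ∃ y, omegaSet Φ y = omegaSet Φ x ∧ SeparatedTrajectory Φ C ψ y := by
  have hord : ∀ z ∈ omegaSet Φ x, z ∉ equilibria Φ → ∀ q ∈ omegaSet Φ x, q - z ∈ C :=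
    fun z hz hzE q hq => h.sub_mem_of_notMem_equilibria hΦ hz hzE hq
  by_cases has : ∃ k ∈ omegaSet Φ x,
      Tendsto (fun t => dist (Φ.toFun t x) (ψ t k)) atTop (nhds 0)
  · obtain ⟨k, hk, hxk⟩ := has
    have hsub : PrecompactOrbit Φ k := ⟨_, h.pre.isCompact_omegaSet, fun t ht => by
      rw [← h.flow.1 t ht k hk]
      exact h.flow.2.1 _ _ hk⟩
    have hom : omegaSet Φ k = omegaSet Φ x := by
      refine Subset.antisymm (fun p hp => ?_) fun p hp => ?_
      · obtain ⟨t, ht0, -, htp⟩ := exists_tendsto_of_mem_omegaSet hp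
        refine h.pre.isCompact_omegaSet.isClosed.mem_of_tendsto htp
          (Eventually.of_forall fun n => ?_)
        rw [← h.flow.1 _ (n.cast_nonneg.trans (ht0 n)) k hk]
        exact h.flow.2.1 _ _ hk
      · obtain ⟨t, ht0, ht, htp⟩ := exists_tendsto_of_mem_omegaSet hp
        refine mem_omegaSet_of_tendsto ht ?_
        have h1 := (tendsto_iff_of_dist (hxk.comp ht)).1 htp
        refine h1.congr fun n => ?_
        exact h.flow.1 _ (n.cast_nonneg.trans (ht0 n)) k hk
    by_cases hkE : k ∈ equilibria Φ
    · left
      rw [← hom, omegaSet_eq_posOrbit_of_periodic one_pos (hkE 1 zero_le_one),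
        posOrbit_eq_singleton_iff.2 hkE]
      rintro _ rfl
      exact hkE
    right
    by_cases hper : ∃ T : ℝ, T ≠ 0 ∧ ψ T k = k
    · left
      obtain ⟨T, hT, hTk⟩ := hper
      obtain ⟨τ, hτ, hτk⟩ := h.flow.exists_minimal_period hk hkE hT hTk
      have h1 : Φ.toFun τ k = k := by
        rw [← h.flow.1 τ hτ.le k hk]
        exact (hτk τ).2 ⟨1, by simp⟩
      exact ⟨k, hk, τ, hτ, h1, fun h2 => hkE (posOrbit_eq_singleton_iff.1 h2),
        by rw [← hom, omegaSet_eq_posOrbit_of_periodic hτ h1]⟩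
    · right
      push Not at hper
      refine ⟨k, hom, hsub, by rw [hom]; exact h.flow, by rwa [hom], ?_⟩
      rw [hom]
      intro z hz hzE a b
      have hC : ∀ t, 0 ≤ t → ∀ r, Φ.toFun t k - ψ r z ∈ C := fun t ht r =>
        hord _ (h.flow.2.1 _ _ hz) (fun hE => hzE ((h.flow.apply_mem_equilibria_iff hz r).1 hE)) _
          (by rw [← h.flow.1 t ht k hk]; exact h.flow.2.1 _ _ hk)
      by_cases hzk : ∃ s, z = ψ s k
      · obtain ⟨s, rfl⟩ := hzk
        refine ⟨max 0 (s + b + 1), le_max_left _ _, fun t ht r hr =>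
          ⟨hC t ((le_max_left _ _).trans ht) r, fun he => ?_⟩⟩
        have ht0 := (le_max_left _ _).trans ht
        have ht1 := (le_max_right _ _).trans ht
        rw [← h.flow.1 t ht0 k hk, h.flow.map_add hk] at he
        refine hper (t - (r + s)) (by have := hr.2; intro h0; linarith) ?_
        rw [sub_eq_neg_add, ← h.flow.map_add hk, he, h.flow.map_neg hk]
      · refine ⟨0, le_rfl, fun t ht r hr => ⟨hC t ht r, fun he => hzk ⟨-r + t, ?_⟩⟩⟩
        rw [← h.flow.map_add hk, h.flow.1 t ht k hk, he, h.flow.map_neg hz]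
  · right; right
    refine ⟨x, rfl, h.pre, h.flow, hord, fun z hz hzE a b => ?_⟩
    have hzC : ∀ q ∈ omegaSet Φ x, ∀ s, q - ψ s z ∈ C := fun q hq s =>
      hord _ (h.flow.2.1 _ _ hz) (fun hE => hzE ((h.flow.apply_mem_equilibria_iff hz s).1 hE)) q hq
    obtain ⟨t₀, ht₀, hC⟩ := (h.eventually_ordered_or_asymptotic hz hzC a b).resolve_right has
    refine ⟨t₀, ht₀, fun t ht r hr => ⟨hC t ht r hr, fun he => has ?_⟩⟩
    have hrz := h.flow.2.1 r z hz
    refine ⟨ψ (-t) (ψ r z), h.flow.2.1 _ _ hrz, tendsto_const_nhds.congr' ?_⟩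
    filter_upwards [eventually_ge_atTop t] with u hu
    have h1 : Φ.toFun u x = ψ (u - t) (ψ r z) := by
      rw [h.flow.1 _ (by linarith) _ hrz, ← he, ← Φ.map_add _ _ (by linarith) (ht₀.trans ht),
        sub_add_cancel]
    rw [h1, h.flow.map_add hrz, ← sub_eq_add_neg, dist_self]

end Separation

section WindowConstruction

/-- The same window with a smaller tolerance. -/
def Window.shrink (W : Window) (δ : ℝ) (hδ : 0 < δ) : Window := { W with δ := δ, hδ := hδ }

theorem Strand.shrink {W : Window} {p : ℝ → ℂ} (hp : Strand W p) {δ : ℝ} (hδ : 0 < δ)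
    (hle : δ ≤ W.δ) : Strand (W.shrink δ hδ) p where
  cont := hp.cont
  ltA := hp.ltA
  gtB := hp.gtB
  lo := hp.lo
  gtlo := hp.gtlo
  hi := hp.hi
  lthi := hp.lthi
  slo := (add_le_add_right hle _).trans hp.slo
  shi := hp.shi.trans (sub_le_sub_left hle _)

theorem Strand.congr {W : Window} {p p' : ℝ → ℂ} (hp : Strand W p)
    (h : ∀ u ∈ Icc W.α W.β, p' u = p u) : Strand W p' := by
  have w1 := W.hαa
  have w2 := W.hbβ
  have w3 := W.has
  have w4 := W.hsb
  refine ⟨hp.cont.congr h, fun t ht => ?_, fun t ht => ?_, ?_, fun t ht => ?_, ?_, fun t ht => ?_,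
    ?_, ?_⟩
  · rw [h t ⟨ht.1, by linarith [ht.2]⟩]; exact hp.ltA t ht
  · rw [h t ⟨by linarith [ht.1], ht.2⟩]; exact hp.gtB t ht
  · rw [h _ ⟨le_rfl, by linarith⟩]; exact hp.lo
  · rw [h t ⟨by linarith [ht.1], ht.2⟩]; exact hp.gtlo t ht
  · rw [h _ ⟨by linarith, le_rfl⟩]; exact hp.hi
  · rw [h t ⟨ht.1, by linarith [ht.2]⟩]; exact hp.lthi t ht
  · rw [h _ ⟨by linarith, by linarith⟩]; exact hp.slo
  · rw [h _ ⟨by linarith, by linarith⟩]; exact hp.shi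

/-- A last and a first exit time of a function increasing from `s₁` to `s₂`. -/
theorem exists_crossing {f : ℝ → ℝ} (hf : Continuous f) {s₁ s₂ : ℝ} (hs : s₁ < s₂)
    (hlt : f s₁ < f s₂) : ∃ α β, s₁ ≤ α ∧ α < β ∧ β ≤ s₂ ∧ f α ≤ f s₁ ∧ f s₂ ≤ f β ∧
      (∀ t ∈ Ioc α β, f s₁ < f t) ∧ ∀ t ∈ Ico α β, f t < f s₂ := by
  obtain ⟨α, hα⟩ := (isCompact_Icc.inter_right (isClosed_Iic.preimage hf)).exists_isGreatest
    (s := Icc s₁ s₂ ∩ f ⁻¹' Iic (f s₁)) ⟨s₁, ⟨le_rfl, hs.le⟩, mem_preimage.2 (mem_Iic.2 le_rfl)⟩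
  obtain ⟨⟨⟨hα1, hα2⟩, hα3⟩, hαg⟩ := hα
  obtain ⟨β, hβ⟩ := (isCompact_Icc.inter_right (isClosed_Ici.preimage hf)).exists_isLeast
    (s := Icc α s₂ ∩ f ⁻¹' Ici (f s₂)) ⟨s₂, ⟨hα2, le_rfl⟩, mem_preimage.2 (mem_Ici.2 le_rfl)⟩
  obtain ⟨⟨⟨hβ1, hβ2⟩, hβ3⟩, hβl⟩ := hβ
  rw [mem_preimage, mem_Iic] at hα3
  rw [mem_preimage, mem_Ici] at hβ3
  refine ⟨α, β, hα1, lt_of_le_of_ne hβ1 ?_, hβ2, hα3, hβ3, fun t ht => ?_, fun t ht => ?_⟩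
  · rintro rfl
    linarith
  · by_contra! hcon
    have := hαg ⟨⟨by linarith [ht.1], ht.2.trans hβ2⟩, hcon⟩
    linarith [ht.1]
  · by_contra! hcon
    have := hβl ⟨⟨ht.1, ht.2.le.trans hβ2⟩, hcon⟩
    linarith [ht.2]

/-- Every curve moving to the right is a stable strand of some window. -/
theorem exists_window_of_lt {Y : ℝ → ℂ} (hY : Continuous Y) {s₁ s₂ : ℝ} (hs : s₁ < s₂)
    (hlt : (Y s₁).re < (Y s₂).re) : ∃ W : Window, s₁ ≤ W.α ∧ W.β ≤ s₂ ∧ ∃ ε > 0, ∀ p : ℝ → ℂ,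
      ContinuousOn p (Icc W.α W.β) → (∀ u ∈ Icc W.α W.β, ‖p u - Y u‖ < ε) → Strand W p := by
  have hf : Continuous fun t => (Y t).re := Complex.continuous_re.comp hY
  obtain ⟨α, β, h1, h2, h3, hα, hβ, hgt, hltM⟩ := exists_crossing hf hs hlt
  set m := (Y s₁).re with hm
  set M := (Y s₂).re with hM
  set g := (M - m) / 12 with hg
  have hg0 : 0 < g := by rw [hg]; linarith
  obtain ⟨a, haα, ham, ha⟩ :
      ∃ a, α < a ∧ a ≤ (α + β) / 2 ∧ ∀ t ∈ Icc α a, (Y t).re < m + 3 * g := by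
    obtain ⟨ε, hε, hb⟩ := Metric.isOpen_iff.1 (isOpen_Iio.preimage hf) α
      (show (Y α).re < m + 3 * g by linarith)
    refine ⟨min (α + ε / 2) ((α + β) / 2), lt_min (by linarith) (by linarith), min_le_right _ _,
      fun t ht => hb ?_⟩
    have := ht.2.trans (min_le_left _ _)
    rw [mem_ball, Real.dist_eq, abs_lt]
    constructor <;> linarith [ht.1]
  obtain ⟨b, hbβ, hbm, hb⟩ :
      ∃ b, b < β ∧ (α + β) / 2 ≤ b ∧ ∀ t ∈ Icc b β, M - 3 * g < (Y t).re := by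
    obtain ⟨ε, hε, hb⟩ := Metric.isOpen_iff.1 (isOpen_Ioi.preimage hf) β
      (show M - 3 * g < (Y β).re by linarith)
    refine ⟨max (β - ε / 2) ((α + β) / 2), max_lt (by linarith) (by linarith), le_max_right _ _,
      fun t ht => hb ?_⟩
    have := (le_max_left _ _).trans ht.1
    rw [mem_ball, Real.dist_eq, abs_lt]
    constructor <;> linarith [ht.2]
  obtain ⟨tm, htm, hm'⟩ := (isCompact_Icc (a := a) (b := β)).exists_isMinOn ⟨β, by linarith, le_rfl⟩
    hf.continuousOn
  obtain ⟨tM, htM, hM'⟩ := (isCompact_Icc (a := α) (b := b)).exists_isMaxOn ⟨α, le_rfl, by linarith⟩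
    hf.continuousOn
  have hm1 : m < (Y tm).re := hgt tm ⟨by linarith [htm.1], htm.2⟩
  have hM1 : (Y tM).re < M := hltM tM ⟨htM.1, by linarith [htM.2]⟩
  set e₁ := ((Y tm).re - m) / 2 with he₁
  set e₂ := (M - (Y tM).re) / 2 with he₂
  set ε := min (min (e₁ / 2) (e₂ / 2)) g with hε
  have hε0 : 0 < ε := lt_min (lt_min (by linarith) (by linarith)) hg0
  have hε1 : ε ≤ e₁ / 2 := (min_le_left _ _).trans (min_le_left _ _)
  have hε2 : ε ≤ e₂ / 2 := (min_le_left _ _).trans (min_le_right _ _)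
  have hε3 : ε ≤ g := min_le_right _ _
  refine ⟨⟨α, a, a, b, β, m + e₁, m + 4 * g, M - 4 * g, M - e₂, ε, haα, le_rfl, by linarith, hbβ,
    by linarith, by linarith, hε0⟩, h1, h3, ε, hε0, fun p hp hpY => ?_⟩
  have hre : ∀ u ∈ Icc α β, |(p u).re - (Y u).re| < ε := fun u hu => by
    rw [← Complex.sub_re]
    exact (Complex.abs_re_le_norm _).trans_lt (hpY u hu)
  refine ⟨hp, fun t ht => ?_, fun t ht => ?_, ?_, fun t ht => ?_, ?_, fun t ht => ?_, ?_, ?_⟩ <;>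
    simp only at *
  · have := abs_lt.1 (hre t ⟨ht.1, by linarith [ht.2]⟩)
    linarith [ha t ht]
  · have := abs_lt.1 (hre t ⟨by linarith [ht.1], ht.2⟩)
    linarith [hb t ht]
  · have := abs_lt.1 (hre α ⟨le_rfl, h2.le⟩)
    linarith
  · have := abs_lt.1 (hre t ⟨by linarith [ht.1], ht.2⟩)
    have h5 : (Y tm).re ≤ (Y t).re := hm' ht
    linarith
  · have := abs_lt.1 (hre β ⟨h2.le, le_rfl⟩)
    linarith
  · have := abs_lt.1 (hre t ⟨ht.1, by linarith [ht.2]⟩)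
    have h5 : (Y t).re ≤ (Y tM).re := hM' ht
    linarith
  · have := abs_lt.1 (hre a ⟨haα.le, by linarith⟩)
    have h5 : (Y tm).re ≤ (Y a).re := hm' (show a ∈ Icc a β from ⟨le_rfl, by linarith⟩)
    linarith
  · have := abs_lt.1 (hre a ⟨haα.le, by linarith⟩)
    have h5 : (Y a).re ≤ (Y tM).re := hM' (show a ∈ Icc α b from ⟨haα.le, by linarith⟩)
    linarith

end WindowConstruction

section Projection

variable {X : Type*} [NormedAddCommGroup X] [NormedSpace ℝ X] {C : Set X} {Φ : Semiflow X}
  {ψ : ℝ → X → X} {x : X}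

/-- A linear projection to the plane which is injective on the cone. -/
def ConeProjection (C : Set X) (π : X →L[ℝ] ℂ) : Prop := ∀ v ∈ C, π v = 0 → v = 0

theorem exists_coneProjection (hC : IsComplementedCone C 2) :
    ∃ π : X →L[ℝ] ℂ, ConeProjection C π := by
  obtain ⟨H, hH, hrank, hHC⟩ := hC
  have : IsClosed (H : Set X) := hH
  have hfin : Module.finrank ℝ (X ⧸ H) = 2 := by
    rw [Module.finrank, hrank]
    simp
  have : FiniteDimensional ℝ (X ⧸ H) := Module.finite_of_finrank_pos (by omega)
  let e : (X ⧸ H) ≃L[ℝ] ℂ :=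
    ContinuousLinearEquiv.ofFinrankEq (by rw [hfin, Complex.finrank_real_complex])
  refine ⟨e.toContinuousLinearMap.comp H.mkQL, fun v hv h0 => ?_⟩
  have h1 : H.mkQ v = 0 := by simpa using h0
  have h2 : v ∈ H := by simpa using h1
  have h3 : v ∈ (H : Set X) ∩ C := ⟨h2, hv⟩
  rw [hHC] at h3
  exact h3

variable {π : X →L[ℝ] ℂ}

theorem ConeProjection.smul (hπ : ConeProjection C π) {c : ℂ} (hc : c ≠ 0) :
    ConeProjection C (c • π) := fun v hv h0 => hπ v hv <| by
  have h1 : c * π v = 0 := h0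
  exact (mul_eq_zero.1 h1).resolve_left hc

theorem ConeProjection.eq_of_apply_eq (hπ : ConeProjection C π) {a b : X} (hab : a - b ∈ C)
    (h : π a = π b) : a = b :=
  sub_eq_zero.1 (hπ _ hab (by rw [map_sub, h, sub_self]))

theorem IsFlowExtensionOn.continuous_proj {K : Set X} {p : X} (hψ : IsFlowExtensionOn Φ ψ K)
    (hp : p ∈ K) : Continuous fun u => π (ψ u p) := π.continuous.comp (hψ.continuous_time hp)

namespace SeparatedTrajectory

variable {z q y : X}

theorem apply_notMem (h : SeparatedTrajectory Φ C ψ x) (hz : z ∈ omegaSet Φ x)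
    (hzE : z ∉ equilibria Φ) (s : ℝ) : ψ s z ∉ equilibria Φ := fun hE =>
  hzE ((h.flow.apply_mem_equilibria_iff hz s).1 hE)

theorem eq_of_proj_eq (h : SeparatedTrajectory Φ C ψ x) (hπ : ConeProjection C π)
    (hz : z ∈ omegaSet Φ x) (hzE : z ∉ equilibria Φ) (hq : q ∈ omegaSet Φ x) (he : π q = π z) :
    q = z := hπ.eq_of_apply_eq (h.ordered z hz hzE q hq) he

theorem exists_shadow (h : SeparatedTrajectory Φ C ψ x) (hq : q ∈ omegaSet Φ x) (a b : ℝ) {η : ℝ}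
    (hη : 0 < η) (M : ℝ) :
    ∃ τ ≥ M, ∀ u ∈ Icc a b, ‖π (Φ.toFun (τ + u) x) - π (ψ u q)‖ < η := by
  obtain ⟨t, ht0, ht, htq⟩ := exists_tendsto_of_mem_omegaSet hq
  by_contra! hcon
  have hex : ∀ n : ℕ, ∃ u, M ≤ t n →
      u ∈ Icc a b ∧ η ≤ ‖π (Φ.toFun (t n + u) x) - π (ψ u q)‖ := fun n => by
    by_cases hn : M ≤ t n
    · obtain ⟨u, hu, hu'⟩ := hcon (t n) hn
      exact ⟨u, fun _ => ⟨hu, hu'⟩⟩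
    · exact ⟨0, fun h => absurd h hn⟩
  choose u hu using hex
  have hM := ht.eventually_ge_atTop M
  obtain ⟨v, hv, huv⟩ := isCompact_Icc.exists_seqFilter_lim (hM.mono fun n hn => (hu n hn).1)
  have h1 := (π.continuous.tendsto _).comp (h.pre.tendsto_shift h.flow ht htq huv)
  have h2 := ((h.flow.continuous_proj (π := π) hq).tendsto v).comp huv
  have h3 := (h1.sub h2).norm
  rw [sub_self, norm_zero] at h3
  obtain ⟨n, hn, hn'⟩ := ((h3.eventually_lt_const hη).and hM).exists
  exact absurd hn (not_lt.2 (hu n hn').2)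

theorem exists_near_forward (h : SeparatedTrajectory Φ C ψ x) (hπ : ConeProjection C π)
    (hy : y ∈ omegaSet Φ x) (hyE : y ∉ equilibria Φ) (a b : ℝ) {ε : ℝ} (hε : 0 < ε) :
    ∃ δ > 0, ∃ t₁, ∀ t, t₁ ≤ t → ‖π (Φ.toFun t x) - π y‖ ≤ δ → ∀ u ∈ Icc a b,
      ‖π (Φ.toFun (t + u) x) - π (ψ u y)‖ < ε := by
  by_contra! hcon
  choose t ht hty u hu hd using fun n : ℕ => hcon (1 / ((n : ℝ) + 1)) (by positivity) n
  have htt := tendsto_seqFilter_atTop_of_le ht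
  obtain ⟨q, hq, htq⟩ := h.pre.exists_lim htt
  have h1 : Tendsto (fun n => π (Φ.toFun (t n) x)) seqFilter (nhds (π y)) := by
    refine tendsto_iff_norm_sub_tendsto_zero.2 (squeeze_zero (fun _ => norm_nonneg _) hty ?_)
    exact tendsto_one_div_add_atTop_nhds_zero_nat.mono_left seqFilter_le_atTop
  have hqy : q = y := h.eq_of_proj_eq hπ hy hyE hq
    (tendsto_nhds_unique ((π.continuous.tendsto _).comp htq) h1)
  subst hqy
  obtain ⟨v, hv, huv⟩ := isCompact_Icc.exists_seqFilter_lim (Eventually.of_forall hu)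
  have h1 := (π.continuous.tendsto _).comp (h.pre.tendsto_shift h.flow htt htq huv)
  have h2 := ((h.flow.continuous_proj (π := π) hq).tendsto v).comp huv
  have h3 := (h1.sub h2).norm
  rw [sub_self, norm_zero] at h3
  obtain ⟨n, hn⟩ := (h3.eventually_lt_const hε).exists
  exact absurd hn (not_lt.2 (hd n))

theorem exists_near_flow (h : SeparatedTrajectory Φ C ψ x) (hy : y ∈ omegaSet Φ x) (a b : ℝ)
    {ε : ℝ} (hε : 0 < ε) : ∃ δ > 0, ∀ q ∈ omegaSet Φ x, dist q y < δ → ∀ u ∈ Icc a b,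
      ‖π (ψ u q) - π (ψ u y)‖ < ε := by
  by_contra! hcon
  choose q hq hqy u hu hd using fun n : ℕ => hcon (1 / ((n : ℝ) + 1)) (by positivity)
  have h1 : Tendsto q seqFilter (nhds y) := by
    refine tendsto_iff_dist_tendsto_zero.2
      (squeeze_zero (fun _ => dist_nonneg) (fun n => (hqy n).le) ?_)
    exact tendsto_one_div_add_atTop_nhds_zero_nat.mono_left seqFilter_le_atTop
  obtain ⟨v, hv, huv⟩ := isCompact_Icc.exists_seqFilter_lim (Eventually.of_forall hu)
  have h1 := (π.continuous.tendsto _).comp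
    (h.flow.tendsto_apply huv h1 (Eventually.of_forall hq) hy)
  have h2 := ((h.flow.continuous_proj (π := π) hy).tendsto v).comp huv
  have h3 := (h1.sub h2).norm
  rw [sub_self, norm_zero] at h3
  obtain ⟨n, hn⟩ := (h3.eventually_lt_const hε).exists
  exact absurd hn (not_lt.2 (hd n))

/-- Near a nonequilibrium of the limit set there is a window crossed by its orbit and by all nearby
pieces of the trajectory. -/
theorem exists_window (h : SeparatedTrajectory Φ C ψ x) (hπ : ConeProjection C π)
    (hy : y ∈ omegaSet Φ x) (hyE : y ∉ equilibria Φ) {η : ℝ} (hη : 0 < η) :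
    ∃ π' : X →L[ℝ] ℂ, ConeProjection C π' ∧ ∃ W : Window, 0 ≤ W.α ∧ W.β ≤ η ∧
      (∃ ε > 0, ∀ p : ℝ → ℂ, ContinuousOn p (Icc W.α W.β) →
        (∀ u ∈ Icc W.α W.β, ‖p u - π' (ψ u y)‖ < ε) → Strand W p) ∧
      ∃ t₁, 0 ≤ t₁ ∧ ∀ t, t₁ ≤ t → ‖π' (Φ.toFun t x) - π' (ψ W.s y)‖ ≤ 2 * W.δ →
        Strand W fun u => π' (Φ.toFun (t + u - W.s) x) := by
  obtain ⟨s, hs, hsy⟩ : ∃ s ∈ Icc 0 η, ψ s y ≠ y := by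
    by_contra! hcon
    exact hyE (h.flow.mem_equilibria_of_const_on hy hη hcon)
  have hs0 : 0 < s := lt_of_le_of_ne hs.1 fun h0 => hsy (by rw [← h0, h.flow.map_zero hy])
  have hne : π (ψ s y) ≠ π y := fun he => hsy (h.eq_of_proj_eq hπ hy hyE (h.flow.2.1 s y hy) he)
  set c : ℂ := starRingEnd ℂ (π (ψ s y) - π y) with hc
  have hc0 : c ≠ 0 := by
    rw [hc, Ne, map_eq_zero]
    exact sub_ne_zero.2 hne
  refine ⟨c • π, hπ.smul hc0, ?_⟩
  have hlt : ((c • π) (ψ 0 y)).re < ((c • π) (ψ s y)).re := by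
    rw [h.flow.map_zero hy, ← sub_pos, ← Complex.sub_re, ← map_sub]
    have h1 : (c • π) (ψ s y - y) = (Complex.normSq (π (ψ s y) - π y) : ℂ) := by
      rw [Complex.normSq_eq_conj_mul_self, ← hc, ← map_sub]
      rfl
    rw [h1, Complex.ofReal_re]
    exact Complex.normSq_pos.2 (sub_ne_zero.2 hne)
  obtain ⟨W, hα, hβ, ε, hε, hW⟩ := exists_window_of_lt
    (h.flow.continuous_proj (π := c • π) hy) hs0 hlt
  obtain ⟨δ, hδ, t₁, hnear⟩ := h.exists_near_forward (hπ.smul hc0) (h.flow.2.1 W.s y hy)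
    (h.apply_notMem hy hyE W.s) (W.α - W.s) (W.β - W.s) hε
  have hδ' : 0 < min (δ / 2) W.δ := lt_min (by linarith) W.hδ
  refine ⟨W.shrink _ hδ', hα, hβ.trans hs.2, ⟨ε, hε, fun p hp hpY =>
    (hW p hp hpY).shrink hδ' (min_le_right _ _)⟩, max (max t₁ (W.s - W.α)) 0, le_max_right _ _,
    fun t ht htd => ?_⟩
  have ht1 : t₁ ≤ t := ((le_max_left _ _).trans (le_max_left _ _)).trans ht
  have ht2 : W.s - W.α ≤ t := ((le_max_right _ _).trans (le_max_left _ _)).trans ht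
  refine Strand.shrink (hW _ ?_ fun u hu => ?_) hδ' (min_le_right _ _)
  · refine (c • π).continuous.comp_continuousOn ((Φ.continuousOn_time x).comp
      (by fun_prop : Continuous fun u : ℝ => t + u - W.s).continuousOn fun u hu => ?_)
    have := hu.1
    refine mem_Ici.2 (?_ : 0 ≤ t + u - W.s)
    change W.α ≤ u at this
    linarith
  · have h1 : 2 * min (δ / 2) W.δ ≤ δ := by linarith [min_le_left (δ / 2) W.δ]
    have h2 := hnear t ht1 (htd.trans h1) (u - W.s) ⟨by linarith [hu.1], by linarith [hu.2]⟩
    rwa [h.flow.map_add hy, sub_add_cancel, ← add_sub_assoc] at h2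

end SeparatedTrajectory

end Projection

section Passes

variable {X : Type*} [NormedAddCommGroup X] [NormedSpace ℝ X] {C : Set X} {Φ : Semiflow X}
  {ψ : ℝ → X → X} {x : X} {π : X →L[ℝ] ℂ}

theorem continuous_clipped (Φ : Semiflow X) (π : X →L[ℝ] ℂ) (x : X) {t₀ : ℝ} (ht₀ : 0 ≤ t₀) :
    Continuous fun t => π (Φ.toFun (max t t₀) x) :=
  π.continuous.comp <| (Φ.continuousOn_time x).comp_continuous (by fun_prop) fun t =>
    mem_Ici.2 (ht₀.trans (le_max_right t t₀))

namespace SeparatedTrajectory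

variable {z q y : X}

theorem proj_ne (h : SeparatedTrajectory Φ C ψ x) (hπ : ConeProjection C π)
    (hq : q ∈ omegaSet Φ x) (hqE : q ∉ equilibria Φ) (a b : ℝ) :
    ∃ t₀, 0 ≤ t₀ ∧ ∀ t, t₀ ≤ t → ∀ r ∈ Icc a b, π (Φ.toFun t x) ≠ π (ψ r q) := by
  obtain ⟨t₀, ht₀, hs⟩ := h.separated q hq hqE a b
  exact ⟨t₀, ht₀, fun t ht r hr he => (hs t ht r hr).2 (hπ.eq_of_apply_eq (hs t ht r hr).1 he)⟩

/-- No orbit of the limit set crosses a window twice at nearby points. -/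
theorem not_doublePass (h : SeparatedTrajectory Φ C ψ x) (hπ : ConeProjection C π)
    (hq : q ∈ omegaSet Φ x) (hqE : q ∉ equilibria Φ) {W : Window} {r₁ r₂ t₁ : ℝ}
    (hr : r₁ + W.β < r₂ + W.α)
    (hinj : InjOn (fun u => ψ u q) (Icc (r₁ + W.α) (r₂ + W.β)))
    (hq₁ : Strand W fun u => π (ψ (r₁ + u) q)) (hq₂ : Strand W fun u => π (ψ (r₂ + u) q))
    (gap : ‖π (ψ (r₁ + W.s) q) - π (ψ (r₂ + W.s) q)‖ < W.δ)
    (near : ∀ t, t₁ ≤ t → ‖π (Φ.toFun t x) - π (ψ (r₁ + W.s) q)‖ ≤ W.δ →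
      Strand W fun u => π (Φ.toFun (t + u - W.s) x)) : False := by
  have w0 := W.αβ
  have w1 := W.hαa
  have w2 := W.hbβ
  have w3 := W.has
  have w4 := W.hsb
  have hab : r₁ + W.α ≤ r₂ + W.β := by linarith
  obtain ⟨t₀, ht₀, hne⟩ := h.proj_ne hπ hq hqE (r₁ + W.α) (r₂ + W.β)
  set P : ℝ → ℂ := fun t => π (Φ.toFun (max t t₀) x) with hP
  set c : ℝ → ℂ := fun u => π (ψ (projIcc (r₁ + W.α) (r₂ + W.β) hab u) q) with hc
  have hPe : ∀ t, t₀ ≤ t → P t = π (Φ.toFun t x) := fun t ht => by simp only [hP, max_eq_left ht]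
  have hce : ∀ u ∈ Icc (r₁ + W.α) (r₂ + W.β), c u = π (ψ u q) := fun u hu => by
    simp only [hc, projIcc_of_mem hab hu]
  have hd : DoublePass W P c r₁ r₂ (max t₁ (t₀ + (W.s - W.α))) := by
    refine ⟨continuous_clipped Φ π x ht₀, (h.flow.continuous_proj hq).comp
      (continuous_subtype_val.comp continuous_projIcc), fun s t => ?_, hr, ?_, ?_, ?_, ?_, ?_, ?_⟩
    · exact hne _ (le_max_right _ _) _ (projIcc _ _ hab s).2
    · refine InjOn.congr (f₁ := fun u => π (ψ u q)) (fun u hu v hv he => hinj hu hv ?_)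
        fun u hu => (hce u hu).symm
      exact h.eq_of_proj_eq hπ (h.flow.2.1 v q hq) (h.apply_notMem hq hqE v)
        (h.flow.2.1 u q hq) he
    · exact hq₁.congr fun u hu => hce _ ⟨by linarith [hu.1], by linarith [hu.2]⟩
    · exact hq₂.congr fun u hu => hce _ ⟨by linarith [hu.1], by linarith [hu.2]⟩
    · rwa [hce _ ⟨by linarith, by linarith⟩, hce _ ⟨by linarith, by linarith⟩]
    · intro t ht htn
      have ht1 := (le_max_left _ _).trans ht
      have ht2 := (le_max_right _ _).trans ht
      rw [hce _ ⟨by linarith, by linarith⟩, hPe _ (by linarith)] at htn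
      exact (near t ht1 htn).congr fun u hu => hPe _ (by linarith [hu.1])
    · intro η hη M
      obtain ⟨τ, hτ, hτs⟩ := h.exists_shadow (π := π) hq (r₁ + W.α) (r₂ + W.β) hη
        (max M (t₀ - (r₁ + W.α)))
      refine ⟨τ, (le_max_left _ _).trans hτ, fun u hu => ?_⟩
      rw [hce u hu, hPe _ (by linarith [(le_max_right _ _).trans hτ, hu.1])]
      exact hτs u hu
  exact hd.elim

/-- A nonperiodic orbit of the limit set does not return to a nonequilibrium. -/
theorem mem_equilibria_of_recurs (h : SeparatedTrajectory Φ C ψ x) (hπ : ConeProjection C π)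
    (hz : z ∈ omegaSet Φ x) (hzE : z ∉ equilibria Φ) (hinj : Function.Injective fun u => ψ u z)
    (hy : y ∈ omegaSet Φ x)
    (hret : ∀ ε > 0, ∀ L, ∃ r₁ r₂, r₁ + L < r₂ ∧ dist (ψ r₁ z) y < ε ∧ dist (ψ r₂ z) y < ε) :
    y ∈ equilibria Φ := by
  by_contra hyE
  obtain ⟨π', hπ', W, -, -, ⟨ε, hε, hW⟩, t₁, ht₁, hnear⟩ := h.exists_window hπ hy hyE one_pos
  have w0 := W.αβ
  have w1 := W.hαa
  have w2 := W.hbβ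
  have w3 := W.has
  have w4 := W.hsb
  have hδ := W.hδ
  obtain ⟨ρ, hρ, hclose⟩ := h.exists_near_flow (π := π') hy W.α W.β
    (lt_min hε (half_pos W.hδ))
  obtain ⟨r₁, r₂, hr, h1, h2⟩ := hret ρ hρ (W.β - W.α)
  have hc : ∀ r, dist (ψ r z) y < ρ → ∀ u ∈ Icc W.α W.β,
      ‖π' (ψ (r + u) z) - π' (ψ u y)‖ < min ε (W.δ / 2) := fun r hrρ u hu => by
    have := hclose _ (h.flow.2.1 r z hz) hrρ u hu
    rwa [h.flow.map_add hz, add_comm u r] at this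
  have hst : ∀ r, dist (ψ r z) y < ρ → Strand W fun u => π' (ψ (r + u) z) := fun r hrρ =>
    hW _ ((h.flow.continuous_proj hz).comp (by fun_prop)).continuousOn fun u hu =>
      (hc r hrρ u hu).trans_le (min_le_left _ _)
  have hs : W.s ∈ Icc W.α W.β := ⟨by linarith, by linarith⟩
  have e1 := (hc r₁ h1 _ hs).trans_le (min_le_right _ _)
  have e2 := (hc r₂ h2 _ hs).trans_le (min_le_right _ _)
  refine h.not_doublePass hπ' hz hzE (W := W) (r₁ := r₁) (r₂ := r₂) (t₁ := t₁) (by linarith)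
    hinj.injOn (hst r₁ h1) (hst r₂ h2) ?_ fun t ht htn => hnear t ht ?_
  · have := norm_sub_le_norm_sub_add_norm_sub (π' (ψ (r₁ + W.s) z)) (π' (ψ W.s y))
      (π' (ψ (r₂ + W.s) z))
    rw [norm_sub_rev (π' (ψ W.s y))] at this
    linarith
  · have := norm_sub_le_norm_sub_add_norm_sub (π' (Φ.toFun t x)) (π' (ψ (r₁ + W.s) z))
      (π' (ψ W.s y))
    linarith

theorem limits_of_injective (h : SeparatedTrajectory Φ C ψ x) (hπ : ConeProjection C π)
    (hz : z ∈ omegaSet Φ x) (hzE : z ∉ equilibria Φ)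
    (hinj : Function.Injective fun u => ψ u z) :
    omegaSet Φ z ⊆ equilibria Φ ∧ alphaSet ψ z ⊆ equilibria Φ := by
  have hcl := h.pre.isCompact_omegaSet.isClosed
  constructor
  · intro y hy
    obtain ⟨t, ht0, ht, hty⟩ := exists_tendsto_of_mem_omegaSet hy
    have hty' : Tendsto (fun n => ψ (t n) z) seqFilter (nhds y) := by
      refine hty.congr fun n => (h.flow.1 _ ?_ z hz).symm
      exact n.cast_nonneg.trans (ht0 n)
    refine h.mem_equilibria_of_recurs hπ hz hzE hinj
      (hcl.mem_of_tendsto hty' (Eventually.of_forall fun n => h.flow.2.1 _ _ hz)) fun ε hε L => ?_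
    have hev := hty'.eventually (ball_mem_nhds y hε)
    obtain ⟨n, hn⟩ := hev.exists
    obtain ⟨m, hm, hm'⟩ := (hev.and (ht.eventually_gt_atTop (t n + L))).exists
    exact ⟨t n, t m, hm', hn, hm⟩
  · intro y hy
    obtain ⟨t, ht0, ht, hty⟩ := exists_tendsto_of_mem_alphaSet hy
    refine h.mem_equilibria_of_recurs hπ hz hzE hinj
      (hcl.mem_of_tendsto hty (Eventually.of_forall fun n => h.flow.2.1 _ _ hz)) fun ε hε L => ?_
    have hev := hty.eventually (ball_mem_nhds y hε)
    obtain ⟨n, hn⟩ := hev.exists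
    obtain ⟨m, hm, hm'⟩ := (hev.and (ht.eventually_gt_atTop (t n + L))).exists
    exact ⟨-t m, -t n, by linarith, hm, hn⟩

end SeparatedTrajectory

end Passes

section Cycles

variable {X : Type*} [NormedAddCommGroup X] [NormedSpace ℝ X] {C : Set X} {Φ : Semiflow X}
  {ψ : ℝ → X → X} {x z k : X} {π : X →L[ℝ] ℂ} {W : Window} {τ ε : ℝ}

/-- A window crossed by a periodic orbit of the limit set, of minimal period `τ`, together with a
tolerance `ε` controlling the orbits that stay `ε`-close to it. -/
structure CycleWindow (Φ : Semiflow X) (C : Set X) (ψ : ℝ → X → X) (x z : X) (π : X →L[ℝ] ℂ)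
    (W : Window) (τ ε : ℝ) : Prop where
  proj : ConeProjection C π
  mem : z ∈ omegaSet Φ x
  notMem : z ∉ equilibria Φ
  pos : 0 < τ
  per : ψ τ z = z
  hα : 0 ≤ W.α
  hβ : W.β ≤ τ / 4
  hε : 0 < ε
  hεδ : 2 * ε ≤ W.δ
  strand : ∀ p : ℝ → ℂ, ContinuousOn p (Icc W.α W.β) →
    (∀ u ∈ Icc W.α W.β, ‖p u - π (ψ u z)‖ < 2 * ε) → Strand W p
  near : ∃ t₁, 0 ≤ t₁ ∧ ∀ t, t₁ ≤ t → ‖π (Φ.toFun t x) - π (ψ W.s z)‖ ≤ 2 * W.δ →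
    Strand W fun u => π (Φ.toFun (t + u - W.s) x)
  far₀ : ∀ t ∈ Icc (τ / 4) (3 * τ / 4) ∪ Icc (τ + (W.s - W.α) / 2) (5 * τ / 4),
    2 * ε ≤ ‖π (ψ t z) - π z‖
  far₁ : ∀ t ∈ Icc W.β (τ + (W.α + W.s) / 2), 8 * ε ≤ ‖π (ψ W.s z) - π (ψ t z)‖

/-- `k` is a nonequilibrium of the limit set following `z` for two periods. -/
structure Follows (Φ : Semiflow X) (ψ : ℝ → X → X) (x z : X) (π : X →L[ℝ] ℂ) (τ ε : ℝ) (k : X) :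
    Prop where
  mem : k ∈ omegaSet Φ x
  close : ∀ u ∈ Icc 0 (2 * τ), ‖π (ψ u k) - π (ψ u z)‖ < ε

theorem SeparatedTrajectory.exists_cycleWindow (h : SeparatedTrajectory Φ C ψ x)
    (hπ : ConeProjection C π) (hz : z ∈ omegaSet Φ x) (hzE : z ∉ equilibria Φ) {T : ℝ}
    (hT : T ≠ 0) (hTz : ψ T z = z) :
    ∃ π' W τ ε, CycleWindow Φ C ψ x z π' W τ ε := by
  obtain ⟨τ, hτ, hper⟩ := h.flow.exists_minimal_period hz hzE hT hTz
  obtain ⟨π', hπ', W, hα, hβ, ⟨ε₀, hε₀, hW⟩, hnear⟩ :=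
    h.exists_window hπ hz hzE (show 0 < τ / 4 by positivity)
  have w1 := W.hαa
  have w2 := W.hbβ
  have w3 := W.has
  have w4 := W.hsb
  have hne : ∀ a b : ℝ, 0 < b - a → b - a < 2 * τ → b - a ≠ τ → ψ a z ≠ ψ b z := by
    intro a b h0 h1 h2 he
    have h3 : ψ (b - a) z = z := by
      have := congrArg (ψ (-a)) he
      rw [h.flow.map_neg hz, h.flow.map_add hz] at this
      rw [show b - a = -a + b by ring, ← this]
    obtain ⟨n, hn⟩ := (hper _).1 h3
    rw [hn] at h0 h1 h2
    have n1 : 0 < n := by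
      by_contra! hcon
      have : (n : ℝ) ≤ 0 := by exact_mod_cast hcon
      nlinarith
    have n2 : n < 2 := by
      by_contra! hcon
      have : (2 : ℝ) ≤ n := by exact_mod_cast hcon
      nlinarith
    have n3 : n = 1 := by omega
    rw [n3] at h2
    simp at h2
  have hfar : ∀ (V : Set ℝ) (σ : ℝ), IsCompact V → (∀ t ∈ V, ψ σ z ≠ ψ t z) →
      ∃ m, 0 < m ∧ ∀ t ∈ V, m ≤ ‖π' (ψ σ z) - π' (ψ t z)‖ := fun V σ hV hVσ => by
    refine hV.exists_forall_le' (f := fun t => ‖π' (ψ σ z) - π' (ψ t z)‖)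
      (continuous_const.sub (h.flow.continuous_proj hz)).norm.continuousOn fun t ht => ?_
    refine norm_pos_iff.2 (sub_ne_zero.2 fun he => hVσ t ht ?_)
    exact h.eq_of_proj_eq hπ' (h.flow.2.1 t z hz) (h.apply_notMem hz hzE t) (h.flow.2.1 σ z hz) he
  obtain ⟨m₀, hm₀, hf₀⟩ := hfar (Icc (τ / 4) (3 * τ / 4) ∪ Icc (τ + (W.s - W.α) / 2) (5 * τ / 4)) 0
    (isCompact_Icc.union isCompact_Icc) fun t ht => by
      refine hne 0 t ?_ ?_ ?_
      · rcases ht with ht | ht <;> linarith [ht.1]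
      · rcases ht with ht | ht <;> linarith [ht.2]
      · rcases ht with ht | ht
        · have := ht.2
          intro he
          linarith
        · have := ht.1
          intro he
          linarith
  obtain ⟨m₁, hm₁, hf₁⟩ := hfar (Icc W.β (τ + (W.α + W.s) / 2)) W.s isCompact_Icc fun t ht => by
    refine hne W.s t (by linarith [ht.1]) (by linarith [ht.2]) fun he => ?_
    linarith [ht.2]
  have hδ := W.hδ
  set ε := min (min (ε₀ / 2) (W.δ / 2)) (min (m₀ / 2) (m₁ / 8)) with hε
  have e1 : ε ≤ ε₀ / 2 := (min_le_left _ _).trans (min_le_left _ _)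
  have e2 : ε ≤ W.δ / 2 := (min_le_left _ _).trans (min_le_right _ _)
  have e3 : ε ≤ m₀ / 2 := (min_le_right _ _).trans (min_le_left _ _)
  have e4 : ε ≤ m₁ / 8 := (min_le_right _ _).trans (min_le_right _ _)
  refine ⟨π', W, τ, ε, hπ', hz, hzE, hτ, (hper τ).2 ⟨1, by simp⟩, hα, hβ,
    lt_min (lt_min (by positivity) (by positivity)) (lt_min (by positivity) (by positivity)),
    by linarith, fun p hp hpu => hW p hp fun u hu => (hpu u hu).trans_le (by linarith), hnear,
    fun t ht => ?_, fun t ht => by linarith [hf₁ t ht]⟩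
  have := hf₀ t ht
  rw [h.flow.map_zero hz, norm_sub_rev] at this
  linarith

namespace CycleWindow

theorem notMem_of_follows (w : CycleWindow Φ C ψ x z π W τ ε) (h : SeparatedTrajectory Φ C ψ x)
    (hk : Follows Φ ψ x z π τ ε k) : k ∉ equilibria Φ := fun hE => by
  have hτ := w.pos
  have h1 := hk.close (τ / 2) ⟨by linarith, by linarith⟩
  have h2 := hk.close 0 ⟨by linarith, by linarith⟩
  rw [h.flow.apply_of_mem_equilibria hk.mem hE] at h1 h2
  rw [h.flow.map_zero w.mem] at h2
  have h3 := w.far₀ (τ / 2) (Or.inl ⟨by linarith, by linarith⟩)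
  have h4 := norm_sub_le_norm_sub_add_norm_sub (π (ψ (τ / 2) z)) (π k) (π z)
  rw [norm_sub_rev (π (ψ (τ / 2) z)) (π k)] at h4
  linarith

theorem strand_of_follows (w : CycleWindow Φ C ψ x z π W τ ε) (h : SeparatedTrajectory Φ C ψ x)
    (hk : Follows Φ ψ x z π τ ε k) : Strand W fun u => π (ψ u k) := by
  have hτ := w.pos
  refine w.strand _ (h.flow.continuous_proj hk.mem).continuousOn fun u hu => ?_
  have := hk.close u ⟨w.hα.trans hu.1, by linarith [hu.2, w.hβ]⟩
  linarith [w.hε]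

/-- Orbits following a cycle of the limit set are closed. -/
theorem exists_period (w : CycleWindow Φ C ψ x z π W τ ε) (h : SeparatedTrajectory Φ C ψ x)
    (hk : Follows Φ ψ x z π τ ε k) :
    ∃ T, W.β ≤ T + W.α ∧ T + W.α ≤ τ + (W.α + W.s) / 2 ∧ ψ T k = k := by
  have w0 := W.αβ
  have w1 := W.hαa
  have w2 := W.hbβ
  have w3 := W.has
  have w4 := W.hsb
  have hτ := w.pos
  have hα := w.hα
  have hβ := w.hβ
  have hε := w.hε
  have hεδ := w.hεδ
  have hper : ∀ u, ψ (τ + u) z = ψ u z := fun u => by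
    rw [add_comm, ← h.flow.map_add w.mem, w.per]
  have hs : W.s ∈ Icc W.α W.β := ⟨by linarith, by linarith⟩
  have hinj : ¬ InjOn (fun u => ψ u k) (Icc (0 + W.α) (τ + W.β)) := fun hinj => by
    have hcl : ∀ u ∈ Icc W.α W.β, ‖π (ψ (τ + u) k) - π (ψ u z)‖ < ε := fun u hu => by
      rw [← hper u]
      exact hk.close _ ⟨by linarith [hu.1], by linarith [hu.2]⟩
    have hcs := hk.close W.s ⟨by linarith, by linarith⟩
    obtain ⟨t₁, ht₁, hnear⟩ := w.near
    refine h.not_doublePass w.proj hk.mem (w.notMem_of_follows h hk) (W := W) (r₁ := 0) (r₂ := τ)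
      (t₁ := t₁) (by linarith) hinj (by simpa using w.strand_of_follows h hk) ?_ ?_
      fun t ht htn => hnear t ht ?_
    · refine w.strand _ ((h.flow.continuous_proj hk.mem).comp (by fun_prop)).continuousOn
        fun u hu => ?_
      linarith [hcl u hu]
    · rw [zero_add]
      have h1 := hcl _ hs
      have := norm_sub_le_norm_sub_add_norm_sub (π (ψ W.s k)) (π (ψ W.s z)) (π (ψ (τ + W.s) k))
      rw [norm_sub_rev (π (ψ W.s z))] at this
      linarith
    · rw [zero_add] at htn
      have := norm_sub_le_norm_sub_add_norm_sub (π (Φ.toFun t x)) (π (ψ W.s k)) (π (ψ W.s z))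
      linarith
  obtain ⟨T, hT0, hT1, hTk⟩ : ∃ T, 0 < T ∧ T ≤ 5 * τ / 4 ∧ ψ T k = k := by
    have key : ∀ u v, u < v → 0 + W.α ≤ u → v ≤ τ + W.β → ψ u k = ψ v k →
        ∃ T, 0 < T ∧ T ≤ 5 * τ / 4 ∧ ψ T k = k := fun u v huv hu hv he => by
      refine ⟨v - u, by linarith, by linarith, ?_⟩
      have := congrArg (ψ (-u)) he
      rw [h.flow.map_neg hk.mem, h.flow.map_add hk.mem] at this
      rw [show v - u = -u + v by ring, ← this]
    simp only [InjOn, not_forall] at hinj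
    obtain ⟨u, hu, v, hv, he, hne⟩ := hinj
    rcases lt_or_gt_of_ne hne with huv | huv
    · exact key u v huv hu.1 hv.2 he
    · exact key v u huv hv.1 hu.2 he.symm
  have hV : ∀ T, 0 ≤ T → ψ T k = k →
      T ∉ Icc (τ / 4) (3 * τ / 4) ∪ Icc (τ + (W.s - W.α) / 2) (5 * τ / 4) := fun T hT0 hTk hTV => by
    have hT1 : T ≤ 5 * τ / 4 := by
      rcases hTV with hTV | hTV <;> linarith [hTV.2]
    have h1 := hk.close T ⟨hT0, by linarith⟩
    have h2 := hk.close 0 ⟨le_rfl, by linarith⟩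
    rw [hTk] at h1
    rw [h.flow.map_zero hk.mem, h.flow.map_zero w.mem] at h2
    have h3 := w.far₀ T hTV
    have h4 := norm_sub_le_norm_sub_add_norm_sub (π (ψ T z)) (π k) (π z)
    rw [norm_sub_rev (π (ψ T z)) (π k)] at h4
    linarith
  have hT2 : τ / 4 ≤ T := by
    by_contra! hlt
    have hP : Function.Periodic (fun u => ψ u k) T := fun u => by
      change ψ (u + T) k = ψ u k
      rw [← h.flow.map_add hk.mem, hTk]
    obtain ⟨v, hv, hv'⟩ := hP.exists_mem_Ico hT0 0 (τ / 4)
    refine hV v (by linarith [hv.1]) ?_ (Or.inl ⟨hv.1, by linarith [hv.2]⟩)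
    rw [← h.flow.map_zero hk.mem]
    simpa [h.flow.map_zero hk.mem] using hv'.symm
  refine ⟨T, by linarith, ?_, hTk⟩
  by_contra! hgt
  exact hV T hT0.le hTk (Or.inr ⟨by linarith, hT1⟩)

end CycleWindow

end Cycles

section Cycles

variable {X : Type*} [NormedAddCommGroup X] [NormedSpace ℝ X] {C : Set X} {Φ : Semiflow X}
  {ψ : ℝ → X → X} {x z k k' k₁ k₂ k₃ : X} {π : X →L[ℝ] ℂ} {W : Window} {τ ε : ℝ}

namespace CycleWindow

theorem proj_ne_of_follows (w : CycleWindow Φ C ψ x z π W τ ε) (h : SeparatedTrajectory Φ C ψ x)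
    (hk : Follows Φ ψ x z π τ ε k) (hk' : Follows Φ ψ x z π τ ε k')
    (hd : ∀ s t, ψ s k ≠ ψ t k') (s t : ℝ) : π (ψ s k) ≠ π (ψ t k') := fun he =>
  hd s t (h.eq_of_proj_eq w.proj (h.flow.2.1 t k' hk'.mem)
    (h.apply_notMem hk'.mem (w.notMem_of_follows h hk') t) (h.flow.2.1 s k hk.mem) he)

theorem strandHeight_ne (w : CycleWindow Φ C ψ x z π W τ ε) (h : SeparatedTrajectory Φ C ψ x)
    (hk : Follows Φ ψ x z π τ ε k) (hk' : Follows Φ ψ x z π τ ε k')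
    (hd : ∀ s t, ψ s k ≠ ψ t k') :
    strandHeight W (fun u => π (ψ u k)) ≠ strandHeight W fun u => π (ψ u k') := by
  have hp := w.strand_of_follows h hk
  have hq := w.strand_of_follows h hk'
  obtain ⟨L, hL, hexp⟩ := exists_log_strands hp.cont hq.cont
    fun s _ t _ => w.proj_ne_of_follows h hk hk' hd t s
  obtain ⟨-, -, hne⟩ := hp.bands hq hL.continuousOn hexp
  exact hne

/-- The trajectory passes late through the window on the same side as any following orbit. -/
theorem exists_pass (w : CycleWindow Φ C ψ x z π W τ ε) (h : SeparatedTrajectory Φ C ψ x)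
    (hk : Follows Φ ψ x z π τ ε k) (hk' : Follows Φ ψ x z π τ ε k')
    (hd : ∀ s t, ψ s k ≠ ψ t k') {P : ℝ → ℂ} {t₀ : ℝ}
    (hPc : Continuous P) (hP : ∀ t, t₀ ≤ t → P t = π (Φ.toFun t x)) :
    ∃ t, ‖P t - π (ψ W.s z)‖ < 2 * ε ∧ Strand W (fun u => P (t + u - W.s)) ∧
      belowInd W (fun u => P (t + u - W.s)) (fun u => π (ψ u k')) =
        belowInd W (fun u => π (ψ u k)) fun u => π (ψ u k') := by
  have w0 := W.αβ
  have w1 := W.hαa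
  have w2 := W.hbβ
  have w3 := W.has
  have w4 := W.hsb
  have hτ := w.pos
  obtain ⟨m, hm, hmin⟩ := (isCompact_Icc.prod isCompact_Icc).exists_forall_le'
    (s := Icc W.α W.β ×ˢ Icc W.α W.β) (f := fun v : ℝ × ℝ => ‖π (ψ v.1 k) - π (ψ v.2 k')‖)
    ((((h.flow.continuous_proj hk.mem).comp continuous_fst).sub
      ((h.flow.continuous_proj hk'.mem).comp continuous_snd)).norm).continuousOn (a := 0)
    fun v _ => norm_pos_iff.2 (sub_ne_zero.2 (w.proj_ne_of_follows h hk hk' hd _ _))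
  obtain ⟨σ, hσ, hsh⟩ := h.exists_shadow (π := π) hk.mem W.α W.β (lt_min w.hε hm) (t₀ - W.α)
  have hPe : ∀ u ∈ Icc W.α W.β, ‖P (σ + W.s + u - W.s) - π (ψ u k)‖ < min ε m := fun u hu => by
    rw [hP _ (by linarith [hu.1]), show σ + W.s + u - W.s = σ + u by ring]
    exact hsh u hu
  have hz : ∀ u ∈ Icc W.α W.β, ‖P (σ + W.s + u - W.s) - π (ψ u z)‖ < 2 * ε := fun u hu => by
    have h1 := (hPe u hu).trans_le (min_le_left _ _)
    have h2 := hk.close u ⟨w.hα.trans hu.1, by linarith [hu.2, w.hβ]⟩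
    have := norm_sub_le_norm_sub_add_norm_sub (P (σ + W.s + u - W.s)) (π (ψ u k)) (π (ψ u z))
    linarith
  have hst : Strand W fun u => P (σ + W.s + u - W.s) :=
    w.strand _ (hPc.comp (by fun_prop)).continuousOn hz
  refine ⟨σ + W.s, ?_, hst, belowInd_congr hst (w.strand_of_follows h hk)
    (w.strand_of_follows h hk') fun s hs t ht => ?_⟩
  · have := hz W.s ⟨by linarith, by linarith⟩
    rwa [add_sub_cancel_right] at this
  · exact ((hPe t ht).trans_le (min_le_right _ _)).trans_le (hmin (t, s) ⟨ht, hs⟩)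

/-- There is no cycle between two other cycles following it. -/
theorem not_between (w : CycleWindow Φ C ψ x z π W τ ε) (h : SeparatedTrajectory Φ C ψ x)
    (h₁ : Follows Φ ψ x z π τ ε k₁) (h₂ : Follows Φ ψ x z π τ ε k₂)
    (h₃ : Follows Φ ψ x z π τ ε k₃)
    (hd₁ : ∀ s t, ψ s k₁ ≠ ψ t k₂) (hd₃ : ∀ s t, ψ s k₃ ≠ ψ t k₂)
    (hlt₁ : strandHeight W (fun u => π (ψ u k₁)) < strandHeight W fun u => π (ψ u k₂))
    (hlt₃ : strandHeight W (fun u => π (ψ u k₂)) < strandHeight W fun u => π (ψ u k₃)) :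
    False := by
  have w0 := W.αβ
  have w1 := W.hαa
  have w2 := W.hbβ
  have w3 := W.has
  have w4 := W.hsb
  have hτ := w.pos
  have hβ := w.hβ
  obtain ⟨T, hT1, hT2, hTk⟩ := w.exists_period h h₂
  have hT0 : 0 < T := by linarith
  have hper : Function.Periodic (fun u => ψ u k₂) T := fun u => by
    change ψ (u + T) k₂ = ψ u k₂
    rw [← h.flow.map_add h₂.mem, hTk]
  obtain ⟨t₀, ht₀, hne⟩ := h.proj_ne w.proj h₂.mem (w.notMem_of_follows h h₂) 0 T
  have hPe : ∀ t, t₀ ≤ t → π (Φ.toFun (max t t₀) x) = π (Φ.toFun t x) := fun t ht => by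
    rw [max_eq_left ht]
  obtain ⟨t, ht, hst, hbt⟩ := w.exists_pass h h₁ h₂ hd₁ (continuous_clipped Φ π x ht₀) hPe
  obtain ⟨t', ht', hst', hbt'⟩ := w.exists_pass h h₃ h₂ hd₃ (continuous_clipped Φ π x ht₀) hPe
  have hclosed := belowInd_eq_of_closed (continuous_clipped Φ π x ht₀)
    (h.flow.continuous_proj (π := π) h₂.mem) (fun s t => by
      obtain ⟨r, hr, hr'⟩ := hper.exists_mem_Ico₀ hT0 s
      rw [show ψ s k₂ = ψ r k₂ from hr']
      exact hne _ (le_max_right _ _) r ⟨hr.1, hr.2.le⟩) hT1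
    (fun s => congrArg π (hper s)) (w.strand_of_follows h h₂) hst hst' fun u hu => by
      have f1 := w.far₁ u ⟨hu.1, hu.2.trans hT2⟩
      have f2 := h₂.close u ⟨by linarith [w.hα, hu.1], by linarith [hu.2]⟩
      have f3 := norm_sub_le_norm_sub_add_norm_sub (π (Φ.toFun (max t t₀) x)) (π (ψ W.s z))
        (π (Φ.toFun (max t' t₀) x))
      have f4 := norm_sub_le_norm_sub_add_norm_sub (π (ψ W.s z)) (π (Φ.toFun (max t' t₀) x))
        (π (ψ u z))
      have f5 := norm_sub_le_norm_sub_add_norm_sub (π (Φ.toFun (max t' t₀) x)) (π (ψ u k₂))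
        (π (ψ u z))
      rw [norm_sub_rev (π (ψ W.s z)) (π (Φ.toFun (max t' t₀) x))] at f3 f4
      linarith [w.hε]
  rw [hbt, hbt', belowInd, belowInd, if_pos hlt₁, if_neg hlt₃.le.not_gt] at hclosed
  exact one_ne_zero hclosed

end CycleWindow

end Cycles

section Cycles

variable {X : Type*} [NormedAddCommGroup X] [NormedSpace ℝ X] {C : Set X} {Φ : Semiflow X}
  {ψ : ℝ → X → X} {x z k k' k₁ k₂ k₃ : X} {π : X →L[ℝ] ℂ} {W : Window} {τ ε : ℝ}

namespace CycleWindow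

theorem not_three (w : CycleWindow Φ C ψ x z π W τ ε) (h : SeparatedTrajectory Φ C ψ x)
    (h₁ : Follows Φ ψ x z π τ ε k₁) (h₂ : Follows Φ ψ x z π τ ε k₂)
    (h₃ : Follows Φ ψ x z π τ ε k₃) (h12 : ∀ s t, ψ s k₁ ≠ ψ t k₂)
    (h13 : ∀ s t, ψ s k₁ ≠ ψ t k₃) (h23 : ∀ s t, ψ s k₂ ≠ ψ t k₃) : False := by
  have h21 : ∀ s t, ψ s k₂ ≠ ψ t k₁ := fun s t => (h12 t s).symm
  have h31 : ∀ s t, ψ s k₃ ≠ ψ t k₁ := fun s t => (h13 t s).symm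
  have h32 : ∀ s t, ψ s k₃ ≠ ψ t k₂ := fun s t => (h23 t s).symm
  rcases lt_or_gt_of_ne (w.strandHeight_ne h h₁ h₂ h12) with a | a <;>
  rcases lt_or_gt_of_ne (w.strandHeight_ne h h₁ h₃ h13) with b | b <;>
  rcases lt_or_gt_of_ne (w.strandHeight_ne h h₂ h₃ h23) with c | c
  · exact w.not_between h h₁ h₂ h₃ h12 h32 a c
  · exact w.not_between h h₁ h₃ h₂ h13 h23 b c
  · exact lt_asymm (a.trans c) b
  · exact w.not_between h h₃ h₁ h₂ h31 h21 b a
  · exact w.not_between h h₂ h₁ h₃ h21 h31 a b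
  · exact lt_asymm (b.trans c) a
  · exact w.not_between h h₂ h₃ h₁ h23 h13 c b
  · exact w.not_between h h₃ h₂ h₁ h32 h12 c a

theorem follows_self (w : CycleWindow Φ C ψ x z π W τ ε) : Follows Φ ψ x z π τ ε z :=
  ⟨w.mem, fun u _ => by simpa using w.hε⟩

end CycleWindow

namespace IsFlowExtensionOn

variable {K : Set X} {p : X}

theorem periodic (hψ : IsFlowExtensionOn Φ ψ K) (hp : p ∈ K) {T : ℝ} (hT : ψ T p = p) :
    Function.Periodic (fun u => ψ u p) T := fun u => by
  change ψ (u + T) p = ψ u p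
  rw [← hψ.map_add hp, hT]

theorem isCompact_range (hψ : IsFlowExtensionOn Φ ψ K) (hp : p ∈ K) {T : ℝ} (hT0 : T ≠ 0)
    (hT : ψ T p = p) : IsCompact (range fun u => ψ u p) :=
  (hψ.periodic hp hT).compact_of_continuous hT0 (hψ.continuous_time hp)

theorem apply_mem_range_iff (hψ : IsFlowExtensionOn Φ ψ K) (hp : p ∈ K) (hk : k ∈ K) (s : ℝ) :
    ψ s k ∈ (range fun u => ψ u p) ↔ k ∈ range fun u => ψ u p := by
  constructor
  · rintro ⟨u, hu⟩
    refine ⟨-s + u, ?_⟩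
    change ψ (-s + u) p = k
    change ψ u p = ψ s k at hu
    rw [← hψ.map_add hp, hu, hψ.map_neg hk]
  · rintro ⟨u, rfl⟩
    exact ⟨s + u, (hψ.map_add hp s u).symm⟩

theorem ne_of_notMem_range (hψ : IsFlowExtensionOn Φ ψ K) (hp : p ∈ K) (hk : k ∈ K)
    (h : k ∉ range fun u => ψ u p) (s t : ℝ) : ψ s p ≠ ψ t k := fun he =>
  h ((hψ.apply_mem_range_iff hp hk t).1 ⟨s, he⟩)

theorem limits_of_mem_equilibria {K : Set X} {z : X} (hψ : IsFlowExtensionOn Φ ψ K) (hz : z ∈ K)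
    (hzE : z ∈ equilibria Φ) : omegaSet Φ z ⊆ equilibria Φ ∧ alphaSet ψ z ⊆ equilibria Φ := by
  constructor
  · intro y hy
    obtain ⟨t, ht0, -, hty⟩ := exists_tendsto_of_mem_omegaSet hy
    rwa [tendsto_nhds_unique hty
      (tendsto_const_nhds.congr fun n => (hzE _ (n.cast_nonneg.trans (ht0 n))).symm)]
  · intro y hy
    obtain ⟨t, -, -, hty⟩ := exists_tendsto_of_mem_alphaSet hy
    rwa [tendsto_nhds_unique hty
      (tendsto_const_nhds.congr fun n => (hψ.apply_of_mem_equilibria hz hzE _).symm)]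

end IsFlowExtensionOn

namespace SeparatedTrajectory

theorem exists_infDist_eq (h : SeparatedTrajectory Φ C ψ x) {G : Set X} (hz : z ∈ omegaSet Φ x)
    (hzG : z ∈ G) (hk : k ∈ omegaSet Φ x) {ρ : ℝ} (hρ : 0 < ρ) (hρk : ρ < infDist k G) :
    ∃ q ∈ omegaSet Φ x, infDist q G = ρ := by
  have hcont : Continuous fun p => infDist p G := continuous_infDist_pt G
  have hex : ∀ n : ℕ, ∃ t, (n : ℝ) ≤ t ∧ infDist (Φ.toFun t x) G = ρ := fun n => by
    obtain ⟨t, -, ht, htz⟩ := exists_tendsto_of_mem_omegaSet hz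
    obtain ⟨t', -, ht', htk⟩ := exists_tendsto_of_mem_omegaSet hk
    have h1 := (hcont.tendsto _).comp htz
    rw [infDist_zero_of_mem hzG] at h1
    have h2 := (hcont.tendsto _).comp htk
    obtain ⟨i, hi, hi'⟩ := ((h1.eventually_lt_const hρ).and (ht.eventually_ge_atTop (n : ℝ))).exists
    obtain ⟨j, hj, hj'⟩ :=
      ((h2.eventually_const_lt hρk).and (ht'.eventually_ge_atTop (n : ℝ))).exists
    have hn : (0 : ℝ) ≤ n := n.cast_nonneg
    obtain ⟨t, htm, hte⟩ := intermediate_value_uIcc (a := t i) (b := t' j)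
      (f := fun t => infDist (Φ.toFun t x) G)
      (hcont.comp_continuousOn ((Φ.continuousOn_time x).mono fun r hr =>
        hn.trans ((le_min hi' hj').trans hr.1))) (mem_uIcc_of_le (le_of_lt hi) (le_of_lt hj))
    exact ⟨t, (le_min hi' hj').trans htm.1, hte⟩
  choose t ht hte using hex
  obtain ⟨q, hq, htq⟩ := h.pre.exists_lim (tendsto_seqFilter_atTop_of_le ht)
  exact ⟨q, hq, tendsto_nhds_unique ((hcont.tendsto q).comp htq)
    (tendsto_const_nhds.congr fun n => (hte n).symm)⟩

theorem exists_follows (h : SeparatedTrajectory Φ C ψ x) (hz : z ∈ omegaSet Φ x) (hτ : 0 < τ)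
    (hper : ψ τ z = z) (hε : 0 < ε) : ∃ ρ > 0, ∀ k ∈ omegaSet Φ x,
      infDist k (range fun u => ψ u z) < ρ → ∃ v, Follows Φ ψ x z π τ ε (ψ v k) := by
  obtain ⟨δ, hδ, hclose⟩ := h.exists_near_flow (π := π) hz 0 (2 * τ) hε
  by_contra! hcon
  choose k hk hkd hkv using fun n : ℕ => hcon (1 / ((n : ℝ) + 1)) (by positivity)
  obtain ⟨q, hq, hkq⟩ := h.pre.isCompact_omegaSet.exists_seqFilter_lim (Eventually.of_forall hk)
  have h0 : infDist q (range fun u => ψ u z) = 0 := by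
    refine tendsto_nhds_unique (((continuous_infDist_pt _).tendsto q).comp hkq)
      (squeeze_zero (fun _ => infDist_nonneg) (fun n => (hkd n).le) ?_)
    exact tendsto_one_div_add_atTop_nhds_zero_nat.mono_left seqFilter_le_atTop
  have hcl := (h.flow.isCompact_range hz hτ.ne' hper).isClosed
  obtain ⟨v, hv⟩ := (hcl.mem_iff_infDist_zero (range_nonempty _)).2 h0
  have h1 := h.flow.tendsto_apply (tendsto_const_nhds (x := -v)) hkq (Eventually.of_forall hk) hq
  rw [← hv, h.flow.map_neg hz] at h1
  obtain ⟨n, hn⟩ := (h1.eventually (ball_mem_nhds z hδ)).exists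
  exact hkv n (-v) ⟨h.flow.2.1 _ _ (hk n), hclose _ (h.flow.2.1 _ _ (hk n)) hn⟩

/-- A limit set that contains a cycle reduces to it. -/
theorem subset_range_of_periodic (h : SeparatedTrajectory Φ C ψ x) (hπ : ConeProjection C π)
    (hz : z ∈ omegaSet Φ x) (hzE : z ∉ equilibria Φ) {T : ℝ} (hT : T ≠ 0) (hTz : ψ T z = z) :
    omegaSet Φ x ⊆ range fun u => ψ u z := by
  intro k hk
  by_contra hkz
  obtain ⟨π', W, τ, ε, w⟩ := h.exists_cycleWindow hπ hz hzE hT hTz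
  set G := range fun u => ψ u z with hG
  have hne : G.Nonempty := range_nonempty _
  have hcl : IsClosed G := (h.flow.isCompact_range hz hT hTz).isClosed
  have hzG : z ∈ G := ⟨0, h.flow.map_zero hz⟩
  have hkG := (hcl.notMem_iff_infDist_pos hne).1 hkz
  obtain ⟨ρ, hρ, hfol⟩ := h.exists_follows (π := π') hz w.pos w.per w.hε
  obtain ⟨ρ₁, h1, h1'⟩ := exists_between (lt_min hρ hkG)
  obtain ⟨k₁, hk₁, hkd₁⟩ := h.exists_infDist_eq hz hzG hk h1 (h1'.trans_le (min_le_right _ _))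
  obtain ⟨v₁, hv₁⟩ := hfol k₁ hk₁ (hkd₁.trans_lt (h1'.trans_le (min_le_left _ _)))
  have hk₁G : k₁ ∉ G := (hcl.notMem_iff_infDist_pos hne).2 (hkd₁ ▸ h1)
  have hkv₁G : ψ v₁ k₁ ∉ G := fun hm => hk₁G ((h.flow.apply_mem_range_iff hz hk₁ v₁).1 hm)
  obtain ⟨T₁, hT₁, -, hTk₁⟩ := w.exists_period h hv₁
  have hT₁0 : T₁ ≠ 0 := by
    have := W.αβ
    intro h0
    linarith
  obtain ⟨m, hm, hmin⟩ := (h.flow.isCompact_range hv₁.mem hT₁0 hTk₁).exists_forall_le'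
    (continuous_infDist_pt G).continuousOn (a := 0) (by
      rintro _ ⟨u, rfl⟩
      refine (hcl.notMem_iff_infDist_pos hne).1 fun hm => hkv₁G ?_
      exact (h.flow.apply_mem_range_iff hz hv₁.mem u).1 hm)
  obtain ⟨ρ₂, h2, h2'⟩ := exists_between (lt_min hm h1)
  have h2m := h2'.trans_le (min_le_left _ _)
  have h21 := (h2'.trans_le (min_le_right _ _)).trans h1'
  obtain ⟨k₂, hk₂, hkd₂⟩ := h.exists_infDist_eq hz hzG hk h2 (h21.trans_le (min_le_right _ _))
  obtain ⟨v₂, hv₂⟩ := hfol k₂ hk₂ (hkd₂.trans_lt (h21.trans_le (min_le_left _ _)))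
  have hkv₂G : ψ v₂ k₂ ∉ G := fun hm => (hcl.notMem_iff_infDist_pos hne).2 (hkd₂ ▸ h2)
    ((h.flow.apply_mem_range_iff hz hk₂ v₂).1 hm)
  refine w.not_three h w.follows_self hv₁ hv₂ (h.flow.ne_of_notMem_range hz hv₁.mem hkv₁G)
    (h.flow.ne_of_notMem_range hz hv₂.mem hkv₂G)
    (h.flow.ne_of_notMem_range hv₁.mem hv₂.mem fun hm => ?_)
  have := hmin k₂ ((h.flow.apply_mem_range_iff hv₁.mem hk₂ v₂).1 hm)
  rw [hkd₂] at this
  linarith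

theorem poincare_bendixson (h : SeparatedTrajectory Φ C ψ x) (hπ : ConeProjection C π) :
    (∃ z ∈ omegaSet Φ x, ∃ T : ℝ, 0 < T ∧ Φ.toFun T z = z ∧ posOrbit Φ z ≠ {z} ∧
      omegaSet Φ x = posOrbit Φ z) ∨
    ∀ z ∈ omegaSet Φ x, omegaSet Φ z ⊆ equilibria Φ ∧ alphaSet ψ z ⊆ equilibria Φ := by
  by_cases hE : ∀ z ∈ omegaSet Φ x, z ∉ equilibria Φ → Function.Injective fun u => ψ u z
  · right
    intro z hz
    by_cases hzE : z ∈ equilibria Φ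
    · exact h.flow.limits_of_mem_equilibria hz hzE
    · exact h.limits_of_injective hπ hz hzE (hE z hz hzE)
  · left
    push Not at hE
    obtain ⟨z, hz, hzE, hninj⟩ := hE
    obtain ⟨T, hT, hTz⟩ : ∃ T > 0, ψ T z = z := by
      have key : ∀ u v, u < v → ψ u z = ψ v z → ∃ T > 0, ψ T z = z := fun u v huv he => by
        refine ⟨v - u, by linarith, ?_⟩
        have := congrArg (ψ (-u)) he
        rw [h.flow.map_neg hz, h.flow.map_add hz] at this
        rw [show v - u = -u + v by ring, ← this]
      simp only [Function.Injective, not_forall] at hninj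
      obtain ⟨u, v, he, hne⟩ := hninj
      rcases lt_or_gt_of_ne hne with huv | huv
      · exact key u v huv he
      · exact key v u huv he.symm
    refine ⟨z, hz, T, hT, by rw [← h.flow.1 T hT.le z hz, hTz],
      fun he => hzE (posOrbit_eq_singleton_iff.1 he), Subset.antisymm (fun k hk => ?_) ?_⟩
    · obtain ⟨u, hu⟩ := h.subset_range_of_periodic hπ hz hzE hT.ne' hTz hk
      obtain ⟨r, hr, hr'⟩ := (h.flow.periodic hz hTz).exists_mem_Ico₀ hT u
      refine ⟨r, hr.1, ?_⟩
      rw [← h.flow.1 r hr.1 z hz]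
      exact (hu.symm.trans hr')
    · rintro _ ⟨t, ht, rfl⟩
      rw [← h.flow.1 t ht z hz]
      exact h.flow.2.1 t z hz

end SeparatedTrajectory

end Cycles

section Main

variable {X : Type*} [NormedAddCommGroup X] [NormedSpace ℝ X] {C : Set X} {Φ : Semiflow X}
  {DΦ : ℝ → X → X →L[ℝ] X} {x : X}

/-- The Poincaré–Bendixson alternative for a precompact pseudo-ordered orbit. -/
theorem poincare_bendixson_of_pseudoOrdered [CompleteSpace X]
    (hSA : StandingAssumptions Φ DΦ C 2) (hΦ : StronglyFocusingMonotone Φ DΦ C)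
    (hpre : PrecompactOrbit Φ x) (hx : PseudoOrdered Φ C x) :
    (∃ z ∈ omegaSet Φ x, ∃ T : ℝ, 0 < T ∧ Φ.toFun T z = z ∧ posOrbit Φ z ≠ {z} ∧
      omegaSet Φ x = posOrbit Φ z) ∨
    ∀ ψ : ℝ → X → X, IsFlowExtensionOn Φ ψ (omegaSet Φ x) →
      ∀ z ∈ omegaSet Φ x, omegaSet Φ z ⊆ equilibria Φ ∧ alphaSet ψ z ⊆ equilibria Φ := by
  refine or_iff_not_imp_left.2 fun hnper ψ hψ => ?_
  have hE : omegaSet Φ x ⊆ equilibria Φ →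
      ∀ z ∈ omegaSet Φ x, omegaSet Φ z ⊆ equilibria Φ ∧ alphaSet ψ z ⊆ equilibria Φ :=
    fun h z hz => hψ.limits_of_mem_equilibria hz (h hz)
  by_cases hinj : InjOn (fun t => Φ.toFun t x) (Ici 0)
  · have h : ConeTrajectory Φ C ψ x := ⟨hSA.1, hΦ.2.2.1, hpre, hψ⟩
    obtain ⟨π, hπ⟩ := exists_coneProjection hSA.2.2.1
    rcases OrderedTrajectory.exists_separatedTrajectory
      ⟨h, fun p hp s => h.orbit_ordered hx hinj hp s⟩ hΦ with h1 | h1 | ⟨y, hy, h1⟩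
    · exact hE h1
    · exact absurd h1 hnper
    · have h2 := h1.poincare_bendixson hπ
      rw [hy] at h2
      exact h2.resolve_left hnper
  · have key : ∀ s t, 0 ≤ s → s < t → Φ.toFun s x = Φ.toFun t x →
        omegaSet Φ x ⊆ equilibria Φ := fun s t hs hst he => by
      have hp : Φ.toFun (t - s) (Φ.toFun s x) = Φ.toFun s x := by
        rw [← Φ.map_add _ _ (by linarith) hs, sub_add_cancel, he]
      have hω := omegaSet_eq_posOrbit_of_periodic (sub_pos.2 hst) hp
      rw [omegaSet_apply hs] at hω
      by_cases h1 : posOrbit Φ (Φ.toFun s x) = {Φ.toFun s x}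
      · rw [hω, h1, singleton_subset_iff]
        exact posOrbit_eq_singleton_iff.1 h1
      · refine absurd ⟨_, ?_, _, sub_pos.2 hst, hp, h1, hω⟩ hnper
        rw [hω]
        exact ⟨0, le_rfl, (Φ.map_zero _).symm⟩
    simp only [InjOn, mem_Ici, not_forall] at hinj
    obtain ⟨s, hs, t, ht, he, hne⟩ := hinj
    rcases lt_or_gt_of_ne hne with hst | hst
    · exact hE (key s t hs hst he)
    · exact hE (key t s ht hst he.symm)

end Main

/-- **Generic Solid Poincaré–Bendixson Theorem (Theorem D).** For a `C^{1,α}`-smooth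
semiflow strongly focusing monotone w.r.t. a cone of rank `2` and an open bounded `D`
with precompact `O⁺(D)`, there is an open dense subset `D' ⊆ D` such that for every
`x ∈ D'`, `ω(x)` is either a nontrivial periodic orbit or a set of equilibria together
with their potential connecting orbits. -/
theorem generic_solid_poincare_bendixson
    {X : Type*} [NormedAddCommGroup X] [NormedSpace ℝ X] [CompleteSpace X]
    (Φ : Semiflow X) (DΦ : ℝ → X → X →L[ℝ] X) (C : Set X)
    (α : ℝ) (hα : α ∈ Set.Ioc (0:ℝ) 1) (hC1α : COneAlpha Φ DΦ α)
    (hSA : StandingAssumptions Φ DΦ C 2)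
    (hSFM : StronglyFocusingMonotone Φ DΦ C)
    (D : Set X) (hDo : IsOpen D) (hDb : Bornology.IsBounded D)
    (hDpre : IsCompact (closure (⋃ x ∈ D, posOrbit Φ x))) :
    ∃ D' : Set X, D' ⊆ D ∧ IsOpen D' ∧ D ⊆ closure D' ∧
      ∀ x ∈ D',
        (∃ z ∈ omegaSet Φ x, ∃ T : ℝ, 0 < T ∧ Φ.toFun T z = z ∧ posOrbit Φ z ≠ {z} ∧
          omegaSet Φ x = posOrbit Φ z) ∨
        (∀ ψ : ℝ → X → X, IsFlowExtensionOn Φ ψ (omegaSet Φ x) →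
          ∀ z ∈ omegaSet Φ x,
            omegaSet Φ z ⊆ equilibria Φ ∧ alphaSet ψ z ⊆ equilibria Φ) := by
  have hm := hSFM.2.2.1
  set S := closure (⋃ x ∈ D, posOrbit Φ x)
  have hS : ∀ y ∈ D, ∀ t, 0 ≤ t → Φ.toFun t y ∈ S := fun y hy t ht =>
    subset_closure (mem_biUnion hy ⟨t, ht, rfl⟩)
  set Q := D ∩ {y | PseudoOrdered Φ C y}
  have hQo : IsOpen Q := hDo.inter (isOpen_pseudoOrdered hSA.1 hm)
  refine ⟨Q ∪ D \ closure Q, union_subset inter_subset_left sdiff_subset,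
    hQo.union (hDo.sdiff isClosed_closure), fun x hx => ?_, ?_⟩
  · by_cases hxQ : x ∈ closure Q
    · exact closure_mono subset_union_left hxQ
    · exact subset_closure (Or.inr ⟨hx, hxQ⟩)
  · rintro x (hx | hx)
    · exact poincare_bendixson_of_pseudoOrdered hSA hSFM ⟨S, hDpre, hS x hx.1⟩ hx.2
    · right
      obtain ⟨r, hr, hball⟩ := Metric.isOpen_iff.1 (hDo.sdiff isClosed_closure) x hx
      have hE : omegaSet Φ x ⊆ equilibria Φ :=
        omegaSet_subset_equilibria hSA.1 hSFM hDpre hr fun y hy =>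
          ⟨hS y (hball hy).1, fun hp => (hball hy).2 (subset_closure ⟨(hball hy).1, hp⟩)⟩
      exact fun ψ hψ z hz => hψ.limits_of_mem_equilibria hz (hE hz)
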